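/- For any R > 0 and α ∈ [0, π/2), let u be the unique entire solution emanating from the planar front in the funnel-shaped domain Ω = Ω_{R,α}, and let u_∞ be the C²_loc(Ω̄) limit of u(t,·) as t → +∞. Then u_∞ is a stable solution of Δu_∞ + f(u_∞) = 0 in Ω̄, i.e. ∫_{Ω̄} (|∇ψ|² − f'(u_∞)ψ²) ≥ 0 for every C¹ function ψ on Ω̄ with compact support. -/

import Mathlib

open Set Filter Topology MeasureTheory

noncomputable section

/-- `ℝ^N` with `N = d+1`, Euclidean structure. -/
abbrev Euc (d : ℕ) := EuclideanSpace ℝ (Fin (d + 1))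

/-- The Euclidean norm of `x' = (x₂,…,x_N)` for `x = (x₁,x') ∈ ℝ^N`. -/
def primeNorm {d : ℕ} (x : Euc d) : ℝ :=
  Real.sqrt (∑ i, if i = 0 then 0 else (x i) ^ 2)

/-- The funnel-shaped domain `Ω = {x : |x'| < h(x₁)}`. -/
def funnel (d : ℕ) (h : ℝ → ℝ) : Set (Euc d) := {x | primeNorm x < h (x 0)}

/-- The Laplacian of `g` at `x`, computed with derivatives taken within the set `s`. -/
def lapW {d : ℕ} (s : Set (Euc d)) (g : Euc d → ℝ) (x : Euc d) : ℝ :=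
  ∑ i, fderivWithin ℝ (fun y => fderivWithin ℝ g s y (EuclideanSpace.single i 1)) s x
      (EuclideanSpace.single i 1)

/-- The quantity `ν·∇g` at a boundary point `x` of the funnel domain `Ω_{R,α}`, where
`ν(x) = (1+h'(x₁)²)^{-1/2}·(-h'(x₁), x'/|x'|)` is the outward unit normal. -/
def neumannLHS {d : ℕ} (h : ℝ → ℝ) (g : Euc d → ℝ) (x : Euc d) : ℝ :=
  (Real.sqrt (1 + deriv h (x 0) ^ 2))⁻¹ *
    (-(deriv h (x 0)) * fderivWithin ℝ g (closure (funnel d h)) x (EuclideanSpace.single 0 1)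
      + ∑ i, if i = 0 then 0 else
          (x i / primeNorm x) *
            fderivWithin ℝ g (closure (funnel d h)) x (EuclideanSpace.single i 1))

/-- The bistable nonlinearity `f`, of class `C^{1,1}`, with positive mass, extended affinely
outside `[0,1]`. -/
structure Bistable (f : ℝ → ℝ) (θ : ℝ) : Prop where
  smooth : ContDiff ℝ 1 f
  lip_deriv : ∃ C : NNReal, LipschitzWith C (deriv f)
  f0 : f 0 = 0
  f1 : f 1 = 0
  df0 : deriv f 0 < 0
  df1 : deriv f 1 < 0
  θmem : θ ∈ Ioo (0 : ℝ) 1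
  neg : ∀ s ∈ Ioo (0 : ℝ) θ, f s < 0
  pos : ∀ s ∈ Ioo θ (1 : ℝ), 0 < f s
  dθ : 0 < deriv f θ
  mass : 0 < ∫ s in (0 : ℝ)..1, f s
  ext_neg : ∀ s < (0 : ℝ), f s = deriv f 0 * s
  ext_pos : ∀ s > (1 : ℝ), f s = deriv f 1 * (s - 1)

/-- The planar traveling front `φ(x₁ - ct)`: `φ'' + cφ' + f(φ) = 0`, `φ(-∞) = 1`,
`φ(+∞) = 0`, `0 < φ < 1`, `φ` decreasing, normalized by `φ(0) = θ`, with speed `c > 0`. -/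
structure PlanarFront (f : ℝ → ℝ) (θ c : ℝ) (φ : ℝ → ℝ) : Prop where
  cpos : 0 < c
  mem : ∀ z : ℝ, φ z ∈ Ioo (0 : ℝ) 1
  smooth : ContDiff ℝ 2 φ
  anti : StrictAnti φ
  ode : ∀ z : ℝ, deriv (deriv φ) z + c * deriv φ z + f (φ z) = 0
  lim_bot : Tendsto φ atBot (nhds 1)
  lim_top : Tendsto φ atTop (nhds 0)
  pin : φ 0 = θ

/-- `h : ℝ → ℝ` defines a funnel-shaped domain `Ω_{R,α}` (of dimension `N = d+1 ≥ 2`) with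
cylinder radius `R`, opening angle `α` and transition parameter `L`. -/
structure IsFunnel (d : ℕ) (R α L : ℝ) (h : ℝ → ℝ) : Prop where
  dpos : 1 ≤ d
  Rpos : 0 < R
  αmem : α ∈ Ico (0 : ℝ) (Real.pi / 2)
  RL : R < L
  smooth : ContDiff ℝ 2 h
  holder : ∃ β : NNReal, 0 < β ∧ (β : ℝ) < 1 ∧ ∃ C : NNReal, HolderWith C β (deriv (deriv h))
  deriv_nonneg : ∀ x : ℝ, 0 ≤ deriv h x
  deriv_le : ∀ x : ℝ, deriv h x ≤ Real.tan α
  left : ∀ x ≤ (0 : ℝ), h x = R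
  right : ∀ x : ℝ, L * Real.cos α ≤ x → h x = x * Real.tan α

/-- An entire solution of `u_t = Δu + f(u)` in `ℝ × Ω̄` (with values in `[0,1]`),
Neumann boundary condition `ν·∇u = 0` on `ℝ × ∂Ω`, emanating from the planar front
`φ(x₁ - ct)` as `t → -∞`. -/
structure IsEntireSolution (d : ℕ) (h f : ℝ → ℝ) (c : ℝ) (φ : ℝ → ℝ)
    (u : ℝ → Euc d → ℝ) : Prop where
  range01 : ∀ t : ℝ, ∀ x ∈ closure (funnel d h), u t x ∈ Icc (0 : ℝ) 1
  time_diff : ∀ x ∈ closure (funnel d h), Differentiable ℝ fun t => u t x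
  space_reg : ∀ t : ℝ, ContDiffOn ℝ 2 (u t) (closure (funnel d h))
  pde : ∀ t : ℝ, ∀ x ∈ closure (funnel d h),
      deriv (fun s => u s x) t = lapW (closure (funnel d h)) (u t) x + f (u t x)
  neumann : ∀ t : ℝ, ∀ x ∈ frontier (funnel d h), neumannLHS h (u t) x = 0
  past : ∀ ε > (0 : ℝ), ∃ T : ℝ, ∀ t ≤ T, ∀ x ∈ closure (funnel d h),
      |u t x - φ (x 0 - c * t)| ≤ ε

/-- Complete propagation: `u(t,x) → 1` as `t → +∞` locally uniformly in `x ∈ Ω̄`. -/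
def CompletePropagation (d : ℕ) (h : ℝ → ℝ) (u : ℝ → Euc d → ℝ) : Prop :=
  TendstoLocallyUniformlyOn u (fun _ => (1 : ℝ)) atTop (closure (funnel d h))

/-- Blocking: `u(t,·)` converges uniformly on `Ω̄`, as `t → +∞`, to a stationary solution
`u_∞` with `u_∞(x) → 0` as `x₁ → +∞`. -/
def Blocked (d : ℕ) (h f : ℝ → ℝ) (u : ℝ → Euc d → ℝ) : Prop :=
  ∃ uinf : Euc d → ℝ,
    TendstoUniformlyOn u uinf atTop (closure (funnel d h)) ∧
    ContDiffOn ℝ 2 uinf (closure (funnel d h)) ∧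
    (∀ x ∈ closure (funnel d h), lapW (closure (funnel d h)) uinf x + f (uinf x) = 0) ∧
    (∀ x ∈ frontier (funnel d h), neumannLHS h uinf x = 0) ∧
    (∀ ε > (0 : ℝ), ∃ A : ℝ, ∀ x ∈ closure (funnel d h), A ≤ x 0 → |uinf x| ≤ ε)

/-- Stability of a solution `U` of `ΔU + f(U) = 0` on `s̄`:
`∫_s (|∇ψ|² - f'(U)ψ²) ≥ 0` for all compactly supported `C¹` functions `ψ`. -/
def StableOn {d : ℕ} (s : Set (Euc d)) (f : ℝ → ℝ) (U : Euc d → ℝ) : Prop :=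
  ∀ ψ : Euc d → ℝ, ContDiff ℝ 1 ψ → HasCompactSupport ψ →
    0 ≤ ∫ x in s, (‖gradient ψ x‖ ^ 2 - deriv f (U x) * ψ x ^ 2)

/-- Joint right-continuity of `v` at `(t, x)` relative to the spatial set `S`. -/
def RightCont {X : Type*} [PseudoMetricSpace X] (S : Set X) (v : ℝ → X → ℝ) (t : ℝ) (x : X) :
    Prop :=
  ∀ ε > 0, ∃ δ > 0, ∀ s, t ≤ s → s < t + δ → ∀ y ∈ S, dist y x < δ → |v s y - v t x| < ε

lemma RightCont.mono {X : Type*} [PseudoMetricSpace X] {S S' : Set X} {v : ℝ → X → ℝ} {t : ℝ}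
    {x : X} (hv : RightCont S v t x) (hS : S' ⊆ S) : RightCont S' v t x := by
  intro ε hε
  obtain ⟨δ, hδ, H⟩ := hv ε hε
  exact ⟨δ, hδ, fun s h1 h2 y hy => H s h1 h2 y (hS hy)⟩

lemma RightCont.sub {X : Type*} [PseudoMetricSpace X] {S : Set X} {v w : ℝ → X → ℝ} {t : ℝ}
    {x : X} (hv : RightCont S v t x) (hw : RightCont S w t x) :
    RightCont S (fun s y => v s y - w s y) t x := by
  intro ε hε
  obtain ⟨δ, hδ, H⟩ := hv (ε / 2) (half_pos hε)
  obtain ⟨δ', hδ', H'⟩ := hw (ε / 2) (half_pos hε)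
  refine ⟨min δ δ', lt_min hδ hδ', fun s h1 h2 y hy hyx => ?_⟩
  have a := H s h1 (h2.trans_le (by gcongr; exact min_le_left _ _)) y hy
    (hyx.trans_le (min_le_left _ _))
  have b := H' s h1 (h2.trans_le (by gcongr; exact min_le_right _ _)) y hy
    (hyx.trans_le (min_le_right _ _))
  rw [abs_lt] at *
  constructor <;> linarith [a.1, a.2, b.1, b.2]

lemma RightCont.comp_add {X : Type*} [PseudoMetricSpace X] {S : Set X} {v : ℝ → X → ℝ} {t : ℝ}
    {x : X} (σ : ℝ) (hv : RightCont S v (t + σ) x) :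
    RightCont S (fun s y => v (s + σ) y) t x := by
  intro ε hε
  obtain ⟨δ, hδ, H⟩ := hv ε hε
  exact ⟨δ, hδ, fun s h1 h2 y hy hyx => H (s + σ) (by linarith) (by linarith) y hy hyx⟩

lemma rightCont_of_continuous {X : Type*} [PseudoMetricSpace X] {S : Set X} {v : ℝ → X → ℝ}
    (hv : Continuous fun p : ℝ × X => v p.1 p.2) (t : ℝ) (x : X) : RightCont S v t x := by
  intro ε hε
  obtain ⟨δ, hδ, H⟩ := Metric.continuous_iff.1 hv (t, x) ε hε
  refine ⟨δ, hδ, fun s h1 h2 y _ hyx => ?_⟩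
  have := H (s, y) (by
    rw [Prod.dist_eq, max_lt_iff]
    exact ⟨by rw [Real.dist_eq, abs_lt]; constructor <;> linarith, hyx⟩)
  simpa [Real.dist_eq] using this

/-- First-contact principle: a function negative at the initial time stays negative on a compact
set provided it cannot touch zero from below for the first time. -/
lemma neg_of_no_first_contact {X : Type*} [PseudoMetricSpace X] {K : Set X} (hK : IsCompact K)
    {z : ℝ → X → ℝ} {t₀ t₁ : ℝ} (h0 : ∀ x ∈ K, z t₀ x < 0)
    (hc : ∀ t, t₀ < t → t ≤ t₁ → ∀ x ∈ K, ContinuousAt (fun s => z s x) t)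
    (hr : ∀ t, t₀ ≤ t → t < t₁ → ∀ x ∈ K, RightCont K z t x)
    (hno : ∀ t, t₀ < t → t ≤ t₁ → ∀ x ∈ K, z t x = 0 → (∀ y ∈ K, z t y ≤ 0) →
      (∀ s, t₀ ≤ s → s < t → z s x < 0) → False) :
    ∀ t, t₀ ≤ t → t ≤ t₁ → ∀ x ∈ K, z t x < 0 := by
  by_contra! hcon
  set B : Set ℝ := {t | t₀ ≤ t ∧ t ≤ t₁ ∧ ∃ x ∈ K, 0 ≤ z t x} with hB
  have hBne : B.Nonempty := by
    obtain ⟨t, h1, h2, x, hx, h3⟩ := hcon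
    exact ⟨t, h1, h2, x, hx, h3⟩
  have hBb : BddBelow B := ⟨t₀, fun t ht => ht.1⟩
  set T := sInf B with hT
  have hT0 : t₀ ≤ T := le_csInf hBne fun t ht => ht.1
  have hT1 : T ≤ t₁ := by
    obtain ⟨t, ht⟩ := hBne
    exact (csInf_le hBb ht).trans ht.2.1
  have hbefore : ∀ s, t₀ ≤ s → s < T → ∀ x ∈ K, z s x < 0 := by
    intro s h1 h2 x hx
    by_contra! h3
    exact absurd (csInf_le hBb (show s ∈ B from ⟨h1, (h2.le.trans hT1), x, hx, h3⟩))
      (not_le.2 h2)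
  have hmem : ∃ x ∈ K, 0 ≤ z T x := by
    by_contra! hneg
    have hTlt : T < t₁ := by
      rcases hT1.lt_or_eq with h | h
      · exact h
      obtain ⟨t, ht⟩ := hBne
      have : t = T := le_antisymm (by rw [h]; exact ht.2.1) (csInf_le hBb ht)
      obtain ⟨x, hx, h3⟩ := ht.2.2
      rw [this] at h3
      exact absurd (hneg x hx) (not_lt.2 h3)
    have hloc : ∀ x ∈ K, ∃ δ > 0, ∀ s, T ≤ s → s < T + δ → ∀ y ∈ K, dist y x < δ →
        z s y < 0 := by
      intro x hx
      obtain ⟨δ, hδ, H⟩ := hr T hT0 hTlt x hx (-(z T x)) (by linarith [hneg x hx])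
      refine ⟨δ, hδ, fun s h1 h2 y hy hyx => ?_⟩
      have := abs_lt.1 (H s h1 h2 y hy hyx)
      linarith [this.2]
    choose! δ hδ hδ' using hloc
    obtain ⟨F, hFK, hF⟩ := hK.elim_nhds_subcover (fun x => Metric.ball x (δ x))
      (fun x hx => Metric.ball_mem_nhds x (hδ x hx))
    have hex : ∃ η > 0, ∀ x ∈ F, η ≤ δ x := by
      rcases F.eq_empty_or_nonempty with h | h
      · exact ⟨1, one_pos, by simp [h]⟩
      · obtain ⟨x, hx, hmin⟩ := F.exists_min_image δ h
        exact ⟨δ x, hδ x (hFK x hx), hmin⟩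
    obtain ⟨η, hη, hηF⟩ := hex
    obtain ⟨t, ht, htT⟩ := exists_lt_of_csInf_lt hBne (show sInf B < T + η by linarith)
    obtain ⟨y, hy, hyz⟩ := ht.2.2
    obtain ⟨x, hxF, hyx⟩ := mem_iUnion₂.1 (hF hy)
    have := hδ' x (hFK x hxF) t (csInf_le hBb ht) (by linarith [hηF x hxF]) y hy hyx
    linarith
  obtain ⟨x, hx, hxz⟩ := hmem
  have hT0' : t₀ < T := by
    rcases hT0.lt_or_eq with h | h
    · exact h
    · rw [← h] at hxz
      exact absurd (h0 x hx) (not_lt.2 hxz)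
  have hle : ∀ y ∈ K, z T y ≤ 0 := by
    intro y hy
    have h1 : Tendsto (fun s => z s y) (𝓝[<] T) (𝓝 (z T y)) :=
      (hc T hT0' hT1 y hy).continuousWithinAt
    refine le_of_tendsto h1 ?_
    filter_upwards [Ioo_mem_nhdsLT hT0'] with s hs
    exact (hbefore s hs.1.le hs.2 y hy).le
  exact hno T hT0' hT1 x hx (le_antisymm (hle x hx) hxz) hle
    fun s h1 h2 => hbefore s h1 h2 x hx

/-- A separately pointwise-Lipschitz function is jointly right-continuous as soon as near-constancy
of an initial slice propagates forward through right-continuous slabs. -/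
lemma rightCont_of_slab_propagation {X : Type*} [MetricSpace X] [LocallyCompactSpace X]
    {u : ℝ → X → ℝ}
    (ht : ∀ t x, ∃ C : ℝ, ∀ᶠ s in 𝓝 t, |u s x - u t x| ≤ C * |s - t|)
    (hx : ∀ t x, ∃ C : ℝ, ∀ᶠ y in 𝓝 x, |u t y - u t x| ≤ C * dist y x)
    (hS : ∀ x₀ : X, ∃ r₀ > 0, ∀ r, 0 < r → r < r₀ → ∀ ε > 0, ∃ τ > 0, ∃ ρ > 0, ∀ a b t₁ : ℝ,
      ∀ x₁ : X, a < b → b ≤ a + τ →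
      (∀ s, a < s → s ≤ b → ∀ y ∈ Metric.closedBall x₀ r, RightCont univ u s y) →
      ∀ e, 0 ≤ e → (∀ y ∈ Metric.closedBall x₀ r, |u a y - u t₁ x₁| ≤ e) →
      ∀ x, dist x x₀ < ρ → |u b x - u t₁ x₁| ≤ e + ε) :
    ∀ t x, RightCont univ u t x := by
  by_contra! hcon
  have hcx : ∀ t, Continuous (u t) := by
    intro t
    rw [continuous_iff_continuousAt]
    intro x
    obtain ⟨C, hC⟩ := hx t x
    rw [ContinuousAt, tendsto_iff_dist_tendsto_zero]
    refine squeeze_zero' (g := fun y => C * dist y x) (Eventually.of_forall fun _ => dist_nonneg)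
      (hC.mono fun y hy => by rw [Real.dist_eq]; exact hy) ?_
    have : Tendsto (fun y => C * dist y x) (𝓝 x) (𝓝 (C * dist x x)) := by
      apply Continuous.tendsto
      fun_prop
    simpa using this
  have hct : ∀ x, Continuous fun t => u t x := by
    intro x
    rw [continuous_iff_continuousAt]
    intro t
    obtain ⟨C, hC⟩ := ht t x
    rw [ContinuousAt, tendsto_iff_dist_tendsto_zero]
    refine squeeze_zero' (g := fun y => C * |y - t|) (Eventually.of_forall fun _ => dist_nonneg)
      (hC.mono fun y hy => by rw [Real.dist_eq]; exact hy) ?_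
    have : Tendsto (fun y => C * |y - t|) (𝓝 t) (𝓝 (C * |t - t|)) := by
      apply Continuous.tendsto
      fun_prop
    simpa using this
  let G : Set (ℝ × X) := {p | RightCont univ u p.1 p.2}
  let F : Set (ℝ × X) := (interior G)ᶜ
  have hFc : IsClosed F := isOpen_interior.isClosed_compl
  have hFne : F.Nonempty := by
    obtain ⟨t, x, h⟩ := hcon
    exact ⟨(t, x), fun h' => h (interior_subset h')⟩
  have hFG : ∀ p, p ∉ F → RightCont univ u p.1 p.2 := fun p hp => by
    have : p ∈ interior G := by simpa [F] using hp
    exact interior_subset this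
  let A : ℕ → Set F := fun n => {p | (∀ s, |s - p.1.1| < 1 / (n + 1 : ℝ) →
      |u s p.1.2 - u p.1.1 p.1.2| ≤ n * |s - p.1.1|) ∧
    (∀ y, dist y p.1.2 < 1 / (n + 1 : ℝ) → |u p.1.1 y - u p.1.1 p.1.2| ≤ n * dist y p.1.2)}
  have hAc : ∀ n, IsClosed (A n) := by
    intro n
    rw [← isSeqClosed_iff_isClosed]
    intro P p hP hlim
    have hn : (0 : ℝ) < 1 / (n + 1 : ℝ) := by positivity
    have hl : Tendsto (fun k => (P k).1) atTop (𝓝 p.1) :=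
      (continuous_subtype_val.tendsto p).comp hlim
    have hl1 : Tendsto (fun k => (P k).1.1) atTop (𝓝 p.1.1) := (continuous_fst.tendsto _).comp hl
    have hl2 : Tendsto (fun k => (P k).1.2) atTop (𝓝 p.1.2) := (continuous_snd.tendsto _).comp hl
    have hd : Tendsto (fun k => |p.1.1 - (P k).1.1|) atTop (𝓝 0) := by
      have := (hl1.const_sub p.1.1).abs
      simpa using this
    have hv : Tendsto (fun k => u (P k).1.1 (P k).1.2) atTop (𝓝 (u p.1.1 p.1.2)) := by
      have h1 : Tendsto (fun k => u p.1.1 (P k).1.2) atTop (𝓝 (u p.1.1 p.1.2)) :=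
        ((hcx _).tendsto _).comp hl2
      have h2 : Tendsto (fun k => u p.1.1 (P k).1.2 - u (P k).1.1 (P k).1.2) atTop (𝓝 0) := by
        refine squeeze_zero_norm' ?_ (by simpa using hd.const_mul (n : ℝ))
        filter_upwards [hd.eventually (gt_mem_nhds hn)] with k hk
        exact (hP k).1 _ hk
      simpa using h1.sub h2
    refine ⟨fun s hs => ?_, fun y hy => ?_⟩
    · have h1 : Tendsto (fun k => |u s (P k).1.2 - u (P k).1.1 (P k).1.2|) atTop
          (𝓝 |u s p.1.2 - u p.1.1 p.1.2|) := (((hcx s).tendsto _ |>.comp hl2).sub hv).abs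
      have h2 : Tendsto (fun k => |s - (P k).1.1|) atTop (𝓝 |s - p.1.1|) :=
        (hl1.const_sub s).abs
      refine le_of_tendsto_of_tendsto h1 (h2.const_mul (n : ℝ)) ?_
      filter_upwards [h2.eventually (gt_mem_nhds hs)] with k hk
      exact (hP k).1 s hk
    · have h1 : Tendsto (fun k => |u (P k).1.1 y - u (P k).1.1 (P k).1.2|) atTop
          (𝓝 |u p.1.1 y - u p.1.1 p.1.2|) := (((hct y).tendsto _ |>.comp hl1).sub hv).abs
      have h2 : Tendsto (fun k => dist y (P k).1.2) atTop (𝓝 (dist y p.1.2)) :=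
        tendsto_const_nhds.dist hl2
      refine le_of_tendsto_of_tendsto h1 (h2.const_mul (n : ℝ)) ?_
      filter_upwards [h2.eventually (gt_mem_nhds hy)] with k hk
      exact (hP k).2 y hk
  have hAU : ⋃ n, A n = univ := by
    rw [eq_univ_iff_forall]
    intro p
    obtain ⟨C, hC⟩ := ht p.1.1 p.1.2
    obtain ⟨C', hC'⟩ := hx p.1.1 p.1.2
    obtain ⟨δ, hδ, H⟩ := Metric.eventually_nhds_iff.1 hC
    obtain ⟨δ', hδ', H'⟩ := Metric.eventually_nhds_iff.1 hC'
    obtain ⟨n, hn⟩ := exists_nat_gt (max (max C C') (max (1 / δ) (1 / δ')))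
    simp only [max_lt_iff] at hn
    obtain ⟨⟨h1, h2⟩, h3, h4⟩ := hn
    have h3' : 1 / (n + 1 : ℝ) < δ := by
      rw [div_lt_comm₀ (by positivity) hδ]; linarith
    have h4' : 1 / (n + 1 : ℝ) < δ' := by
      rw [div_lt_comm₀ (by positivity) hδ']; linarith
    refine mem_iUnion.2 ⟨n, fun s hs => ?_, fun y hy => ?_⟩
    · refine (H (by rw [Real.dist_eq]; linarith)).trans ?_
      gcongr
    · refine (H' (by linarith)).trans ?_
      gcongr
  have : Nonempty F := hFne.to_subtype
  have : LocallyCompactSpace F := hFc.isClosedEmbedding_subtypeVal.locallyCompactSpace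
  obtain ⟨n, p₀, hp₀⟩ := nonempty_interior_of_iUnion_of_closed hAc hAU
  rw [mem_interior_iff_mem_nhds, Metric.mem_nhds_iff] at hp₀
  obtain ⟨R, hR, hball⟩ := hp₀
  have hA : ∀ p : ℝ × X, p ∈ F → dist p p₀.1 < R →
      (∀ s, |s - p.1| < 1 / (n + 1 : ℝ) → |u s p.2 - u p.1 p.2| ≤ n * |s - p.1|) ∧
      (∀ y, dist y p.2 < 1 / (n + 1 : ℝ) → |u p.1 y - u p.1 p.2| ≤ n * dist y p.2) := by
    intro p hp hd
    exact hball (show (⟨p, hp⟩ : F) ∈ Metric.ball p₀ R from hd)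
  refine p₀.2 (mem_interior_iff_mem_nhds.2 (Metric.mem_nhds_iff.2 ⟨R / 2, by positivity, ?_⟩))
  rintro ⟨t₁, x₁⟩ hq
  by_cases hqF : (t₁, x₁) ∈ F
  swap
  · exact hFG _ hqF
  change RightCont univ u t₁ x₁
  rw [Metric.mem_ball] at hq
  intro ε hε
  have hn : (0 : ℝ) < 1 / (n + 1 : ℝ) := by positivity
  obtain ⟨r₀, hr₀, hSx⟩ := hS x₁
  obtain ⟨rc, hrc, hcomp⟩ := Metric.exists_isCompact_closedBall x₁
  obtain ⟨r, hr, hr1⟩ : ∃ r > 0, r < min (min r₀ rc) (min (R / 2) (min (1 / (n + 1 : ℝ) / 2)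
      (ε / 2 / (4 * n + 1)))) := by
    refine exists_between ?_
    simp only [lt_min_iff]
    refine ⟨⟨hr₀, hrc⟩, by positivity, by positivity, by positivity⟩
  simp only [lt_min_iff] at hr1
  obtain ⟨⟨hr0, hrrc⟩, hrR, hrn, hrε⟩ := hr1
  have hK : IsCompact (Metric.closedBall x₁ r) :=
    hcomp.of_isClosed_subset Metric.isClosed_closedBall (Metric.closedBall_subset_closedBall hrrc.le)
  rw [lt_div_iff₀ (by positivity)] at hrε
  obtain ⟨τ, hτ, ρ, hρ, HS⟩ := hSx r hr hr0 (ε / 4) (by positivity)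
  have hin : ∀ t y, t₁ ≤ t → t < t₁ + r → y ∈ Metric.closedBall x₁ r → dist (t, y) p₀.1 < R := by
    intro t y h1 h2 hy
    have : dist (t, y) (t₁, x₁) ≤ r := by
      rw [Prod.dist_eq, max_le_iff]
      exact ⟨by rw [Real.dist_eq, abs_le]; constructor <;> linarith, hy⟩
    have := dist_triangle (t, y) (t₁, x₁) p₀.1
    linarith
  -- slices meeting the exceptional set are almost constant
  have hslice : ∀ t, t₁ ≤ t → t < t₁ + r → (∃ y ∈ Metric.closedBall x₁ r, (t, y) ∈ F) →
      ∀ x ∈ Metric.closedBall x₁ r, |u t x - u t₁ x₁| ≤ 4 * n * r := by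
    rintro t h1 h2 ⟨y, hy, hyF⟩ x hxr
    have a1 := (hA (t, y) hyF (hin t y h1 h2 hy))
    have hyd : dist y x₁ ≤ r := hy
    have hxd : dist x x₁ ≤ r := hxr
    have hxy : dist x y ≤ 2 * r := by
      have := dist_triangle_right x y x₁
      linarith
    have b1 := a1.2 x (by simp only; linarith)
    have b2 := a1.1 t₁ (by simp only; rw [abs_lt]; constructor <;> linarith)
    have b3 := (hA (t₁, x₁) hqF (by linarith)).2 y (by simp only; linarith)
    simp only at b1 b2 b3
    have ht' : |t₁ - t| ≤ r := by rw [abs_le]; constructor <;> linarith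
    have c1 : |u t x - u t y| ≤ n * (2 * r) := b1.trans (by gcongr)
    have c2 : |u t₁ y - u t y| ≤ n * r := b2.trans (by gcongr)
    have c3 : |u t₁ y - u t₁ x₁| ≤ n * r := b3.trans (by gcongr)
    rw [abs_le] at *
    constructor <;> linarith [c1.1, c1.2, c2.1, c2.2, c3.1, c3.2]
  refine ⟨min (min τ ρ) r, by positivity, fun t h1 h2 x _ hxd => ?_⟩
  have hmin1 : min (min τ ρ) r ≤ τ := (min_le_left _ _).trans (min_le_left _ _)
  have hmin2 : min (min τ ρ) r ≤ ρ := (min_le_left _ _).trans (min_le_right _ _)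
  have hmin3 : min (min τ ρ) r ≤ r := min_le_right _ _
  have hxr : x ∈ Metric.closedBall x₁ r := by rw [Metric.mem_closedBall]; linarith
  let T : Set ℝ := Prod.fst '' (F ∩ (Icc t₁ t ×ˢ Metric.closedBall x₁ r))
  have hTc : IsCompact T :=
    ((isCompact_Icc.prod hK).inter_left hFc).image continuous_fst
  have hTne : T.Nonempty := ⟨t₁, (t₁, x₁), ⟨hqF, ⟨le_rfl, h1⟩, by simp [hr.le]⟩, rfl⟩
  obtain ⟨a, haT, hamax⟩ := hTc.exists_isGreatest hTne
  obtain ⟨⟨a', ya⟩, ⟨haF, haI, hya⟩, rfl⟩ := haT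
  simp only [mem_Icc] at haI
  have hsl := hslice a' haI.1 (by linarith [haI.2]) ⟨ya, hya, haF⟩
  rcases haI.2.lt_or_eq with hlt | heq
  · have := HS a' t t₁ x₁ hlt (by linarith [haI.1]) (fun s hs1 hs2 y hy => by
      refine hFG (s, y) fun hsF => ?_
      have : s ≤ a' := hamax ⟨(s, y), ⟨hsF, ⟨haI.1.trans hs1.le, hs2⟩, hy⟩, rfl⟩
      linarith) (4 * n * r) (by positivity) hsl x (by linarith)
    nlinarith
  · have := hsl x hxr
    rw [heq] at this
    nlinarith

/-- The Laplacian computed with Fréchet derivatives on the whole space. -/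
def lap {d : ℕ} (g : Euc d → ℝ) (x : Euc d) : ℝ :=
  ∑ i, fderiv ℝ (fun y => fderiv ℝ g y (EuclideanSpace.single i 1)) x (EuclideanSpace.single i 1)

lemma lapW_eq_lap {d : ℕ} {s : Set (Euc d)} {x : Euc d} (hx : x ∈ interior s) (g : Euc d → ℝ) :
    lapW s g x = lap g x := by
  refine Finset.sum_congr rfl fun i _ => ?_
  have h1 : (fun y => fderivWithin ℝ g s y (EuclideanSpace.single i 1)) =ᶠ[𝓝 x]
      fun y => fderiv ℝ g y (EuclideanSpace.single i 1) := by
    filter_upwards [isOpen_interior.mem_nhds hx] with y hy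
    rw [fderivWithin_of_mem_nhds (mem_interior_iff_mem_nhds.1 hy)]
  rw [fderivWithin_of_mem_nhds (mem_interior_iff_mem_nhds.1 hx), h1.fderiv_eq]

section LapCalculus

variable {d : ℕ} {g k : Euc d → ℝ} {x : Euc d}

lemma ContDiffAt.differentiableAt_fderiv_apply (hg : ContDiffAt ℝ 2 g x) (v : Euc d) :
    DifferentiableAt ℝ (fun y => fderiv ℝ g y v) x :=
  ((hg.fderiv_right (m := 1) (by norm_num)).differentiableAt (by norm_num)).clm_apply
    (differentiableAt_const v)

lemma ContDiffAt.eventually_differentiableAt (hg : ContDiffAt ℝ 2 g x) :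
    ∀ᶠ y in 𝓝 x, DifferentiableAt ℝ g y :=
  (hg.eventually (by norm_num)).mono fun _ hy => hy.differentiableAt (by norm_num)

lemma lap_add (hg : ContDiffAt ℝ 2 g x) (hk : ContDiffAt ℝ 2 k x) :
    lap (fun y => g y + k y) x = lap g x + lap k x := by
  simp only [lap, ← Finset.sum_add_distrib]
  refine Finset.sum_congr rfl fun i _ => ?_
  have : (fun y => fderiv ℝ (fun y => g y + k y) y (EuclideanSpace.single i 1)) =ᶠ[𝓝 x]
      fun y => fderiv ℝ g y (EuclideanSpace.single i 1)
        + fderiv ℝ k y (EuclideanSpace.single i 1) := by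
    filter_upwards [hg.eventually_differentiableAt, hk.eventually_differentiableAt] with y h1 h2
    rw [fderiv_fun_add h1 h2, add_apply]
  rw [this.fderiv_eq, fderiv_fun_add (hg.differentiableAt_fderiv_apply _)
    (hk.differentiableAt_fderiv_apply _), add_apply]

lemma lap_const_mul (c : ℝ) (hg : ContDiffAt ℝ 2 g x) :
    lap (fun y => c * g y) x = c * lap g x := by
  simp only [lap, Finset.mul_sum]
  refine Finset.sum_congr rfl fun i _ => ?_
  have : (fun y => fderiv ℝ (fun y => c * g y) y (EuclideanSpace.single i 1)) =ᶠ[𝓝 x]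
      fun y => c * fderiv ℝ g y (EuclideanSpace.single i 1) := by
    filter_upwards [hg.eventually_differentiableAt] with y h1
    rw [fderiv_const_mul h1, smul_apply, smul_eq_mul]
  rw [this.fderiv_eq, fderiv_const_mul (hg.differentiableAt_fderiv_apply _), smul_apply,
    smul_eq_mul]

lemma lap_const (c : ℝ) : lap (fun _ : Euc d => c) x = 0 := by
  simp [lap]

lemma lap_sub (hg : ContDiffAt ℝ 2 g x) (hk : ContDiffAt ℝ 2 k x) :
    lap (fun y => g y - k y) x = lap g x - lap k x := by
  have := lap_add hg (contDiffAt_const.mul hk : ContDiffAt ℝ 2 (fun y => (-1 : ℝ) * k y) x)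
  rw [lap_const_mul _ hk] at this
  simpa [sub_eq_add_neg] using this

lemma lap_sum {ι : Type*} (s : Finset ι) {G : ι → Euc d → ℝ}
    (hG : ∀ j ∈ s, ContDiffAt ℝ 2 (G j) x) :
    lap (fun y => ∑ j ∈ s, G j y) x = ∑ j ∈ s, lap (G j) x := by
  classical
  induction s using Finset.induction_on with
  | empty => simpa using lap_const (d := d) (x := x) 0
  | insert a s ha ih =>
    simp only [Finset.sum_insert ha]
    rw [lap_add (hG a (Finset.mem_insert_self _ _))
      (ContDiffAt.sum fun j hj => hG j (Finset.mem_insert_of_mem hj)),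
      ih fun j hj => hG j (Finset.mem_insert_of_mem hj)]

lemma gradient_apply_eq (g : Euc d → ℝ) (x v : Euc d) :
    inner ℝ (gradient g x) v = fderiv ℝ g x v := by
  simp [gradient]

lemma sum_fderiv_sq (g : Euc d → ℝ) (x : Euc d) :
    ∑ i, (fderiv ℝ g x (EuclideanSpace.single i 1)) ^ 2 = ‖gradient g x‖ ^ 2 := by
  rw [EuclideanSpace.norm_sq_eq]
  refine Finset.sum_congr rfl fun i _ => ?_
  rw [← gradient_apply_eq, EuclideanSpace.inner_single_right]
  simp

lemma fderiv_gradient_self (g : Euc d → ℝ) (x : Euc d) :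
    fderiv ℝ g x (gradient g x) = ‖gradient g x‖ ^ 2 := by
  rw [← gradient_apply_eq, real_inner_self_eq_norm_sq]

/-- Chain rule for the Laplacian of `Φ ∘ g`. -/
lemma lap_comp {Φ Φ' : ℝ → ℝ} {Φ'' : ℝ} (hΦ : ∀ s, HasDerivAt Φ (Φ' s) s)
    (hΦ' : HasDerivAt Φ' Φ'' (g x)) (hg : ContDiffAt ℝ 2 g x) :
    lap (fun y => Φ (g y)) x = Φ'' * ‖gradient g x‖ ^ 2 + Φ' (g x) * lap g x := by
  rw [← sum_fderiv_sq, lap, lap, Finset.mul_sum, Finset.mul_sum, ← Finset.sum_add_distrib]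
  refine Finset.sum_congr rfl fun i _ => ?_
  have : (fun y => fderiv ℝ (fun y => Φ (g y)) y (EuclideanSpace.single i 1)) =ᶠ[𝓝 x]
      fun y => Φ' (g y) * fderiv ℝ g y (EuclideanSpace.single i 1) := by
    filter_upwards [hg.eventually_differentiableAt] with y h1
    have := ((hΦ (g y)).comp_hasFDerivAt y h1.hasFDerivAt).fderiv
    rw [Function.comp_def] at this
    rw [this, smul_apply, smul_eq_mul]
  rw [this.fderiv_eq]
  have h2 := hΦ'.comp_hasFDerivAt x (hg.differentiableAt (by norm_num)).hasFDerivAt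
  have h3 := (h2.mul (hg.differentiableAt_fderiv_apply (EuclideanSpace.single i 1)).hasFDerivAt).fderiv
  rw [Function.comp_def] at h3
  have h4 : (fun y => Φ' (g y) * fderiv ℝ g y (EuclideanSpace.single i 1)) =
      (fun y => Φ' (g y)) * fun y => fderiv ℝ g y (EuclideanSpace.single i 1) := rfl
  rw [h4, h3]
  simp only [add_apply, smul_apply, smul_eq_mul]
  ring

lemma lap_nonpos_of_isLocalMax (hg : ContDiffAt ℝ 2 g x) (hmax : IsLocalMax g x) :
    lap g x ≤ 0 := by
  refine Finset.sum_nonpos fun i _ => ?_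
  set e : Euc d := EuclideanSpace.single i 1
  by_contra! hpos
  let γ : ℝ → Euc d := fun s => x + s • e
  have hγ : ∀ s, HasDerivAt γ e s := fun s => by
    have := ((hasDerivAt_id s).smul_const e).const_add x
    rwa [one_smul] at this
  have hγ0 : γ 0 = x := by simp [γ]
  have hγt : Tendsto γ (𝓝 0) (𝓝 x) := by
    have := (hγ 0).continuousAt.tendsto
    rwa [hγ0] at this
  have hd : deriv (g ∘ γ) =ᶠ[𝓝 0] fun s => fderiv ℝ g (γ s) e := by
    filter_upwards [hγt.eventually hg.eventually_differentiableAt] with s hs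
    exact (hs.hasFDerivAt.comp_hasDerivAt s (hγ s)).deriv
  have hdd : deriv (deriv (g ∘ γ)) 0 = fderiv ℝ (fun y => fderiv ℝ g y e) x e := by
    rw [hd.deriv_eq]
    have h1 : HasFDerivAt (fun y => fderiv ℝ g y e) (fderiv ℝ (fun y => fderiv ℝ g y e) x) (γ 0) := by
      rw [hγ0]; exact (hg.differentiableAt_fderiv_apply e).hasFDerivAt
    exact (h1.comp_hasDerivAt 0 (hγ 0)).deriv
  have hmax' : IsLocalMax (g ∘ γ) 0 := by
    have := hγt.eventually hmax
    filter_upwards [this] with s hs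
    simpa [hγ0] using hs
  have hcont : ContinuousAt (g ∘ γ) 0 := by
    refine ContinuousAt.comp ?_ (hγ 0).continuousAt
    rw [hγ0]; exact hg.continuousAt
  have hmin : IsLocalMin (g ∘ γ) 0 :=
    isLocalMin_of_deriv_deriv_pos (by rw [hdd]; exact hpos) hmax'.deriv_eq_zero hcont
  have hconst : (g ∘ γ) =ᶠ[𝓝 0] fun _ => (g ∘ γ) 0 := by
    filter_upwards [hmin, hmax'] with s h1 h2
    exact le_antisymm h2 h1
  have h5 : deriv (g ∘ γ) =ᶠ[𝓝 0] fun _ => 0 := by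
    filter_upwards [hconst.deriv] with s hs
    rw [hs]; simp
  have := h5.deriv_eq
  rw [hdd] at this
  simp at this
  linarith

lemma fderiv_normSq_sub (x₀ x v : Euc d) :
    fderiv ℝ (fun y : Euc d => ‖y - x₀‖ ^ 2) x v = 2 * inner ℝ (x - x₀) v := by
  have h := ((hasFDerivAt_id x).sub_const x₀).norm_sq
  have h' : HasFDerivAt (fun y : Euc d => ‖y - x₀‖ ^ 2) _ x := h
  rw [h'.fderiv]
  simp [inner_sub_left]

lemma gradient_normSq_sub (x₀ x : Euc d) :
    gradient (fun y : Euc d => ‖y - x₀‖ ^ 2) x = (2 : ℝ) • (x - x₀) := by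
  refine ext_inner_right ℝ fun v => ?_
  rw [gradient_apply_eq, fderiv_normSq_sub, real_inner_smul_left]

lemma contDiff_normSq_sub (x₀ : Euc d) : ContDiff ℝ 2 (fun y : Euc d => ‖y - x₀‖ ^ 2) :=
  (contDiff_id.sub contDiff_const).norm_sq ℝ

lemma lap_normSq_sub (x₀ x : Euc d) :
    lap (fun y : Euc d => ‖y - x₀‖ ^ 2) x = 2 * (d + 1) := by
  simp only [lap, fderiv_normSq_sub]
  have : ∀ i : Fin (d + 1), fderiv ℝ (fun y : Euc d => 2 * inner ℝ (y - x₀)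
      (EuclideanSpace.single i (1 : ℝ))) x (EuclideanSpace.single i 1) = 2 := by
    intro i
    have h1 : HasFDerivAt (fun y : Euc d => 2 * inner ℝ (y - x₀) (EuclideanSpace.single i (1 : ℝ)))
        ((2 : ℝ) • (innerSL ℝ (EuclideanSpace.single i (1 : ℝ)) : Euc d →L[ℝ] ℝ)) x := by
      have := (((innerSL ℝ (EuclideanSpace.single i (1 : ℝ)) : Euc d →L[ℝ] ℝ).hasFDerivAt
        (x := x)).sub_const (inner ℝ (EuclideanSpace.single i (1 : ℝ)) x₀)).const_mul 2
      refine this.congr_of_eventuallyEq (Eventually.of_forall fun y => ?_)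
      simp [inner_sub_left, real_inner_comm]
    rw [h1.fderiv]
    simp
  simp only [this]
  simp
  ring

end LapCalculus

/-- The homogeneous Neumann condition at a point of the boundary of `{b ≤ 0}`. -/
def NeumannAt {d : ℕ} (b v : Euc d → ℝ) (x : Euc d) : Prop :=
  ∃ L : Euc d →L[ℝ] ℝ, HasFDerivWithinAt v L {y | b y ≤ 0} x ∧ L (gradient b x) = 0

lemma NeumannAt.sub {d : ℕ} {b v w : Euc d → ℝ} {x : Euc d} (hv : NeumannAt b v x)
    (hw : NeumannAt b w x) : NeumannAt b (fun y => v y - w y) x := by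
  obtain ⟨L, h1, h2⟩ := hv
  obtain ⟨L', h1', h2'⟩ := hw
  exact ⟨L - L', h1.sub h1', by simp [h2, h2']⟩

lemma neumannAt_const {d : ℕ} (b : Euc d → ℝ) (c : ℝ) (x : Euc d) :
    NeumannAt b (fun _ => c) x :=
  ⟨0, hasFDerivWithinAt_const _ _ _, by simp⟩

lemma deriv_nonneg_of_neg_before {z : ℝ → ℝ} {z' t₀ t : ℝ} (hz : HasDerivAt z z' t) (ht : t₀ < t)
    (h0 : z t = 0) (hneg : ∀ s, t₀ ≤ s → s < t → z s < 0) : 0 ≤ z' := by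
  have h1 : Tendsto (slope z t) (𝓝[<] t) (𝓝 z') :=
    (hasDerivAt_iff_tendsto_slope.1 hz).mono_left (nhdsWithin_mono _ fun s hs => ne_of_lt hs)
  refine ge_of_tendsto h1 ?_
  filter_upwards [Ioo_mem_nhdsLT ht] with s hs
  rw [slope_def_field, h0]
  have := hneg s hs.1.le hs.2
  exact div_nonneg_of_nonpos (by linarith) (by linarith [hs.2])

/-- Strict parabolic comparison on `{b ≤ 0} ∩ closedBall x₀ r` with Neumann condition on
`{b = 0}` and Dirichlet condition on the sphere. -/
lemma lt_of_parabolic_barrier {d : ℕ} {b : Euc d → ℝ} (hb : ContDiff ℝ 2 b)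
    (hnd : ∀ x, b x = 0 → gradient b x ≠ 0) {x₀ : Euc d} {r : ℝ} {v P : ℝ → Euc d → ℝ}
    {t₀ t₁ : ℝ} {K : Set (Euc d)} (hKdef : K = {x | b x ≤ 0} ∩ Metric.closedBall x₀ r)
    (hvt : ∀ t, t₀ < t → t ≤ t₁ → ∀ x ∈ K, DifferentiableAt ℝ (fun s => v s x) t)
    (hvx : ∀ t, t₀ < t → t ≤ t₁ → ∀ x ∈ K, b x < 0 → ContDiffAt ℝ 2 (v t) x)
    (hvn : ∀ t, t₀ < t → t ≤ t₁ → ∀ x ∈ K, b x = 0 → NeumannAt b (v t) x)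
    (hvr : ∀ t, t₀ ≤ t → t < t₁ → ∀ x ∈ K, RightCont K v t x)
    (hPc : ∀ t, t₀ ≤ t → t < t₁ → ∀ x ∈ K, RightCont K P t x)
    (hPt : ∀ t, t₀ < t → t ≤ t₁ → ∀ x ∈ K, DifferentiableAt ℝ (fun s => P s x) t)
    (hPx : ∀ t, t₀ < t → t ≤ t₁ → ∀ x ∈ K, ContDiffAt ℝ 2 (P t) x)
    (h0 : ∀ x ∈ K, v t₀ x < P t₀ x)
    (hlat : ∀ t, t₀ < t → t ≤ t₁ → ∀ x ∈ K, dist x x₀ = r → v t x < P t x)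
    (hbd : ∀ t, t₀ < t → t ≤ t₁ → ∀ x ∈ K, b x = 0 → 0 < fderiv ℝ (P t) x (gradient b x))
    (hinter : ∀ t, t₀ < t → t ≤ t₁ → ∀ x ∈ K, b x < 0 → v t x = P t x →
      deriv (fun s => P s x) t ≤ deriv (fun s => v s x) t → lap (v t) x ≤ lap (P t) x → False) :
    ∀ t, t₀ ≤ t → t ≤ t₁ → ∀ x ∈ K, v t x < P t x := by
  have hbc : Continuous b := hb.continuous
  have hK : IsCompact K := by
    rw [hKdef]
    exact (isCompact_closedBall x₀ r).inter_left (isClosed_le hbc continuous_const)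
  have key := neg_of_no_first_contact (t₁ := t₁) hK (z := fun t x => v t x - P t x) (t₀ := t₀)
    (fun x hx => by linarith [h0 x hx])
    (fun t h1 h2 x hx => ((hvt t h1 h2 x hx).sub (hPt t h1 h2 x hx)).continuousAt)
    (fun t h1 h2 x hx => (hvr t h1 h2 x hx).sub (hPc t h1 h2 x hx)) ?_
  · intro t h1 h2 x hx
    linarith [key t h1 h2 x hx]
  intro t h1 h2 x hx hzero hle hbefore
  have hxr : dist x x₀ < r := by
    have hx' := hx
    rw [hKdef] at hx'
    refine lt_of_le_of_ne hx'.2 fun h => ?_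
    linarith [hlat t h1 h2 x hx h]
  have hxb : b x ≤ 0 := by rw [hKdef] at hx; exact hx.1
  rcases hxb.lt_or_eq with hlt | heq
  · have hnhds : K ∈ 𝓝 x := by
      rw [hKdef]
      refine inter_mem ?_ ?_
      · filter_upwards [(isOpen_lt hbc continuous_const).mem_nhds hlt] with y hy
        exact le_of_lt hy
      · exact mem_of_superset (Metric.isOpen_ball.mem_nhds hxr) Metric.ball_subset_closedBall
    have hmax : IsLocalMax (fun y => v t y - P t y) x := by
      filter_upwards [hnhds] with y hy
      linarith [hle y hy]
    have hv2 := hvx t h1 h2 x hx hlt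
    have hP2 := hPx t h1 h2 x hx
    have hl := lap_nonpos_of_isLocalMax (hv2.sub hP2) hmax
    rw [lap_sub hv2 hP2] at hl
    refine hinter t h1 h2 x hx hlt (by linarith) ?_ (by linarith)
    have := deriv_nonneg_of_neg_before
      ((hvt t h1 h2 x hx).hasDerivAt.sub (hPt t h1 h2 x hx).hasDerivAt) h1 hzero hbefore
    linarith
  · obtain ⟨M, hM, hM0⟩ := hvn t h1 h2 x hx heq
    have hgrad : 0 < ‖gradient b x‖ ^ 2 := by
      have := norm_pos_iff.2 (hnd x heq)
      positivity
    set n := gradient b x with hn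
    let γ : ℝ → Euc d := fun s => x - s • n
    have hγ : HasDerivAt γ (-n) 0 := by
      have := ((hasDerivAt_id (0 : ℝ)).smul_const n).const_sub x
      rwa [one_smul] at this
    have hγ0 : γ 0 = x := by simp [γ]
    have hγt : Tendsto γ (𝓝[>] 0) (𝓝 x) := by
      have := hγ.continuousAt.tendsto
      rw [hγ0] at this
      exact this.mono_left nhdsWithin_le_nhds
    have slope_tendsto : ∀ {q : ℝ → ℝ} {q' : ℝ}, HasDerivWithinAt q q' (Ioi 0) 0 → q 0 = 0 →
        0 < q' → ∀ᶠ s in 𝓝[>] (0 : ℝ), 0 < q s := by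
      intro q q' hq hq0 hpos
      rw [hasDerivWithinAt_iff_tendsto_slope' (by simp)] at hq
      filter_upwards [hq.eventually (lt_mem_nhds hpos), self_mem_nhdsWithin] with s hs hs0
      rw [slope_def_field, hq0, sub_zero, sub_zero] at hs
      have hs0' : (0 : ℝ) < s := hs0
      rcases div_pos_iff.1 hs with h | h
      · exact h.1
      · linarith [h.2]
    have hbγ : ∀ᶠ s in 𝓝[>] (0 : ℝ), 0 < -(b (γ s)) := by
      have hb' : HasFDerivAt b (fderiv ℝ b x) (γ 0) := by
        rw [hγ0]
        exact (hb.differentiable (by norm_num) x).hasFDerivAt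
      have := (hb'.comp_hasDerivAt 0 hγ).neg.hasDerivWithinAt (s := Ioi 0)
      refine slope_tendsto this (by simp [hγ0, heq]) ?_
      rw [map_neg, neg_neg, hn, fderiv_gradient_self]
      exact hgrad
    have hmem : ∀ᶠ s in 𝓝[>] (0 : ℝ), γ s ∈ K := by
      filter_upwards [hbγ, hγt.eventually (Metric.isOpen_ball.mem_nhds hxr)] with s hs hs'
      rw [hKdef]
      exact ⟨(by linarith : b (γ s) ≤ 0), Metric.ball_subset_closedBall hs'⟩
    have hPd := ((hPx t h1 h2 x hx).differentiableAt (by norm_num)).hasFDerivAt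
    have hd : HasFDerivWithinAt (fun y => v t y - P t y) (M - fderiv ℝ (P t) x)
        {y | b y ≤ 0} (γ 0) := by
      rw [hγ0]
      exact hM.sub hPd.hasFDerivWithinAt
    let S : Set ℝ := {s | b (γ s) ≤ 0}
    have hcomp : HasDerivWithinAt (fun s => v t (γ s) - P t (γ s))
        ((M - fderiv ℝ (P t) x) (-n)) S 0 :=
      hd.comp_hasDerivWithinAt (0 : ℝ) hγ.hasDerivWithinAt (fun s hs => hs)
    have hS : S ∈ 𝓝[>] (0 : ℝ) := by
      filter_upwards [hbγ] with s hs
      exact (by linarith : b (γ s) ≤ 0)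
    have hcomp' : HasDerivWithinAt (fun s => v t (γ s) - P t (γ s))
        ((M - fderiv ℝ (P t) x) (-n)) (Ioi 0) 0 := hcomp.mono_of_mem_nhdsWithin hS
    have := slope_tendsto hcomp' (by simpa [hγ0] using hzero) (by
      have := hbd t h1 h2 x hx heq
      simpa [hM0] using this)
    obtain ⟨s, hs1, hs2⟩ := (this.and hmem).exists
    linarith [hle _ hs2]

/-- A nonnegative supersolution of the heat equation on `K` for times after `t₀`, with nonnegative
normal derivative on `{b = 0}`. -/
structure HeatSuper {d : ℕ} (b : Euc d → ℝ) (K : Set (Euc d)) (t₀ : ℝ) (H : ℝ → Euc d → ℝ) :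
    Prop where
  cont : ∀ t, t₀ ≤ t → ∀ x, ContinuousAt (fun p : ℝ × Euc d => H p.1 p.2) (t, x)
  tdiff : ∀ t, t₀ ≤ t → ∀ x, DifferentiableAt ℝ (fun s => H s x) t
  xdiff : ∀ t, t₀ ≤ t → ContDiff ℝ 2 (H t)
  nonneg : ∀ t, t₀ ≤ t → ∀ x, 0 ≤ H t x
  super : ∀ t, t₀ ≤ t → ∀ x ∈ K, lap (H t) x ≤ deriv (fun s => H s x) t
  normal : ∀ t, t₀ ≤ t → ∀ x ∈ K, b x = 0 → 0 ≤ fderiv ℝ (H t) x (gradient b x)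

lemma HeatSuper.sum {d : ℕ} {b : Euc d → ℝ} {K : Set (Euc d)} {t₀ : ℝ} {ι : Type*} (s : Finset ι)
    {H : ι → ℝ → Euc d → ℝ} (hH : ∀ j ∈ s, HeatSuper b K t₀ (H j)) :
    HeatSuper b K t₀ (fun t x => ∑ j ∈ s, H j t x) where
  cont t ht x := tendsto_finsetSum s fun j hj => (hH j hj).cont t ht x
  tdiff t ht x := DifferentiableAt.fun_sum fun j hj => (hH j hj).tdiff t ht x
  xdiff t ht := ContDiff.sum fun j hj => (hH j hj).xdiff t ht
  nonneg t ht x := Finset.sum_nonneg fun j hj => (hH j hj).nonneg t ht x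
  super t ht x hx := by
    rw [lap_sum s fun j hj => ((hH j hj).xdiff t ht).contDiffAt,
      deriv_fun_sum fun j hj => (hH j hj).tdiff t ht x]
    exact Finset.sum_le_sum fun j hj => (hH j hj).super t ht x hx
  normal t ht x hx hb := by
    rw [fderiv_fun_sum fun j hj => ((hH j hj).xdiff t ht).differentiable (by norm_num) x,
      sum_apply]
    exact Finset.sum_nonneg fun j hj => (hH j hj).normal t ht x hx hb

lemma rightCont_of_continuousAt {X : Type*} [PseudoMetricSpace X] {S : Set X} {v : ℝ → X → ℝ}
    {t : ℝ} {x : X} (hv : ContinuousAt (fun p : ℝ × X => v p.1 p.2) (t, x)) :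
    RightCont S v t x := by
  intro ε hε
  obtain ⟨δ, hδ, H⟩ := Metric.continuousAt_iff.1 hv ε hε
  refine ⟨δ, hδ, fun s h1 h2 y _ hyx => ?_⟩
  have := H (x := (s, y)) (by
    rw [Prod.dist_eq, max_lt_iff]
    exact ⟨by rw [Real.dist_eq, abs_lt]; constructor <;> linarith, hyx⟩)
  simpa [Real.dist_eq] using this

/-- A solution-like function with values in `[0,1]` whose heat defect is at most `C` from above. -/
structure HeatSub {d : ℕ} (b : Euc d → ℝ) (K : Set (Euc d)) (C : ℝ) (u : ℝ → Euc d → ℝ) :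
    Prop where
  tdiff : ∀ x ∈ K, Differentiable ℝ fun t => u t x
  xdiff : ∀ t, ∀ x ∈ K, b x < 0 → ContDiffAt ℝ 2 (u t) x
  neumann : ∀ t, ∀ x ∈ K, b x = 0 → NeumannAt b (u t) x
  mem01 : ∀ t, ∀ x ∈ K, u t x ∈ Icc (0 : ℝ) 1
  defect : ∀ t, ∀ x ∈ K, b x < 0 → deriv (fun s => u s x) t ≤ lap (u t) x + C

lemma HeatSub.lt_barrier {d : ℕ} {b : Euc d → ℝ} (hb : ContDiff ℝ 2 b)
    (hnd : ∀ x, b x = 0 → gradient b x ≠ 0) {x₀ : Euc d} {r C Λ A : ℝ} {u H : ℝ → Euc d → ℝ}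
    {ψ : Euc d → ℝ} {t₀ t₁ : ℝ} {K : Set (Euc d)}
    (hKdef : K = {x | b x ≤ 0} ∩ Metric.closedBall x₀ r) (hu : HeatSub b K C u)
    (hur : ∀ t, t₀ ≤ t → t < t₁ → ∀ x ∈ K, RightCont K u t x)
    (hH : HeatSuper b K t₀ H) (hψ : ContDiff ℝ 2 ψ) (hA : 0 ≤ A) (hΛ : 0 ≤ Λ + C)
    (hψlat : ∀ x ∈ K, dist x x₀ = r → 2 ≤ ψ x)
    (hψn : ∀ x ∈ K, b x = 0 → 0 < fderiv ℝ ψ x (gradient b x))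
    (hψlap : ∀ x ∈ K, lap ψ x ≤ Λ)
    (h0 : ∀ x ∈ K, u t₀ x < A + H t₀ x + ψ x) :
    ∀ t, t₀ ≤ t → t ≤ t₁ → ∀ x ∈ K, u t x < A + H t x + ψ x + (Λ + C + 1) * (t - t₀) := by
  have hPx : ∀ t, t₀ ≤ t → ContDiff ℝ 2
      (fun x => A + H t x + ψ x + (Λ + C + 1) * (t - t₀)) := fun t ht =>
    ((contDiff_const.add (hH.xdiff t ht)).add hψ).add contDiff_const
  have hPt : ∀ t, t₀ ≤ t → ∀ x, HasDerivAt
      (fun s => A + H s x + ψ x + (Λ + C + 1) * (s - t₀))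
      (deriv (fun s => H s x) t + (Λ + C + 1)) t := fun t ht x => by
    have := ((((hH.tdiff t ht x).hasDerivAt.const_add A).add_const (ψ x))).add
      (((hasDerivAt_id t).sub_const t₀).const_mul (Λ + C + 1))
    rw [mul_one] at this
    exact this
  refine lt_of_parabolic_barrier (K := K) hb hnd hKdef
    (P := fun t x => A + H t x + ψ x + (Λ + C + 1) * (t - t₀))
    (fun t h1 h2 x hx => hu.tdiff x hx t) (fun t h1 h2 x hx hbx => hu.xdiff t x hx hbx)
    (fun t h1 h2 x hx hbx => hu.neumann t x hx hbx) hur ?_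
    (fun t h1 h2 x hx => (hPt t h1.le x).differentiableAt)
    (fun t h1 h2 x hx => (hPx t h1.le).contDiffAt)
    (fun x hx => by simpa using h0 x hx) ?_ ?_ ?_
  · intro t h1 h2 x hx
    refine rightCont_of_continuousAt ?_
    have h3 := hH.cont t h1 x
    have h4 : ContinuousAt (fun p : ℝ × Euc d => ψ p.2) (t, x) :=
      (hψ.continuous.comp continuous_snd).continuousAt
    have h5 : ContinuousAt (fun p : ℝ × Euc d => (Λ + C + 1) * (p.1 - t₀)) (t, x) := by fun_prop
    exact ((continuousAt_const.add h3).add h4).add h5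
  · intro t h1 h2 x hx hxr
    have h3 := hψlat x hx hxr
    have h4 := hH.nonneg t h1.le x
    have h5 := (hu.mem01 t x hx).2
    have h6 : 0 ≤ (Λ + C + 1) * (t - t₀) := mul_nonneg (by linarith) (by linarith)
    linarith
  · intro t h1 h2 x hx hbx
    have h3 := hψn x hx hbx
    have h4 := hH.normal t h1.le x hx hbx
    have hd1 := (hH.xdiff t h1.le).differentiable (by norm_num) x
    have hd2 := hψ.differentiable (by norm_num) x
    have : fderiv ℝ (fun x => A + H t x + ψ x + (Λ + C + 1) * (t - t₀)) x =
        fderiv ℝ (H t) x + fderiv ℝ ψ x := by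
      rw [fderiv_add_const, fderiv_fun_add (hd1.const_add A) hd2, fderiv_const_add]
    rw [this, add_apply]
    linarith
  · intro t h1 h2 x hx hbx hval hder hlap
    rw [(hPt t h1.le x).deriv] at hder
    have e1 : lap (fun x => A + H t x + ψ x + (Λ + C + 1) * (t - t₀)) x =
        lap (H t) x + lap ψ x := by
      have c1 : ContDiffAt ℝ 2 (fun x => A + H t x) x :=
        (contDiff_const.add (hH.xdiff t h1.le)).contDiffAt
      rw [lap_add (c1.add hψ.contDiffAt) contDiffAt_const, lap_add c1 hψ.contDiffAt,
        lap_add contDiffAt_const (hH.xdiff t h1.le).contDiffAt, lap_const, lap_const]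
      ring
    rw [e1] at hlap
    linarith [hu.defect t x hx hbx, hψlap x hx, hH.super t h1.le x hx]

/-- The spreading profile `e^k (η²/(t+η²))^m exp(-k q/(t+η²))`. -/
def spread (m k η t q : ℝ) : ℝ :=
  Real.exp (k + 2 * m * Real.log η - m * Real.log (t + η ^ 2) - k * q / (t + η ^ 2))

lemma one_le_spread {m k η q : ℝ} (hη : 0 < η) (hk : 0 ≤ k) (hq : q ≤ η ^ 2) :
    1 ≤ spread m k η 0 q := by
  rw [spread, Real.one_le_exp_iff, zero_add, Real.log_pow]
  have : k * q / η ^ 2 ≤ k := by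
    rw [div_le_iff₀ (by positivity)]
    gcongr
  push_cast
  linarith

lemma spread_le {m k η t q : ℝ} (hη : 0 < η) (hm : 0 ≤ m) (hk : 0 ≤ k) (hq : 0 ≤ q) (ht : 0 < t) :
    spread m k η t q ≤ Real.exp (k - m * Real.log t) * Real.exp (2 * m * Real.log η) := by
  rw [spread, ← Real.exp_add, Real.exp_le_exp]
  have h1 : Real.log t ≤ Real.log (t + η ^ 2) := Real.log_le_log ht (by nlinarith)
  have h2 : 0 ≤ k * q / (t + η ^ 2) := by positivity
  nlinarith [mul_le_mul_of_nonneg_left h1 hm]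

lemma heatSuper_spread {d : ℕ} {b q : Euc d → ℝ} {K : Set (Euc d)} {m k η : ℝ} (t₀ : ℝ)
    (hη : 0 < η) (hk : 0 ≤ k) (hq : ContDiff ℝ 2 q)
    (hgrad : ∀ x ∈ K, k * ‖gradient q x‖ ^ 2 ≤ q x) (hlap : ∀ x ∈ K, m ≤ k * lap q x)
    (hn : ∀ x ∈ K, b x = 0 → fderiv ℝ q x (gradient b x) = 0) :
    HeatSuper b K t₀ (fun t x => spread m k η (t - t₀) (q x)) where
  cont t ht x := by
    have hpos : 0 < t - t₀ + η ^ 2 := by have := sq_pos_of_pos hη; linarith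
    have hqc := hq.continuous
    unfold spread
    refine Real.continuous_exp.continuousAt.comp ?_
    refine ContinuousAt.sub (ContinuousAt.sub continuousAt_const ?_) ?_
    · refine continuousAt_const.mul (ContinuousAt.log (by fun_prop) hpos.ne')
    · exact ContinuousAt.div (by fun_prop) (by fun_prop) hpos.ne'
  tdiff t ht x := by
    have hpos : 0 < t - t₀ + η ^ 2 := by have := sq_pos_of_pos hη; linarith
    unfold spread
    have := hpos.ne'
    fun_prop (disch := assumption)
  xdiff t ht := by
    unfold spread
    fun_prop
  nonneg t ht x := (Real.exp_pos _).le
  super t ht x hx := by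
    have hpos : 0 < t - t₀ + η ^ 2 := by have := sq_pos_of_pos hη; linarith
    set s := t - t₀ + η ^ 2 with hs
    set G := spread m k η (t - t₀) (q x) with hG
    have hGpos : 0 < G := Real.exp_pos _
    have h1 : HasDerivAt (fun τ => spread m k η (τ - t₀) (q x))
        (G * (-(m / s) + k * q x / s ^ 2)) t := by
      have hs1 : HasDerivAt (fun τ => τ - t₀ + η ^ 2) 1 t :=
        ((hasDerivAt_id t).sub_const t₀).add_const _
      have hl := (hs1.log hpos.ne').const_mul m
      have hd := (hasDerivAt_const t (k * q x)).div hs1 hpos.ne'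
      have := ((hl.const_sub (k + 2 * m * Real.log η)).sub hd).exp
      refine this.congr_deriv ?_
      simp only [hG, spread, ← hs, Pi.div_apply, Pi.sub_apply]
      ring
    have hΦ : ∀ w, HasDerivAt (fun w => spread m k η (t - t₀) w)
        (spread m k η (t - t₀) w * (-(k / s))) w := by
      intro w
      have := ((((hasDerivAt_id w).const_mul k).div_const s).const_sub
        (k + 2 * m * Real.log η - m * Real.log s)).exp
      refine this.congr_deriv ?_
      simp only [spread, ← hs, id]
      ring
    have hΦ' := (hΦ (q x)).mul_const (-(k / s))
    rw [h1.deriv, lap_comp hΦ hΦ' hq.contDiffAt, ← hG]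
    have hA := mul_le_mul_of_nonneg_left (hgrad x hx) (by positivity : 0 ≤ G * k / s ^ 2)
    have hB := mul_le_mul_of_nonneg_left (hlap x hx) (by positivity : 0 ≤ G / s)
    have e1 : G * -(k / s) * -(k / s) * ‖gradient q x‖ ^ 2 + G * -(k / s) * lap q x =
        G * k / s ^ 2 * (k * ‖gradient q x‖ ^ 2) - G / s * (k * lap q x) := by
      field_simp
      ring
    have e2 : G * (-(m / s) + k * q x / s ^ 2) = G * k / s ^ 2 * q x - G / s * m := by
      field_simp
      ring
    rw [e1, e2]
    linarith
  normal t ht x hx hbx := by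
    set s := t - t₀ + η ^ 2 with hs
    have hΦ : HasDerivAt (fun w => spread m k η (t - t₀) w)
        (spread m k η (t - t₀) (q x) * (-(k / s))) (q x) := by
      have := ((((hasDerivAt_id (q x)).const_mul k).div_const s).const_sub
        (k + 2 * m * Real.log η - m * Real.log s)).exp
      refine this.congr_deriv ?_
      simp only [spread, ← hs, id]
      ring
    have := (hΦ.comp_hasFDerivAt x (hq.differentiable (by norm_num) x).hasFDerivAt).fderiv
    rw [Function.comp_def] at this
    rw [this, smul_apply, hn x hx hbx, smul_zero]

/-- A compact subset of an open set of small volume is covered by finitely many balls with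
controlled total volume. -/
lemma exists_finset_cover_balls {d : ℕ} {C A : Set (Euc d)} (hC : IsCompact C) (hA : IsOpen A)
    (hCA : C ⊆ A) {κ : ℝ} (hκ : 0 ≤ κ)
    (hvol : volume A ≤ ENNReal.ofReal κ * volume (Metric.ball (0 : Euc d) 1)) :
    ∃ (F : Finset (Euc d)) (ρ : Euc d → ℝ), (∀ y ∈ F, 0 < ρ y) ∧
      (∀ x ∈ C, ∃ y ∈ F, dist x y ≤ 5 * ρ y) ∧ ∑ y ∈ F, ρ y ^ (d + 1) ≤ κ := by
  classical
  have hloc : ∀ x ∈ C, ∃ ρ > 0, Metric.closedBall x ρ ⊆ A := fun x hx =>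
    Metric.nhds_basis_closedBall.mem_iff.1 (hA.mem_nhds (hCA hx))
  choose! ρ hρ hρA using hloc
  obtain ⟨F₀, hF₀C, hF₀⟩ := hC.elim_nhds_subcover (fun x => Metric.closedBall x (ρ x))
    (fun x hx => Metric.closedBall_mem_nhds x (hρ x hx))
  obtain ⟨s, hsF, hdisj, hcov⟩ := Vitali.exists_disjoint_subfamily_covering_enlargement_closedBall
    (F₀ : Set (Euc d)) (fun x => x) ρ (∑ x ∈ F₀, |ρ x|)
    (fun a ha => (le_abs_self _).trans
      (Finset.single_le_sum (f := fun x => |ρ x|) (fun _ _ => abs_nonneg _) ha)) 5 (by norm_num)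
  have hsfin : s.Finite := F₀.finite_toSet.subset hsF
  have hsub : ∀ y ∈ hsfin.toFinset, y ∈ C := fun y hy =>
    hF₀C y (hsF (hsfin.mem_toFinset.1 hy))
  refine ⟨hsfin.toFinset, ρ, fun y hy => hρ y (hsub y hy), ?_, ?_⟩
  · intro x hx
    obtain ⟨z, hz, hxz⟩ := mem_iUnion₂.1 (hF₀ hx)
    obtain ⟨y, hy, hyz⟩ := hcov z hz
    exact ⟨y, hsfin.mem_toFinset.2 hy, hyz hxz⟩
  · have h1 : ∑ y ∈ hsfin.toFinset, volume (Metric.closedBall y (ρ y)) ≤ volume A := by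
      rw [← measure_biUnion_finset (fun x hx y hy hxy => hdisj (hsfin.mem_toFinset.1 hx)
        (hsfin.mem_toFinset.1 hy) hxy) fun y _ => Metric.isClosed_closedBall.measurableSet]
      exact measure_mono (iUnion₂_subset fun y hy => hρA y (hsub y hy))
    have h2 : ∀ y ∈ hsfin.toFinset, volume (Metric.closedBall y (ρ y)) =
        ENNReal.ofReal (ρ y ^ (d + 1)) * volume (Metric.ball (0 : Euc d) 1) := by
      intro y hy
      rw [Measure.addHaar_closedBall _ _ (hρ y (hsub y hy)).le]
      simp
    rw [Finset.sum_congr rfl h2, ← Finset.sum_mul] at h1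
    have h3 := h1.trans hvol
    rw [ENNReal.mul_le_mul_iff_left (Metric.measure_ball_pos _ _ one_pos).ne'
      measure_ball_lt_top.ne, ← ENNReal.ofReal_sum_of_nonneg (fun y hy => by
        have := hρ y (hsub y hy); positivity), ENNReal.ofReal_le_ofReal_iff hκ] at h3
    exact h3

/-- Upper bounds on an interior ball propagate for a short time. -/
lemma HeatSub.interior_slab {d : ℕ} {x₀ : Euc d} {r C : ℝ} (hr : 0 < r) (hC : 0 ≤ C) {ε : ℝ}
    (hε : 0 < ε) : ∃ τ > 0, ∃ ρ > 0, ρ ≤ r ∧ ∀ u : ℝ → Euc d → ℝ,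
      HeatSub (fun _ => -1) (Metric.closedBall x₀ r) C u → ∀ a b, a < b → b ≤ a + τ →
      (∀ s, a < s → s ≤ b → ∀ y ∈ Metric.closedBall x₀ r,
        RightCont (Metric.closedBall x₀ r) u s y) →
      ∀ m, 0 ≤ m → (∀ y ∈ Metric.closedBall x₀ r, u a y ≤ m) →
      ∀ x, dist x x₀ < ρ → u b x ≤ m + ε := by
  set K := Metric.closedBall x₀ r with hK
  set Λ : ℝ := 4 * (d + 1) / r ^ 2 with hΛ
  have hΛ0 : 0 ≤ Λ := by positivity
  set ψ : Euc d → ℝ := fun x => 2 / r ^ 2 * ‖x - x₀‖ ^ 2 with hψ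
  have hψ2 : ContDiff ℝ 2 ψ := contDiff_const.mul (contDiff_normSq_sub x₀)
  have hψ0 : ∀ x, 0 ≤ ψ x := fun x => by positivity
  have hψr : ∀ x, dist x x₀ = r → ψ x = 2 := fun x hx => by
    rw [dist_eq_norm] at hx
    simp only [hψ, hx]
    field_simp
  refine ⟨ε / (4 * (Λ + C + 1)), by positivity, r * min 1 ε / 4, by positivity, ?_, ?_⟩
  · have : min 1 ε ≤ 1 := min_le_left _ _
    nlinarith
  intro u hu a b hab hbτ hur m hm hua x hx
  have hcont : ∀ t, ContinuousOn (u t) K := fun t y hy =>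
    (hu.xdiff t y hy (by norm_num)).continuousAt.continuousWithinAt
  set A : ℝ → Set (Euc d) := fun t => Metric.ball x₀ r ∩ u t ⁻¹' Ioi (m + ε / 8) with hA
  have hAo : ∀ t, IsOpen (A t) := fun t =>
    ((hcont t).mono Metric.ball_subset_closedBall).isOpen_inter_preimage Metric.isOpen_ball
      isOpen_Ioi
  have hAlim : Tendsto (fun t => volume (A t)) (𝓝[>] a) (𝓝 (volume (∅ : Set (Euc d)))) := by
    refine tendsto_measure_of_tendsto_indicator (𝓝[>] a) (fun t => (hAo t).measurableSet)
      (B := Metric.ball x₀ r) Metric.isOpen_ball.measurableSet measure_ball_lt_top.ne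
      (Eventually.of_forall fun t => inter_subset_left) fun y => ?_
    by_cases hy : y ∈ Metric.ball x₀ r
    · have hyK := Metric.ball_subset_closedBall hy
      have h1 : Tendsto (fun t => u t y) (𝓝[>] a) (𝓝 (u a y)) :=
        (hu.tdiff y hyK).continuous.continuousAt.continuousWithinAt
      filter_upwards [h1.eventually (gt_mem_nhds (show u a y < m + ε / 8 by
        linarith [hua y hyK]))] with t ht
      simp only [mem_empty_iff_false, iff_false]
      exact fun h => absurd h.2 (not_lt.2 ht.le)
    · refine Eventually.of_forall fun t => ?_
      simp only [mem_empty_iff_false, iff_false]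
      exact fun h => hy h.1
  set M : ℝ := Real.exp (1 / 4 - ((d + 1 : ℕ) : ℝ) / 2 * Real.log ((b - a) / 2)) * 5 ^ (d + 1)
    with hM
  have hMpos : 0 < M := by positivity
  set κ : ℝ := ε / 4 / M with hκ
  have hκpos : 0 < κ := by positivity
  have hsmall : ∀ᶠ t in 𝓝[>] a,
      volume (A t) < ENNReal.ofReal κ * volume (Metric.ball (0 : Euc d) 1) := by
    refine hAlim.eventually (gt_mem_nhds ?_)
    rw [measure_empty]
    exact ENNReal.mul_pos (by simpa using hκpos) (Metric.measure_ball_pos _ _ one_pos).ne'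
  obtain ⟨t₀, ht₀v, ht₀⟩ := (hsmall.and (Ioo_mem_nhdsGT
    (show a < (a + b) / 2 by linarith))).exists
  set Cc : Set (Euc d) := K ∩ (fun y => u t₀ y - ψ y) ⁻¹' Ici (m + ε / 4) with hCc
  have hCcl : IsClosed Cc :=
    ((hcont t₀).sub hψ2.continuous.continuousOn).preimage_isClosed_of_isClosed
      Metric.isClosed_closedBall isClosed_Ici
  have hCcomp : IsCompact Cc :=
    (isCompact_closedBall x₀ r).of_isClosed_subset hCcl inter_subset_left
  have hCA : Cc ⊆ A t₀ := by
    rintro y ⟨hyK, hy⟩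
    have hy' : m + ε / 4 ≤ u t₀ y - ψ y := hy
    refine ⟨?_, ?_⟩
    · rw [Metric.mem_ball]
      refine lt_of_le_of_ne hyK fun h => ?_
      have := (hu.mem01 t₀ y hyK).2
      rw [hψr y h] at hy'
      linarith
    · have := hψ0 y
      change m + ε / 8 < u t₀ y
      linarith
  obtain ⟨F, ρ, hρ, hcov, hsum⟩ := exists_finset_cover_balls hCcomp (hAo t₀) hCA hκpos.le ht₀v.le
  set N : ℝ := ((d + 1 : ℕ) : ℝ) / 2 with hN
  let H : ℝ → Euc d → ℝ := fun t x =>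
    ∑ y ∈ F, spread N (1 / 4) (5 * ρ y) (t - t₀) (‖x - y‖ ^ 2)
  have hH : HeatSuper (fun _ => (-1 : ℝ)) K t₀ H := by
    refine HeatSuper.sum F fun y hy => heatSuper_spread t₀ (by have := hρ y hy; positivity)
      (by norm_num) (contDiff_normSq_sub y) (fun z _ => ?_) (fun z _ => ?_) (fun z _ hz => ?_)
    · rw [gradient_normSq_sub, norm_smul, mul_pow]
      norm_num
      linarith
    · rw [lap_normSq_sub, hN]
      push_cast
      linarith
    · norm_num at hz
  have hψlap : ∀ y ∈ K, lap ψ y ≤ Λ := fun y _ => by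
    rw [hψ, lap_const_mul _ (contDiff_normSq_sub x₀).contDiffAt, lap_normSq_sub, hΛ]
    apply le_of_eq
    ring
  have hKdef : K = {x | (fun _ : Euc d => (-1 : ℝ)) x ≤ 0} ∩ Metric.closedBall x₀ r := by
    ext y
    simp [hK]
  have hxK : x ∈ K := by
    rw [hK, Metric.mem_closedBall]
    have : min 1 ε ≤ 1 := min_le_left _ _
    nlinarith
  have hmain := hu.lt_barrier (A := m + ε / 4) (t₀ := t₀) (t₁ := b) (Λ := Λ) contDiff_const
    (by intro y hy; norm_num at hy) hKdef
    (fun t h1 h2 y hy => hur t (by linarith [ht₀.1]) h2.le y hy) hH hψ2 (by positivity)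
    (by positivity) (fun y _ hyr => (hψr y hyr).ge) (fun y _ hy => by norm_num at hy) hψlap ?_
    b (by linarith [ht₀.2]) le_rfl x hxK
  · have hHb : H b x ≤ ε / 4 := by
      have hT : 0 < b - t₀ := by linarith [ht₀.2]
      have h1 : ∀ y ∈ F, spread N (1 / 4) (5 * ρ y) (b - t₀) (‖x - y‖ ^ 2) ≤ M * ρ y ^ (d + 1) := by
        intro y hy
        have hρy := hρ y hy
        refine (spread_le (by positivity) (by positivity) (by norm_num) (by positivity) hT).trans ?_
        have e1 : Real.exp (2 * N * Real.log (5 * ρ y)) = 5 ^ (d + 1) * ρ y ^ (d + 1) := by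
          rw [← mul_pow, hN, mul_div_cancel₀ _ two_ne_zero, ← Real.log_pow, Real.exp_log]
          positivity
        rw [e1, hM, mul_assoc]
        gcongr
        linarith [ht₀.2]
      calc H b x ≤ ∑ y ∈ F, M * ρ y ^ (d + 1) := Finset.sum_le_sum h1
        _ = M * ∑ y ∈ F, ρ y ^ (d + 1) := by rw [Finset.mul_sum]
        _ ≤ M * κ := by gcongr
        _ = ε / 4 := by rw [hκ]; field_simp
    have hψx : ψ x ≤ ε / 8 := by
      have h1 : ‖x - x₀‖ ≤ r * min 1 ε / 4 := by rw [← dist_eq_norm]; exact hx.le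
      have h2 : ‖x - x₀‖ ^ 2 ≤ (r * min 1 ε / 4) ^ 2 := by gcongr
      have h3 : min 1 ε * min 1 ε ≤ 1 * ε :=
        mul_le_mul (min_le_left _ _) (min_le_right _ _) (by positivity) (by norm_num)
      calc ψ x ≤ 2 / r ^ 2 * (r * min 1 ε / 4) ^ 2 := by simp only [hψ]; gcongr
        _ = min 1 ε * min 1 ε / 8 := by field_simp; norm_num
        _ ≤ ε / 8 := by linarith
    have hτ : (Λ + C + 1) * (b - t₀) ≤ ε / 4 := by
      have : b - t₀ ≤ ε / (4 * (Λ + C + 1)) := by linarith [ht₀.1]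
      calc (Λ + C + 1) * (b - t₀) ≤ (Λ + C + 1) * (ε / (4 * (Λ + C + 1))) := by gcongr
        _ = ε / 4 := by field_simp
    linarith
  · intro y hy
    by_cases hyC : y ∈ Cc
    · obtain ⟨z, hz, hyz⟩ := hcov y hyC
      have hρz := hρ z hz
      have h1 : 1 ≤ H t₀ y := by
        have h2 : 1 ≤ spread N (1 / 4) (5 * ρ z) (t₀ - t₀) (‖y - z‖ ^ 2) := by
          rw [sub_self]
          refine one_le_spread (by positivity) (by norm_num) ?_
          rw [← dist_eq_norm]
          gcongr
        exact h2.trans (Finset.single_le_sum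
          (f := fun z => spread N (1 / 4) (5 * ρ z) (t₀ - t₀) (‖y - z‖ ^ 2))
          (fun _ _ => (Real.exp_pos _).le) hz)
      have h2 := (hu.mem01 t₀ y hy).2
      have h3 := hψ0 y
      linarith
    · have h1 : u t₀ y - ψ y < m + ε / 4 := by
        by_contra! h
        exact hyC ⟨hy, h⟩
      have h2 := hH.nonneg t₀ le_rfl y
      linarith

lemma contDiff_one_fderiv_apply {d : ℕ} {g : Euc d → ℝ} (hg : ContDiff ℝ 2 g) (v : Euc d) :
    ContDiff ℝ 1 (fun y => fderiv ℝ g y v) :=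
  (hg.fderiv_right (m := 1) (by norm_num)).clm_apply contDiff_const

lemma continuous_lap {d : ℕ} {g : Euc d → ℝ} (hg : ContDiff ℝ 2 g) : Continuous (lap g) := by
  refine continuous_finsetSum _ fun i _ => ?_
  exact ((contDiff_one_fderiv_apply hg _).continuous_fderiv (by norm_num)).clm_apply continuous_const

lemma contDiff_gradient {d : ℕ} {g : Euc d → ℝ} (hg : ContDiff ℝ 2 g) :
    ContDiff ℝ 1 (gradient g) := by
  have h := hg.fderiv_right (m := 1) (by norm_num)
  exact (InnerProductSpace.toDual ℝ (Euc d)).symm.contDiff.comp h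

lemma gradient_sq {d : ℕ} {b : Euc d → ℝ} {x : Euc d} (hb : DifferentiableAt ℝ b x) :
    gradient (fun y => b y ^ 2) x = (2 * b x) • gradient b x := by
  refine ext_inner_right ℝ fun v => ?_
  rw [gradient_apply_eq, real_inner_smul_left, gradient_apply_eq, fderiv_fun_pow 2 hb]
  simp

lemma lap_sq {d : ℕ} {b : Euc d → ℝ} {x : Euc d} (hb : ContDiffAt ℝ 2 b x) :
    lap (fun y => b y ^ 2) x = 2 * ‖gradient b x‖ ^ 2 + 2 * b x * lap b x := by
  have hΦ : ∀ s : ℝ, HasDerivAt (fun s => s ^ 2) (2 * s) s := fun s => by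
    simpa using hasDerivAt_pow 2 s
  have hΦ' : HasDerivAt (fun s : ℝ => 2 * s) 2 (b x) := by
    simpa using (hasDerivAt_id (b x)).const_mul (2 : ℝ)
  exact lap_comp hΦ hΦ' hb

lemma fderiv_exp_mul {d : ℕ} {b : Euc d → ℝ} {x : Euc d} (c : ℝ) (hb : DifferentiableAt ℝ b x)
    (v : Euc d) :
    fderiv ℝ (fun y => Real.exp (c * b y)) x v = Real.exp (c * b x) * (c * fderiv ℝ b x v) := by
  rw [fderiv_exp (hb.const_mul c), fderiv_const_mul hb]
  simp

lemma lap_exp_mul {d : ℕ} {b : Euc d → ℝ} {x : Euc d} (c : ℝ) (hb : ContDiffAt ℝ 2 b x) :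
    lap (fun y => Real.exp (c * b y)) x =
      Real.exp (c * b x) * (c ^ 2 * ‖gradient b x‖ ^ 2 + c * lap b x) := by
  have hΦ : ∀ s : ℝ, HasDerivAt (fun s => Real.exp (c * s)) (Real.exp (c * s) * c) s := fun s => by
    simpa using ((hasDerivAt_id s).const_mul c).exp
  have hΦ' := (hΦ (b x)).mul_const c
  rw [lap_comp hΦ hΦ' hb]
  ring

lemma fderiv_const_mul_add {d : ℕ} {g k : Euc d → ℝ} {x : Euc d} (c e : ℝ)
    (hg : DifferentiableAt ℝ g x) (hk : DifferentiableAt ℝ k x) (v : Euc d) :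
    fderiv ℝ (fun y => c * g y + e * k y) x v = c * fderiv ℝ g x v + e * fderiv ℝ k x v := by
  rw [fderiv_fun_add (hg.const_mul c) (hk.const_mul e), fderiv_const_mul hg, fderiv_const_mul hk]
  simp

set_option maxHeartbeats 1000000 in
/-- Upper bounds near a boundary point propagate for a short time, given right-continuity at
interior points. -/
lemma HeatSub.boundary_slab {d : ℕ} {b : Euc d → ℝ} (hb : ContDiff ℝ 2 b)
    (hnd : ∀ x, b x = 0 → gradient b x ≠ 0) {x₀ : Euc d} (hx₀ : b x₀ = 0) {C : ℝ} (hC : 0 ≤ C) :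
    ∃ r₀ > 0, ∀ r, 0 < r → r < r₀ → ∀ ε > 0, ∃ τ > 0, ∃ ρ > 0, ρ ≤ r ∧ ∀ u : ℝ → Euc d → ℝ,
      ∀ K, K = {x | b x ≤ 0} ∩ Metric.closedBall x₀ r → HeatSub b K C u →
      ∀ a a', a < a' → a' ≤ a + τ → (∀ s, a < s → s ≤ a' → ∀ y ∈ K, RightCont K u s y) →
      (∀ y ∈ K, b y < 0 → RightCont K u a y) →
      ∀ m, 0 ≤ m → (∀ y ∈ K, u a y ≤ m) → ∀ x ∈ K, dist x x₀ < ρ → u a' x ≤ m + ε := by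
  have hbd : ∀ x, DifferentiableAt ℝ b x := fun x => hb.differentiable (by norm_num) x
  have hg : 0 < ‖gradient b x₀‖ := norm_pos_iff.2 (hnd x₀ hx₀)
  set g := ‖gradient b x₀‖ with hgdef
  set l := |lap b x₀| + 1 with hl
  have hlpos : 0 < l := by positivity
  have hgc : Continuous fun x => ‖gradient b x‖ := (contDiff_gradient hb).continuous.norm
  have hlc : Continuous fun x => |lap b x| := (continuous_lap hb).abs
  have hbc : Continuous fun x => |b x| := hb.continuous.abs
  have hev : ∀ᶠ x in 𝓝 x₀, g / 2 < ‖gradient b x‖ ∧ ‖gradient b x‖ < 2 * g ∧ |lap b x| < l ∧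
      |b x| < g ^ 2 / (8 * l) := by
    filter_upwards [hgc.continuousAt.eventually (lt_mem_nhds (show g / 2 < ‖gradient b x₀‖ by
        linarith)), hgc.continuousAt.eventually (gt_mem_nhds (show ‖gradient b x₀‖ < 2 * g by
        linarith)), hlc.continuousAt.eventually (gt_mem_nhds (show |lap b x₀| < l by linarith)),
      hbc.continuousAt.eventually (gt_mem_nhds (show |b x₀| < g ^ 2 / (8 * l) by
        rw [hx₀, abs_zero]; positivity))] with x h1 h2 h3 h4
    exact ⟨h1, h2, h3, h4⟩
  obtain ⟨r₀, hr₀, hball⟩ := Metric.eventually_nhds_iff.1 hev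
  refine ⟨r₀, hr₀, fun r hr hrr ε hε => ?_⟩
  set Λ₁ : ℝ := (8 * g / r + 1) / (ε / 8 * (g / 2) ^ 2) with hΛ₁
  have hΛ₁0 : 0 < Λ₁ := by positivity
  set Λ : ℝ := 4 * (d + 1) / r ^ 2 + ε / 8 * (Λ₁ ^ 2 * (2 * g) ^ 2 + Λ₁ * l) with hΛ
  have hΛ0 : 0 ≤ Λ := by positivity
  set ψ : Euc d → ℝ := fun x => 2 / r ^ 2 * ‖x - x₀‖ ^ 2 + ε / 8 * Real.exp (Λ₁ * b x) with hψ
  have hexp2 : ContDiff ℝ 2 fun x => Real.exp (Λ₁ * b x) :=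
    Real.contDiff_exp.comp (contDiff_const.mul hb)
  have hψ2 : ContDiff ℝ 2 ψ :=
    (contDiff_const.mul (contDiff_normSq_sub x₀)).add (contDiff_const.mul hexp2)
  have hψ0 : ∀ x, 0 ≤ ψ x := fun x => by positivity
  have hψr : ∀ x, dist x x₀ = r → 2 ≤ ψ x := fun x hx => by
    rw [dist_eq_norm] at hx
    have h1 : 2 / r ^ 2 * r ^ 2 = 2 := by field_simp
    have h2 : 0 ≤ ε / 8 * Real.exp (Λ₁ * b x) := by positivity
    simp only [hψ, hx, h1]
    linarith
  refine ⟨ε / (4 * (Λ + C + 1)), by positivity, r * min 1 ε / 4, by positivity, ?_, ?_⟩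
  · have : min 1 ε ≤ 1 := min_le_left _ _
    nlinarith
  intro u K hKdef hu a a' haa haτ hur hura m hm hua x hxK hx
  have hKin : ∀ y ∈ K, g / 2 < ‖gradient b y‖ ∧ ‖gradient b y‖ < 2 * g ∧ |lap b y| < l ∧
      |b y| < g ^ 2 / (8 * l) := by
    intro y hy
    rw [hKdef] at hy
    exact hball (lt_of_le_of_lt hy.2 hrr)
  have hKb : ∀ y ∈ K, b y ≤ 0 := fun y hy => by rw [hKdef] at hy; exact hy.1
  have hKr : ∀ y ∈ K, ‖y - x₀‖ ≤ r := fun y hy => by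
    rw [hKdef] at hy; rw [← dist_eq_norm]; exact hy.2
  have hKc : IsCompact K := by
    rw [hKdef]
    exact (isCompact_closedBall x₀ r).inter_left (isClosed_le hb.continuous continuous_const)
  set k : ℝ := 1 / (4 * (2 * g) ^ 2) with hk
  have hkpos : 0 < k := by positivity
  set N : ℝ := k * (g / 2) ^ 2 with hN
  have hNpos : 0 < N := by positivity
  -- the width of the boundary layer
  obtain ⟨η, hη, hηsmall⟩ : ∃ η > 0,
      Real.exp (k - N * Real.log ((a' - a) / 2)) * Real.exp (2 * N * Real.log η) ≤ ε / 8 := by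
    have h1 : Tendsto (fun η => Real.exp (k - N * Real.log ((a' - a) / 2)) *
        Real.exp (2 * N * Real.log η)) (𝓝[>] 0)
        (𝓝 (Real.exp (k - N * Real.log ((a' - a) / 2)) * 0)) := by
      refine Tendsto.const_mul _ (Real.tendsto_exp_atBot.comp ?_)
      exact Real.tendsto_log_nhdsGT_zero.const_mul_atBot (by positivity)
    rw [mul_zero] at h1
    obtain ⟨η, h2, h3⟩ := ((h1.eventually (gt_mem_nhds (show 0 < ε / 8 by positivity))).and
      self_mem_nhdsWithin).exists
    exact ⟨η, h3, h2.le⟩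
  -- a time at which the bound holds away from the boundary layer
  obtain ⟨t₀, ht₀, ht₀u⟩ : ∃ t₀ ∈ Ioo a ((a + a') / 2), ∀ y ∈ K, b y ≤ -η →
      u t₀ y < m + ε / 4 := by
    have hKη : IsCompact (K ∩ {y | b y ≤ -η}) :=
      hKc.inter_right (isClosed_le hb.continuous continuous_const)
    have hloc : ∀ y ∈ K ∩ {y | b y ≤ -η}, ∃ δ > 0, ∀ s, a ≤ s → s < a + δ → ∀ z ∈ K,
        dist z y < δ → u s z < m + ε / 4 := by
      rintro y ⟨hyK, hyη⟩
      have hyb : b y < 0 := lt_of_le_of_lt hyη (by linarith)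
      obtain ⟨δ, hδ, H⟩ := hura y hyK hyb (ε / 4) (by positivity)
      refine ⟨δ, hδ, fun s h1 h2 z hz hzy => ?_⟩
      have := (abs_lt.1 (H s h1 h2 z hz hzy)).2
      linarith [hua y hyK]
    choose! δ hδ hδ' using hloc
    obtain ⟨F, hFK, hF⟩ := hKη.elim_nhds_subcover (fun y => Metric.ball y (δ y))
      (fun y hy => Metric.ball_mem_nhds y (hδ y hy))
    have hex : ∃ σ > 0, ∀ y ∈ F, σ ≤ δ y := by
      rcases F.eq_empty_or_nonempty with h | h
      · exact ⟨1, one_pos, by simp [h]⟩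
      · obtain ⟨y, hy, hmin⟩ := F.exists_min_image δ h
        exact ⟨δ y, hδ y (hFK y hy), hmin⟩
    obtain ⟨σ, hσ, hσF⟩ := hex
    obtain ⟨t₀, h1, h2⟩ := exists_between
      (show a < min (a + σ) ((a + a') / 2) from lt_min (by linarith) (by linarith))
    refine ⟨t₀, ⟨h1, h2.trans_le (min_le_right _ _)⟩, fun y hy hyη => ?_⟩
    obtain ⟨z, hzF, hyz⟩ := mem_iUnion₂.1 (hF ⟨hy, hyη⟩)
    exact hδ' z (hFK z hzF) t₀ h1.le
      (by linarith [hσF z hzF, h2.trans_le (min_le_left _ _)]) y hy hyz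
  have hH : HeatSuper b K t₀ (fun t y => spread N k η (t - t₀) (b y ^ 2)) := by
    refine heatSuper_spread t₀ hη hkpos.le (hb.pow 2) (fun y hy => ?_) (fun y hy => ?_)
      (fun y _ hy => ?_)
    · have h1 := (hKin y hy).2.1
      rw [gradient_sq (hbd y), norm_smul, mul_pow, Real.norm_eq_abs, sq_abs]
      have h2 : ‖gradient b y‖ ^ 2 ≤ (2 * g) ^ 2 := by gcongr
      have h3 : k * 4 * (2 * g) ^ 2 = 1 := by rw [hk]; field_simp
      calc k * ((2 * b y) ^ 2 * ‖gradient b y‖ ^ 2) = b y ^ 2 * (k * 4 * ‖gradient b y‖ ^ 2) := by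
            ring
        _ ≤ b y ^ 2 * (k * 4 * (2 * g) ^ 2) := by gcongr
        _ = b y ^ 2 := by rw [h3, mul_one]
    · obtain ⟨h1, -, h3, h4⟩ := hKin y hy
      rw [lap_sq hb.contDiffAt, hN]
      refine mul_le_mul_of_nonneg_left ?_ hkpos.le
      have h5 : (g / 2) ^ 2 ≤ ‖gradient b y‖ ^ 2 := by gcongr
      have h6 : |b y * lap b y| ≤ g ^ 2 / (8 * l) * l := by
        rw [abs_mul]; gcongr
      have h7 : g ^ 2 / (8 * l) * l = g ^ 2 / 8 := by field_simp
      rw [h7] at h6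
      have h8 := (abs_le.1 h6).1
      nlinarith
    · rw [← gradient_apply_eq, gradient_sq (hbd y), hy]
      simp
  have hψn : ∀ y ∈ K, b y = 0 → 0 < fderiv ℝ ψ y (gradient b y) := by
    intro y hy hby
    obtain ⟨h1, h2, -, -⟩ := hKin y hy
    rw [hψ, fderiv_const_mul_add _ _ ((contDiff_normSq_sub x₀).differentiable (by norm_num) y)
      (hexp2.differentiable (by norm_num) y), fderiv_normSq_sub, fderiv_exp_mul _ (hbd y), hby,
      fderiv_gradient_self, mul_zero, Real.exp_zero, one_mul]
    have h3 : |inner ℝ (y - x₀) (gradient b y)| ≤ r * (2 * g) :=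
      (abs_real_inner_le_norm _ _).trans (by gcongr; exact hKr y hy)
    have h4 : (g / 2) ^ 2 ≤ ‖gradient b y‖ ^ 2 := by gcongr
    have h5 : ε / 8 * (Λ₁ * (g / 2) ^ 2) = 8 * g / r + 1 := by rw [hΛ₁]; field_simp
    have h6 : ε / 8 * (Λ₁ * (g / 2) ^ 2) ≤ ε / 8 * (Λ₁ * ‖gradient b y‖ ^ 2) := by gcongr
    have h7 : 2 / r ^ 2 * (2 * -(r * (2 * g))) ≤
        2 / r ^ 2 * (2 * inner ℝ (y - x₀) (gradient b y)) := by
      gcongr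
      exact (abs_le.1 h3).1
    have h8 : 2 / r ^ 2 * (2 * -(r * (2 * g))) = -(8 * g / r) := by field_simp; norm_num
    linarith
  have hψlap : ∀ y ∈ K, lap ψ y ≤ Λ := by
    intro y hy
    obtain ⟨-, h2, h3, -⟩ := hKin y hy
    rw [hψ, lap_add (contDiff_const.mul (contDiff_normSq_sub x₀)).contDiffAt
      (contDiff_const.mul hexp2).contDiffAt, lap_const_mul _ (contDiff_normSq_sub x₀).contDiffAt,
      lap_const_mul _ hexp2.contDiffAt, lap_normSq_sub, lap_exp_mul _ hb.contDiffAt, hΛ]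
    have h4 : Real.exp (Λ₁ * b y) ≤ 1 :=
      Real.exp_le_one_iff.2 (mul_nonpos_of_nonneg_of_nonpos hΛ₁0.le (hKb y hy))
    have h5 : Λ₁ ^ 2 * ‖gradient b y‖ ^ 2 + Λ₁ * lap b y ≤ Λ₁ ^ 2 * (2 * g) ^ 2 + Λ₁ * l := by
      gcongr
      exact (le_abs_self _).trans h3.le
    have h6 : Real.exp (Λ₁ * b y) * (Λ₁ ^ 2 * ‖gradient b y‖ ^ 2 + Λ₁ * lap b y) ≤
        1 * (Λ₁ ^ 2 * (2 * g) ^ 2 + Λ₁ * l) :=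
      (mul_le_mul_of_nonneg_left h5 (Real.exp_pos _).le).trans
        (mul_le_mul_of_nonneg_right h4 (by positivity))
    have h7 : 2 / r ^ 2 * (2 * ((d : ℝ) + 1)) = 4 * (d + 1) / r ^ 2 := by ring
    rw [h7]
    rw [one_mul] at h6
    gcongr
  have hmain := hu.lt_barrier (A := m + ε / 4) (t₀ := t₀) (t₁ := a') (Λ := Λ) hb hnd hKdef
    (fun t h1 h2 y hy => hur t (by linarith [ht₀.1]) h2.le y hy) hH hψ2 (by positivity)
    (by positivity) (fun y _ hyr => hψr y hyr) hψn hψlap ?_ a' (by linarith [ht₀.2]) le_rfl x hxK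
  · have hHb : spread N k η (a' - t₀) (b x ^ 2) ≤ ε / 8 := by
      have hT : 0 < a' - t₀ := by linarith [ht₀.2]
      refine (spread_le hη hNpos.le hkpos.le (by positivity) hT).trans (le_trans ?_ hηsmall)
      gcongr
      linarith [ht₀.2]
    have hψx : ψ x ≤ ε / 8 + ε / 8 := by
      have h1 : ‖x - x₀‖ ≤ r * min 1 ε / 4 := by rw [← dist_eq_norm]; exact hx.le
      have h3 : min 1 ε * min 1 ε ≤ 1 * ε :=
        mul_le_mul (min_le_left _ _) (min_le_right _ _) (by positivity) (by norm_num)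
      have h4 : Real.exp (Λ₁ * b x) ≤ 1 :=
        Real.exp_le_one_iff.2 (mul_nonpos_of_nonneg_of_nonpos hΛ₁0.le (hKb x hxK))
      have h5 : 2 / r ^ 2 * ‖x - x₀‖ ^ 2 ≤ ε / 8 := by
        calc 2 / r ^ 2 * ‖x - x₀‖ ^ 2 ≤ 2 / r ^ 2 * (r * min 1 ε / 4) ^ 2 := by gcongr
          _ = min 1 ε * min 1 ε / 8 := by field_simp; norm_num
          _ ≤ ε / 8 := by linarith
      have h6 : ε / 8 * Real.exp (Λ₁ * b x) ≤ ε / 8 * 1 := by gcongr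
      simp only [hψ]
      linarith
    have hτ : (Λ + C + 1) * (a' - t₀) ≤ ε / 4 := by
      have : a' - t₀ ≤ ε / (4 * (Λ + C + 1)) := by linarith [ht₀.1]
      calc (Λ + C + 1) * (a' - t₀) ≤ (Λ + C + 1) * (ε / (4 * (Λ + C + 1))) := by gcongr
        _ = ε / 4 := by field_simp
    linarith
  · intro y hy
    have h3 := hψ0 y
    by_cases hyη : b y ≤ -η
    · have h2 := hH.nonneg t₀ le_rfl y
      linarith [ht₀u y hy hyη]
    · have h1 : 1 ≤ spread N k η (t₀ - t₀) (b y ^ 2) := by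
        rw [sub_self]
        refine one_le_spread hη hkpos.le ?_
        nlinarith [hKb y hy]
      have h2 := (hu.mem01 t₀ y hy).2
      linarith

lemma rightCont_subtype_iff {X : Type*} [PseudoMetricSpace X] {S : Set X} {v : ℝ → X → ℝ} {t : ℝ}
    {x : S} : RightCont univ (fun s (y : S) => v s y) t x ↔ RightCont S v t x := by
  refine forall₂_congr fun ε _ => exists_congr fun δ => and_congr_right fun _ => ?_
  refine forall₃_congr fun s _ _ => ?_
  simp [Subtype.dist_eq]

lemma RightCont.of_mem_nhds {X : Type*} [PseudoMetricSpace X] {S T : Set X} {v : ℝ → X → ℝ}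
    {t : ℝ} {x : X} (hv : RightCont S v t x) (hS : S ∈ 𝓝 x) : RightCont T v t x := by
  intro ε hε
  obtain ⟨δ, hδ, H⟩ := hv ε hε
  obtain ⟨σ, hσ, Hσ⟩ := Metric.mem_nhds_iff.1 hS
  exact ⟨min δ σ, lt_min hδ hσ, fun s h1 h2 y _ hyx =>
    H s h1 (h2.trans_le (by gcongr; exact min_le_left _ _)) y
      (Hσ (hyx.trans_le (min_le_right _ _))) (hyx.trans_le (min_le_left _ _))⟩

lemma RightCont.const_sub {X : Type*} [PseudoMetricSpace X] {S : Set X} {v : ℝ → X → ℝ} {t : ℝ}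
    {x : X} (c : ℝ) (hv : RightCont S v t x) : RightCont S (fun s y => c - v s y) t x := by
  refine RightCont.sub (v := fun _ _ => c) (fun ε hε => ⟨1, one_pos, fun _ _ _ _ _ _ => ?_⟩) hv
  simpa using hε

lemma HeatSub.mono {d : ℕ} {b : Euc d → ℝ} {K K' : Set (Euc d)} {C : ℝ} {u : ℝ → Euc d → ℝ}
    (hu : HeatSub b K C u) (hK : K' ⊆ K) : HeatSub b K' C u where
  tdiff x hx := hu.tdiff x (hK hx)
  xdiff t x hx := hu.xdiff t x (hK hx)
  neumann t x hx := hu.neumann t x (hK hx)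
  mem01 t x hx := hu.mem01 t x (hK hx)
  defect t x hx := hu.defect t x (hK hx)

lemma HeatSub.of_interior {d : ℕ} {b : Euc d → ℝ} {K K' : Set (Euc d)} {C : ℝ}
    {u : ℝ → Euc d → ℝ} (hu : HeatSub b K C u) (hK : K' ⊆ K) (hneg : ∀ x ∈ K', b x < 0) :
    HeatSub (fun _ => -1) K' C u where
  tdiff x hx := hu.tdiff x (hK hx)
  xdiff t x hx _ := hu.xdiff t x (hK hx) (hneg x hx)
  neumann t x hx h := by norm_num at h
  mem01 t x hx := hu.mem01 t x (hK hx)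
  defect t x hx _ := hu.defect t x (hK hx) (hneg x hx)

lemma exists_lipschitz_of_hasFDerivWithinAt {d : ℕ} {g : Euc d → ℝ} {L : Euc d →L[ℝ] ℝ}
    {S : Set (Euc d)} {x : Euc d} (hg : HasFDerivWithinAt g L S x) :
    ∃ C : ℝ, ∀ᶠ y in 𝓝[S] x, |g y - g x| ≤ C * dist y x := by
  obtain ⟨C, hC⟩ := hg.isBigO_sub.bound
  refine ⟨C, hC.mono fun y hy => ?_⟩
  rwa [Real.norm_eq_abs, ← dist_eq_norm] at hy

lemma exists_lipschitz_of_hasDerivAt {g : ℝ → ℝ} {g' t : ℝ} (hg : HasDerivAt g g' t) :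
    ∃ C : ℝ, ∀ᶠ s in 𝓝 t, |g s - g t| ≤ C * |s - t| := by
  obtain ⟨C, hC⟩ := hg.isBigO_sub.bound
  exact ⟨C, hC.mono fun y hy => hy⟩

section JointContinuity

variable {d : ℕ} {b : Euc d → ℝ} {C : ℝ} {u : ℝ → Euc d → ℝ}

lemma HeatSub.abs_interior_slab (hC : 0 ≤ C) (hu : HeatSub b {x | b x ≤ 0} C u)
    (hu' : HeatSub b {x | b x ≤ 0} C fun t x => 1 - u t x) {x₀ : Euc d} {r : ℝ} (hr : 0 < r)
    (hball : ∀ y ∈ Metric.closedBall x₀ r, b y < 0) {ε : ℝ} (hε : 0 < ε) :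
    ∃ τ > 0, ∃ ρ > 0, ∀ a a' c : ℝ, c ∈ Icc (0 : ℝ) 1 → a < a' → a' ≤ a + τ →
      (∀ s, a < s → s ≤ a' → ∀ y ∈ Metric.closedBall x₀ r,
        RightCont (Metric.closedBall x₀ r) u s y) →
      ∀ e, 0 ≤ e → (∀ y ∈ Metric.closedBall x₀ r, |u a y - c| ≤ e) →
      ∀ x, dist x x₀ < ρ → |u a' x - c| ≤ e + ε := by
  obtain ⟨τ, hτ, ρ, hρ, -, H⟩ := HeatSub.interior_slab (x₀ := x₀) hr hC hε
  have hsub : Metric.closedBall x₀ r ⊆ {x | b x ≤ 0} := fun y hy => (hball y hy).le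
  refine ⟨τ, hτ, ρ, hρ, fun a a' c hc haa haτ hrc e he hae x hx => ?_⟩
  have h1 := H u (hu.of_interior hsub hball) a a' haa haτ hrc (c + e) (by linarith [hc.1])
    (fun y hy => by linarith [(abs_le.1 (hae y hy)).2]) x hx
  have h2 := H _ (hu'.of_interior hsub hball) a a' haa haτ
    (fun s h1 h2 y hy => (hrc s h1 h2 y hy).const_sub 1) (1 - c + e) (by linarith [hc.2])
    (fun y hy => by linarith [(abs_le.1 (hae y hy)).1]) x hx
  rw [abs_le]
  constructor <;> linarith

lemma HeatSub.exists_time_lipschitz (hu : HeatSub b {x | b x ≤ 0} C u) (t : ℝ) {x : Euc d}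
    (hx : b x ≤ 0) : ∃ M : ℝ, ∀ᶠ s in 𝓝 t, |u s x - u t x| ≤ M * |s - t| :=
  exists_lipschitz_of_hasDerivAt (hu.tdiff x hx t).hasDerivAt

lemma HeatSub.exists_space_lipschitz (hu : HeatSub b {x | b x ≤ 0} C u) (t : ℝ) {x : Euc d}
    (hx : b x ≤ 0) :
    ∃ M : ℝ, ∀ᶠ y in 𝓝[{x | b x ≤ 0}] x, |u t y - u t x| ≤ M * dist y x := by
  rcases hx.lt_or_eq with h | h
  · exact exists_lipschitz_of_hasFDerivWithinAt
      ((hu.xdiff t x hx h).differentiableAt (by norm_num)).hasFDerivAt.hasFDerivWithinAt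
  · obtain ⟨L, hL, -⟩ := hu.neumann t x hx h
    exact exists_lipschitz_of_hasFDerivWithinAt hL

lemma HeatSub.rightCont_interior (hb : Continuous b) (hC : 0 ≤ C)
    (hu : HeatSub b {x | b x ≤ 0} C u)
    (hu' : HeatSub b {x | b x ≤ 0} C fun t x => 1 - u t x) :
    ∀ t x, b x < 0 → RightCont {x | b x < 0} u t x := by
  have hO : IsOpen {x | b x < 0} := isOpen_lt hb continuous_const
  have : LocallyCompactSpace {x | b x < 0} := hO.locallyCompactSpace
  have key := rightCont_of_slab_propagation (X := {x | b x < 0}) (u := fun t y => u t y)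
    (fun t x => hu.exists_time_lipschitz t (le_of_lt x.2)) (fun t x => ?_) ?_
  · intro t x hx
    exact (rightCont_subtype_iff (S := {x | b x < 0}) (v := u) (x := ⟨x, hx⟩)).1 (key t ⟨x, hx⟩)
  · obtain ⟨M, hM⟩ := hu.exists_space_lipschitz t (le_of_lt x.2)
    refine ⟨M, ?_⟩
    have h1 : Tendsto (Subtype.val : {x | b x < 0} → Euc d) (𝓝 x) (𝓝[{x | b x ≤ 0}] x.1) :=
      tendsto_nhdsWithin_iff.2 ⟨continuous_subtype_val.continuousAt,
        Eventually.of_forall fun y => (le_of_lt (show b y.1 < 0 from y.2) : b y.1 ≤ 0)⟩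
    exact h1.eventually hM
  · intro x₀
    obtain ⟨r₀, hr₀, hsub⟩ := Metric.nhds_basis_closedBall.mem_iff.1 (hO.mem_nhds x₀.2)
    refine ⟨r₀, hr₀, fun r hr hrr ε hε => ?_⟩
    have hsubr : Metric.closedBall x₀.1 r ⊆ {x | b x < 0} :=
      (Metric.closedBall_subset_closedBall hrr.le).trans hsub
    obtain ⟨τ, hτ, ρ, hρ, H⟩ := hu.abs_interior_slab hC hu' hr (fun y hy => hsubr hy) hε
    refine ⟨τ, hτ, ρ, hρ, fun a a' t₁ x₁ haa haτ hrc e he hae x hx => ?_⟩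
    refine H a a' _ (hu.mem01 t₁ x₁ (show b x₁.1 ≤ 0 from le_of_lt x₁.2)) haa haτ (fun s h1 h2 y hy => ?_) e he
      (fun y hy => hae ⟨y, hsubr hy⟩ hy) x hx
    exact ((rightCont_subtype_iff (S := {x | b x < 0}) (v := u) (x := ⟨y, hsubr hy⟩)).1
      (hrc s h1 h2 ⟨y, hsubr hy⟩ hy)).mono hsubr

/-- Joint right-continuity, up to the boundary, of functions with bounded heat defect. -/
theorem HeatSub.rightCont (hb : ContDiff ℝ 2 b) (hnd : ∀ x, b x = 0 → gradient b x ≠ 0)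
    (hC : 0 ≤ C) (hu : HeatSub b {x | b x ≤ 0} C u)
    (hu' : HeatSub b {x | b x ≤ 0} C fun t x => 1 - u t x) :
    ∀ t x, b x ≤ 0 → RightCont {x | b x ≤ 0} u t x := by
  have hinter := hu.rightCont_interior hb.continuous hC hu'
  have hO : IsOpen {x | b x < 0} := isOpen_lt hb.continuous continuous_const
  have hD : IsClosed {x | b x ≤ 0} := isClosed_le hb.continuous continuous_const
  have : LocallyCompactSpace {x | b x ≤ 0} := hD.isClosedEmbedding_subtypeVal.locallyCompactSpace
  have key := rightCont_of_slab_propagation (X := {x | b x ≤ 0}) (u := fun t y => u t y)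
    (fun t x => hu.exists_time_lipschitz t x.2) (fun t x => ?_) ?_
  · intro t x hx
    exact (rightCont_subtype_iff (S := {x | b x ≤ 0}) (v := u) (x := ⟨x, hx⟩)).1 (key t ⟨x, hx⟩)
  · obtain ⟨M, hM⟩ := hu.exists_space_lipschitz t x.2
    refine ⟨M, ?_⟩
    have h1 : Tendsto (Subtype.val : {x | b x ≤ 0} → Euc d) (𝓝 x) (𝓝[{x | b x ≤ 0}] x.1) :=
      tendsto_nhdsWithin_iff.2 ⟨continuous_subtype_val.continuousAt,
        Eventually.of_forall fun y => y.2⟩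
    exact h1.eventually hM
  · intro x₀
    have hx₀ : b x₀.1 ≤ 0 := x₀.2
    rcases hx₀.lt_or_eq with hlt | heq
    · obtain ⟨r₀, hr₀, hsub⟩ := Metric.nhds_basis_closedBall.mem_iff.1 (hO.mem_nhds hlt)
      refine ⟨r₀, hr₀, fun r hr hrr ε hε => ?_⟩
      have hsubr : Metric.closedBall x₀.1 r ⊆ {x | b x < 0} :=
        (Metric.closedBall_subset_closedBall hrr.le).trans hsub
      obtain ⟨τ, hτ, ρ, hρ, H⟩ := hu.abs_interior_slab hC hu' hr (fun y hy => hsubr hy) hε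
      refine ⟨τ, hτ, ρ, hρ, fun a a' t₁ x₁ haa haτ hrc e he hae x hx => ?_⟩
      refine H a a' _ (hu.mem01 t₁ x₁ x₁.2) haa haτ (fun s h1 h2 y hy => ?_) e he
        (fun y hy => hae ⟨y, (show b y ≤ 0 from le_of_lt (hsubr hy))⟩ hy) x hx
      exact (hinter s y (hsubr hy)).of_mem_nhds (hO.mem_nhds (hsubr hy))
    · obtain ⟨r₀, hr₀, HB⟩ := HeatSub.boundary_slab hb hnd heq hC
      refine ⟨r₀, hr₀, fun r hr hrr ε hε => ?_⟩
      obtain ⟨τ, hτ, ρ, hρ, hρr, H⟩ := HB r hr hrr ε hε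
      refine ⟨τ, hτ, ρ, hρ, fun a a' t₁ x₁ haa haτ hrc e he hae x hx => ?_⟩
      set K := {x | b x ≤ 0} ∩ Metric.closedBall x₀.1 r with hK
      have hKD : K ⊆ {x | b x ≤ 0} := inter_subset_left
      have hc := hu.mem01 t₁ x₁ x₁.2
      have hrcK : ∀ s, a < s → s ≤ a' → ∀ y ∈ K, RightCont K u s y := fun s h1 h2 y hy =>
        ((rightCont_subtype_iff (S := {x | b x ≤ 0}) (v := u) (x := ⟨y, hKD hy⟩)).1
          (hrc s h1 h2 ⟨y, hKD hy⟩ hy.2)).mono hKD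
      have hrca : ∀ y ∈ K, b y < 0 → RightCont K u a y := fun y hy hby =>
        (hinter a y hby).of_mem_nhds (hO.mem_nhds hby)
      have hxK : x.1 ∈ K := ⟨x.2, (hx.le.trans hρr : dist x x₀ ≤ r)⟩
      have h1 := H u K rfl (hu.mono hKD) a a' haa haτ hrcK hrca (u t₁ x₁ + e)
        (by linarith [hc.1])
        (fun y hy => by linarith [(abs_le.1 (hae ⟨y, hKD hy⟩ hy.2)).2]) x hxK hx
      have h2 := H _ K rfl (hu'.mono hKD) a a' haa haτ
        (fun s h1 h2 y hy => (hrcK s h1 h2 y hy).const_sub 1)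
        (fun y hy hby => (hrca y hy hby).const_sub 1) (1 - u t₁ x₁ + e) (by linarith [hc.2])
        (fun y hy => by linarith [(abs_le.1 (hae ⟨y, hKD hy⟩ hy.2)).1]) x hxK hx
      rw [abs_le]
      constructor <;> linarith

end JointContinuity

section Geometry

variable {d : ℕ} {h : ℝ → ℝ} {R α L : ℝ}

/-- The defining function `|x'|² - h(x₁)²` of the funnel. -/
def wall (h : ℝ → ℝ) (x : Euc d) : ℝ := ∑ i : Fin d, x i.succ ^ 2 - h (x 0) ^ 2

lemma primeNorm_eq (x : Euc d) : primeNorm x = Real.sqrt (∑ i : Fin d, x i.succ ^ 2) := by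
  simp [primeNorm, Fin.sum_univ_succ]

lemma primeNorm_sq (x : Euc d) : primeNorm x ^ 2 = ∑ i : Fin d, x i.succ ^ 2 := by
  rw [primeNorm_eq, Real.sq_sqrt (Finset.sum_nonneg fun i _ => sq_nonneg _)]

lemma primeNorm_nonneg (x : Euc d) : 0 ≤ primeNorm x := Real.sqrt_nonneg _

lemma wall_eq (h : ℝ → ℝ) (x : Euc d) : wall h x = primeNorm x ^ 2 - h (x 0) ^ 2 := by
  rw [primeNorm_sq, wall]

lemma norm_sq_eq_add_primeNorm_sq (x : Euc d) : ‖x‖ ^ 2 = x 0 ^ 2 + primeNorm x ^ 2 := by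
  rw [EuclideanSpace.real_norm_sq_eq, Fin.sum_univ_succ, primeNorm_sq]

lemma contDiff_wall (hh : ContDiff ℝ 2 h) : ContDiff ℝ 2 (wall h : Euc d → ℝ) := by
  unfold wall
  have h0 : ContDiff ℝ 2 fun x : Euc d => h (x 0) := hh.comp (by fun_prop)
  fun_prop

lemma fderiv_wall (hh : ContDiff ℝ 2 h) (x v : Euc d) :
    fderiv ℝ (wall h) x v =
      2 * (∑ i : Fin d, x i.succ * v i.succ - h (x 0) * deriv h (x 0) * v 0) := by
  have hco : ∀ i : Fin (d + 1), HasFDerivAt (fun y : Euc d => y i)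
      (EuclideanSpace.proj (𝕜 := ℝ) i : Euc d →L[ℝ] ℝ) x := fun i =>
    (EuclideanSpace.proj (𝕜 := ℝ) i : Euc d →L[ℝ] ℝ).hasFDerivAt
  have h1 : HasFDerivAt (fun y : Euc d => h (y 0))
      (deriv h (x 0) • (EuclideanSpace.proj (𝕜 := ℝ) 0 : Euc d →L[ℝ] ℝ)) x :=
    (hh.differentiable (by norm_num) (x 0)).hasDerivAt.comp_hasFDerivAt x (hco 0)
  have h2 := (HasFDerivAt.fun_sum (u := Finset.univ) fun i _ => (hco (Fin.succ i)).pow 2).sub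
    (h1.pow 2)
  have h3 : HasFDerivAt (wall h) _ x := h2
  rw [h3.fderiv]
  have hp : ∀ i : Fin (d + 1), (EuclideanSpace.proj (𝕜 := ℝ) i : Euc d →L[ℝ] ℝ) v = v i :=
    fun _ => rfl
  simp only [sub_apply, sum_apply, smul_apply, hp, smul_eq_mul, nsmul_eq_mul]
  rw [mul_sub, Finset.mul_sum]
  congr 1
  · exact Finset.sum_congr rfl fun i _ => by push_cast; ring
  · push_cast; ring

lemma fderiv_wall_single_zero (hh : ContDiff ℝ 2 h) (x : Euc d) :
    fderiv ℝ (wall h) x (EuclideanSpace.single 0 1) = -2 * (h (x 0) * deriv h (x 0)) := by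
  rw [fderiv_wall hh]; simp [Fin.succ_ne_zero]

lemma fderiv_wall_single_succ (hh : ContDiff ℝ 2 h) (x : Euc d) (i : Fin d) :
    fderiv ℝ (wall h) x (EuclideanSpace.single i.succ 1) = 2 * x i.succ := by
  rw [fderiv_wall hh]
  simp [(Fin.succ_ne_zero i).symm]

lemma gradient_apply_coord (g : Euc d → ℝ) (x : Euc d) (i : Fin (d + 1)) :
    gradient g x i = fderiv ℝ g x (EuclideanSpace.single i 1) := by
  rw [← gradient_apply_eq, EuclideanSpace.inner_single_right]
  simp

lemma norm_gradient_wall_sq (hh : ContDiff ℝ 2 h) (x : Euc d) :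
    ‖gradient (wall h) x‖ ^ 2 = 4 * ((h (x 0) * deriv h (x 0)) ^ 2 + primeNorm x ^ 2) := by
  rw [← sum_fderiv_sq, Fin.sum_univ_succ, fderiv_wall_single_zero hh, primeNorm_sq]
  simp only [fderiv_wall_single_succ hh, mul_pow, ← Finset.mul_sum]
  ring

lemma lap_wall (hh : ContDiff ℝ 2 h) (x : Euc d) :
    lap (wall h) x = 2 * d - 2 * (deriv h (x 0) ^ 2 + h (x 0) * deriv (deriv h) (x 0)) := by
  have hco : ∀ i : Fin (d + 1), HasFDerivAt (fun y : Euc d => y i)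
      (EuclideanSpace.proj (𝕜 := ℝ) i : Euc d →L[ℝ] ℝ) x := fun i =>
    (EuclideanSpace.proj (𝕜 := ℝ) i : Euc d →L[ℝ] ℝ).hasFDerivAt
  have hd : DifferentiableAt ℝ h (x 0) := hh.differentiable (by norm_num) _
  have hdd : DifferentiableAt ℝ (deriv h) (x 0) :=
    ((contDiff_succ_iff_deriv (n := 1)).1 hh).2.2.differentiable (by norm_num) _
  have h0 := ((hd.hasDerivAt.mul hdd.hasDerivAt).const_mul (-2)).comp_hasFDerivAt x (hco 0)
  have h0' : HasFDerivAt (fun y : Euc d => -2 * (h (y 0) * deriv h (y 0))) _ x := h0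
  rw [lap, Fin.sum_univ_succ]
  simp only [fderiv_wall_single_zero hh, fderiv_wall_single_succ hh]
  rw [h0'.fderiv]
  have h1 : ∀ i : Fin d, fderiv ℝ (fun y : Euc d => 2 * y i.succ) x
      (EuclideanSpace.single i.succ 1) = 2 := fun i => by
    rw [((hco i.succ).const_mul 2).fderiv]
    simp
  simp only [h1]
  simp
  ring

lemma IsFunnel.hasDerivAt (hΩ : IsFunnel d R α L h) (s : ℝ) : HasDerivAt h (deriv h s) s :=
  (hΩ.smooth.differentiable (by norm_num) s).hasDerivAt

lemma IsFunnel.monotone (hΩ : IsFunnel d R α L h) : Monotone h :=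
  monotone_of_deriv_nonneg (hΩ.smooth.differentiable (by norm_num)) hΩ.deriv_nonneg

lemma IsFunnel.R_le (hΩ : IsFunnel d R α L h) (s : ℝ) : R ≤ h s := by
  rcases le_total s 0 with hs | hs
  · rw [hΩ.left s hs]
  · rw [← hΩ.left 0 le_rfl]
    exact hΩ.monotone hs

lemma IsFunnel.pos (hΩ : IsFunnel d R α L h) (s : ℝ) : 0 < h s := hΩ.Rpos.trans_le (hΩ.R_le s)

lemma IsFunnel.tan_nonneg (hΩ : IsFunnel d R α L h) : 0 ≤ Real.tan α :=
  (hΩ.deriv_nonneg 0).trans (hΩ.deriv_le 0)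

lemma IsFunnel.le_affine (hΩ : IsFunnel d R α L h) (s : ℝ) : h s ≤ R + Real.tan α * |s| := by
  have h1 := Convex.norm_image_sub_le_of_norm_deriv_le (f := h) (C := Real.tan α)
    (fun x _ => (hΩ.hasDerivAt x).differentiableAt)
    (fun x _ => by rw [Real.norm_of_nonneg (hΩ.deriv_nonneg x)]; exact hΩ.deriv_le x)
    convex_univ (mem_univ 0) (mem_univ s)
  rw [hΩ.left 0 le_rfl, sub_zero, Real.norm_eq_abs, Real.norm_eq_abs] at h1
  linarith [le_abs_self (h s - R)]

lemma IsFunnel.deriv_mul_le (hΩ : IsFunnel d R α L h) (s : ℝ) :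
    deriv h s * s ≤ h s + L * Real.cos α * Real.tan α := by
  have hcos : 0 < Real.cos α := Real.cos_pos_of_mem_Ioo
    ⟨by linarith [hΩ.αmem.1, Real.pi_pos], hΩ.αmem.2⟩
  have hLc : 0 ≤ L * Real.cos α := mul_nonneg (hΩ.Rpos.trans hΩ.RL).le hcos.le
  have hK := mul_nonneg hLc hΩ.tan_nonneg
  rcases le_total (L * Real.cos α) s with hs | hs
  · rw [hΩ.right s hs]
    nlinarith [hΩ.deriv_le s]
  · rcases le_total s 0 with h0 | h0
    · nlinarith [hΩ.deriv_nonneg s, hΩ.pos s]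
    · nlinarith [hΩ.deriv_nonneg s, hΩ.pos s, mul_le_mul hs (hΩ.deriv_le s)
        (hΩ.deriv_nonneg s) hLc]

lemma IsFunnel.continuous_deriv_deriv (hΩ : IsFunnel d R α L h) :
    Continuous (deriv (deriv h)) :=
  (((contDiff_succ_iff_deriv (n := 1)).1 hΩ.smooth).2.2).continuous_deriv (by norm_num)

lemma IsFunnel.exists_bound_mul_deriv_deriv (hΩ : IsFunnel d R α L h) :
    ∃ M : ℝ, ∀ s, |h s * deriv (deriv h) s| ≤ M := by
  have hc : Continuous fun s => h s * deriv (deriv h) s :=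
    hΩ.smooth.continuous.mul hΩ.continuous_deriv_deriv
  have hzero : ∀ s, s ∉ Icc 0 (L * Real.cos α) → deriv (deriv h) s = 0 := by
    intro s hs
    have haff : ∃ p q : ℝ, h =ᶠ[𝓝 s] fun y => y * p + q := by
      rcases lt_or_ge s 0 with h0 | h0
      · exact ⟨0, R, by filter_upwards [Iio_mem_nhds h0] with y hy; simp [hΩ.left y (le_of_lt hy)]⟩
      · have h1 : L * Real.cos α < s := not_le.1 fun h2 => hs ⟨h0, h2⟩
        exact ⟨Real.tan α, 0, by
          filter_upwards [Ioi_mem_nhds h1] with y hy; simp [hΩ.right y (le_of_lt hy)]⟩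
    obtain ⟨p, q, hpq⟩ := haff
    rw [hpq.deriv.deriv_eq]
    simp
  obtain ⟨M, hM⟩ := (isCompact_Icc (a := (0 : ℝ)) (b := L * Real.cos α)).exists_bound_of_continuousOn
    hc.continuousOn
  refine ⟨max M 0, fun s => ?_⟩
  by_cases hs : s ∈ Icc 0 (L * Real.cos α)
  · exact (hM s hs).trans (le_max_left _ _)
  · simp [hzero s hs]

lemma IsFunnel.wall_neg_iff (hΩ : IsFunnel d R α L h) (x : Euc d) :
    wall h x < 0 ↔ x ∈ funnel d h := by
  rw [wall_eq, sub_neg, sq_lt_sq₀ (primeNorm_nonneg x) (hΩ.pos _).le]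
  rfl

/-- Dilation by the factor `s` in the `x'` variables. -/
def dilate (s : ℝ) (x : Euc d) : Euc d := x + (s - 1) • (x - x 0 • EuclideanSpace.single 0 1)

lemma dilate_zero (s : ℝ) (x : Euc d) : dilate s x 0 = x 0 := by simp [dilate]

lemma dilate_succ (s : ℝ) (x : Euc d) (i : Fin d) : dilate s x i.succ = s * x i.succ := by
  simp [dilate]; ring

lemma dilate_one (x : Euc d) : dilate 1 x = x := by simp [dilate]

lemma continuous_dilate (x : Euc d) : Continuous fun s => dilate s x := by
  unfold dilate; fun_prop

lemma primeNorm_dilate_sq (s : ℝ) (x : Euc d) :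
    primeNorm (dilate s x) ^ 2 = s ^ 2 * primeNorm x ^ 2 := by
  simp only [primeNorm_sq, dilate_succ, mul_pow, Finset.mul_sum]

lemma wall_dilate (s : ℝ) (x : Euc d) :
    wall h (dilate s x) = s ^ 2 * primeNorm x ^ 2 - h (x 0) ^ 2 := by
  rw [wall_eq, primeNorm_dilate_sq, dilate_zero]

lemma IsFunnel.funnel_eq (hΩ : IsFunnel d R α L h) : funnel d h = {x | wall h x < 0} :=
  Set.ext fun x => (hΩ.wall_neg_iff x).symm

lemma IsFunnel.isOpen (hΩ : IsFunnel d R α L h) : IsOpen (funnel d h) := by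
  rw [hΩ.funnel_eq]
  exact isOpen_lt (contDiff_wall hΩ.smooth).continuous continuous_const

lemma IsFunnel.closure_eq (hΩ : IsFunnel d R α L h) :
    closure (funnel d h) = {x | wall h x ≤ 0} := by
  rw [hΩ.funnel_eq]
  refine Subset.antisymm (closure_lt_subset_le (contDiff_wall hΩ.smooth).continuous
    continuous_const) fun x hx => ?_
  have hx' : primeNorm x ^ 2 ≤ h (x 0) ^ 2 := by
    have : wall h x ≤ 0 := hx
    rw [wall_eq] at this; linarith
  have h1 : Tendsto (fun s => dilate s x) (𝓝[<] 1) (𝓝 x) := by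
    have := (continuous_dilate x).tendsto 1
    rw [dilate_one] at this
    exact this.mono_left nhdsWithin_le_nhds
  refine mem_closure_of_tendsto h1 ?_
  filter_upwards [Ioo_mem_nhdsLT (show (0 : ℝ) < 1 by norm_num)] with s hs
  rw [wall_dilate]
  have := hΩ.pos (x 0)
  have h2 : s ^ 2 < 1 := by nlinarith [hs.1, hs.2]
  nlinarith [sq_nonneg (primeNorm x), sq_nonneg s, mul_pos this this]

lemma IsFunnel.frontier_eq (hΩ : IsFunnel d R α L h) :
    frontier (funnel d h) = {x | wall h x = 0} := by
  rw [hΩ.isOpen.frontier_eq, hΩ.closure_eq, hΩ.funnel_eq]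
  ext x
  exact ⟨fun hx => le_antisymm hx.1 (not_lt.1 hx.2), fun hx => ⟨le_of_eq hx, not_lt.2 (ge_of_eq hx)⟩⟩

lemma IsFunnel.mem_interior (hΩ : IsFunnel d R α L h) {x : Euc d} (hx : wall h x < 0) :
    x ∈ interior (closure (funnel d h)) :=
  interior_mono subset_closure (hΩ.isOpen.interior_eq.symm ▸ (hΩ.wall_neg_iff x).1 hx)

lemma IsFunnel.primeNorm_of_wall (hΩ : IsFunnel d R α L h) {x : Euc d} (hx : wall h x = 0) :
    primeNorm x = h (x 0) := by
  rw [wall_eq, sub_eq_zero] at hx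
  exact (pow_left_inj₀ (primeNorm_nonneg x) (hΩ.pos _).le two_ne_zero).1 hx

lemma IsFunnel.gradient_wall_ne (hΩ : IsFunnel d R α L h) (x : Euc d) (hx : wall h x = 0) :
    gradient (wall h) x ≠ 0 := by
  intro h0
  have h1 := norm_gradient_wall_sq hΩ.smooth x
  rw [h0, hΩ.primeNorm_of_wall hx] at h1
  simp only [norm_zero] at h1
  nlinarith [sq_nonneg (h (x 0) * deriv h (x 0)), hΩ.pos (x 0), mul_pos (hΩ.pos (x 0)) (hΩ.pos (x 0))]

lemma IsFunnel.neumannAt (hΩ : IsFunnel d R α L h) {x : Euc d} (hx : wall h x = 0)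
    {g : Euc d → ℝ} (hg : DifferentiableWithinAt ℝ g (closure (funnel d h)) x)
    (hn : neumannLHS h g x = 0) : NeumannAt (wall h) g x := by
  have hD := hΩ.closure_eq
  refine ⟨fderivWithin ℝ g (closure (funnel d h)) x, hD ▸ hg.hasFDerivWithinAt, ?_⟩
  have hp := hΩ.primeNorm_of_wall hx
  have hpos := hΩ.pos (x 0)
  have hs : gradient (wall h) x = ∑ i, gradient (wall h) x i • EuclideanSpace.single i (1 : ℝ) := by
    ext j; simp [Finset.sum_apply, Pi.single_apply]
  rw [neumannLHS, hp] at hn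
  have h1 : Real.sqrt (1 + deriv h (x 0) ^ 2) ≠ 0 := by positivity
  replace hn := (mul_eq_zero.1 hn).resolve_left (inv_ne_zero h1)
  rw [Fin.sum_univ_succ] at hn
  simp only [if_true, Fin.succ_ne_zero, if_false, zero_add] at hn
  rw [hs, map_sum, Fin.sum_univ_succ]
  simp only [map_smul, smul_eq_mul, gradient_apply_coord, fderiv_wall_single_zero hΩ.smooth,
    fderiv_wall_single_succ hΩ.smooth]
  have h2 := congrArg (fun z => 2 * h (x 0) * z) hn
  simp only [mul_add, Finset.mul_sum, mul_zero] at h2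
  rw [← h2]
  congr 1
  · ring
  · exact Finset.sum_congr rfl fun i _ => by field_simp

end Geometry

/-- A function of quadratic growth controlling the behaviour at infinity in `{b ≤ 0}`. -/
structure IsGrowthFn {d : ℕ} (b Ψ : Euc d → ℝ) (C : ℝ) : Prop where
  contDiff : ContDiff ℝ 2 Ψ
  growth : ∀ x, 1 + ‖x‖ ^ 2 ≤ Ψ x
  lap_le : ∀ x, b x ≤ 0 → lap Ψ x ≤ C * Ψ x
  normal_pos : ∀ x, b x = 0 → 0 < fderiv ℝ Ψ x (gradient b x)

lemma inner_gradient_wall {d : ℕ} {h : ℝ → ℝ} (hh : ContDiff ℝ 2 h) (x : Euc d) :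
    inner ℝ x (gradient (wall h) x) =
      2 * (primeNorm x ^ 2 - h (x 0) * (deriv h (x 0) * x 0)) := by
  rw [real_inner_comm, gradient_apply_eq, fderiv_wall hh, primeNorm_sq]
  congr 1
  simp only [← sq]
  ring

set_option maxHeartbeats 1000000 in
lemma IsFunnel.exists_isGrowthFn {d : ℕ} {h : ℝ → ℝ} {R α L : ℝ} (hΩ : IsFunnel d R α L h) :
    ∃ Ψ C, IsGrowthFn (d := d) (wall h) Ψ C := by
  have hb : ContDiff ℝ 2 (wall h : Euc d → ℝ) := contDiff_wall hΩ.smooth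
  obtain ⟨M, hM⟩ := hΩ.exists_bound_mul_deriv_deriv
  have hM0 : 0 ≤ M := (abs_nonneg _).trans (hM 0)
  set T := Real.tan α with hT
  have hT0 : 0 ≤ T := hΩ.tan_nonneg
  set A := |L * Real.cos α * T| with hA
  have hA0 : 0 ≤ A := abs_nonneg _
  have hR := hΩ.Rpos
  set μ := (A + 1) / R with hμ
  have hμ0 : 0 < μ := by positivity
  have hμR : μ * R = A + 1 := by rw [hμ]; field_simp
  have hex : ContDiff ℝ 2 fun y : Euc d => Real.exp (1 * wall h y) :=
    (contDiff_const.mul hb).exp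
  have hns : ContDiff ℝ 2 fun y : Euc d => ‖y - 0‖ ^ 2 := contDiff_normSq_sub 0
  have hq : ContDiff ℝ 2 fun y : Euc d => 1 * ‖y - 0‖ ^ 2 + μ * Real.exp (1 * wall h y) :=
    (contDiff_const.mul hns).add (contDiff_const.mul hex)
  refine ⟨fun y => 1 + (1 * ‖y - 0‖ ^ 2 + μ * Real.exp (1 * wall h y)),
    2 * (d + 1) + μ * (4 * ((R + T) ^ 2 * 2 * T ^ 2 + 1) + (2 * d + 2 * M)), contDiff_const.add hq,
    fun x => ?_, fun x hx => ?_, fun x hx => ?_⟩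
  · have := mul_pos hμ0 (Real.exp_pos (1 * wall h x))
    simp only [sub_zero]; linarith
  · rw [lap_add contDiff_const.contDiffAt hq.contDiffAt, lap_const,
      lap_add (contDiff_const.mul hns).contDiffAt (contDiff_const.mul hex).contDiffAt,
      lap_const_mul _ hns.contDiffAt, lap_const_mul _ hex.contDiffAt, lap_normSq_sub,
      lap_exp_mul _ hb.contDiffAt, norm_gradient_wall_sq hΩ.smooth, lap_wall hΩ.smooth]
    have hE0 := Real.exp_pos (1 * wall h x)
    have hE1 : Real.exp (1 * wall h x) ≤ 1 := Real.exp_le_one_iff.2 (by linarith)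
    set E := Real.exp (1 * wall h x)
    set Q := 1 + ‖x‖ ^ 2 with hQ
    have hQ1 : 1 ≤ Q := by rw [hQ]; linarith [sq_nonneg ‖x‖]
    have hnorm := norm_sq_eq_add_primeNorm_sq x
    have hp : primeNorm x ^ 2 ≤ Q := by rw [hQ]; linarith [sq_nonneg (x 0)]
    have hh2 : h (x 0) ^ 2 ≤ (R + T) ^ 2 * (2 * Q) := by
      have h1 : h (x 0) ≤ (R + T) * (1 + |x 0|) := by
        nlinarith [hΩ.le_affine (x 0), abs_nonneg (x 0)]
      have h2 : (1 + |x 0|) ^ 2 ≤ 2 * Q := by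
        rw [hQ]; nlinarith [sq_abs (x 0), sq_nonneg (1 - |x 0|), sq_nonneg (primeNorm x)]
      calc h (x 0) ^ 2 ≤ ((R + T) * (1 + |x 0|)) ^ 2 :=
            pow_le_pow_left₀ (hΩ.pos _).le h1 2
        _ = (R + T) ^ 2 * (1 + |x 0|) ^ 2 := by ring
        _ ≤ _ := by gcongr
    have hd2 : deriv h (x 0) ^ 2 ≤ T ^ 2 :=
      pow_le_pow_left₀ (hΩ.deriv_nonneg _) (hΩ.deriv_le _) 2
    have hg : (h (x 0) * deriv h (x 0)) ^ 2 + primeNorm x ^ 2 ≤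
        ((R + T) ^ 2 * 2 * T ^ 2 + 1) * Q := by
      have := mul_le_mul hh2 hd2 (sq_nonneg _) (by positivity)
      rw [mul_pow]; linarith
    have hl : 2 * d - 2 * (deriv h (x 0) ^ 2 + h (x 0) * deriv (deriv h) (x 0)) ≤
        (2 * d + 2 * M) * Q := by
      have h1 := (abs_le.1 (hM (x 0))).1
      have h2 : 2 * (d : ℝ) + 2 * M ≤ (2 * d + 2 * M) * Q :=
        le_mul_of_one_le_right (by positivity) hQ1
      nlinarith [sq_nonneg (deriv h (x 0))]
    set B := 4 * ((R + T) ^ 2 * 2 * T ^ 2 + 1) + (2 * d + 2 * M) with hB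
    have hB0 : 0 ≤ B := by positivity
    have h3 : E * (1 ^ 2 * (4 * ((h (x 0) * deriv h (x 0)) ^ 2 + primeNorm x ^ 2)) +
        1 * (2 * d - 2 * (deriv h (x 0) ^ 2 + h (x 0) * deriv (deriv h) (x 0)))) ≤ B * Q := by
      calc _ ≤ E * (B * Q) := by
            gcongr
            rw [hB]; nlinarith
        _ ≤ 1 * (B * Q) := by gcongr
        _ = B * Q := one_mul _
    have h4 := mul_le_mul_of_nonneg_left h3 hμ0.le
    have h5 : (0 : ℝ) ≤ 2 * (d + 1) + μ * B := by positivity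
    calc _ ≤ (2 * (d + 1) + μ * B) * Q := by
          have : 2 * ((d : ℝ) + 1) ≤ 2 * (d + 1) * Q := le_mul_of_one_le_right (by positivity) hQ1
          nlinarith
      _ ≤ _ := by
          gcongr
          simp only [sub_zero, hQ]
          nlinarith [mul_pos hμ0 hE0]
  · rw [fderiv_const_add, fderiv_const_mul_add _ _ (hns.differentiable (by norm_num) x)
      (hex.differentiable (by norm_num) x), fderiv_normSq_sub,
      fderiv_exp_mul _ (hb.differentiable (by norm_num) x), fderiv_gradient_self,
      norm_gradient_wall_sq hΩ.smooth, hx, sub_zero, inner_gradient_wall hΩ.smooth,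
      hΩ.primeNorm_of_wall hx]
    simp only [mul_zero, Real.exp_zero]
    have h1 := hΩ.deriv_mul_le (x 0)
    have h2 : L * Real.cos α * T ≤ A := le_abs_self _
    have h3 := hΩ.R_le (x 0)
    have hpos := hΩ.pos (x 0)
    have h4 : 0 < h (x 0) - deriv h (x 0) * x 0 + μ * h (x 0) := by
      nlinarith [mul_le_mul_of_nonneg_left h3 hμ0.le]
    have h5 : 0 ≤ μ * (h (x 0) * deriv h (x 0)) ^ 2 := by positivity
    nlinarith [mul_pos hpos h4]

/-- Comparison on the unbounded domain `{b ≤ 0}` with the spatially constant solution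
`m e^{lam (t - t₀)}` of the linear equation. -/
theorem le_exp_of_subsolution {d : ℕ} {b Ψ : Euc d → ℝ} {C : ℝ} (hb : ContDiff ℝ 2 b)
    (hnd : ∀ x, b x = 0 → gradient b x ≠ 0) (hΨ : IsGrowthFn b Ψ C) {y : ℝ → Euc d → ℝ}
    {t₀ t₁ lam m : ℝ} (hm : 0 ≤ m)
    (hyt : ∀ t x, b x ≤ 0 → DifferentiableAt ℝ (fun s => y s x) t)
    (hyx : ∀ t x, b x < 0 → ContDiffAt ℝ 2 (y t) x)
    (hyn : ∀ t x, b x = 0 → NeumannAt b (y t) x)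
    (hyr : ∀ t x, b x ≤ 0 → RightCont {x | b x ≤ 0} y t x)
    (hy1 : ∀ t x, b x ≤ 0 → y t x ≤ 1)
    (hy0 : ∀ x, b x ≤ 0 → y t₀ x ≤ m)
    (hsub : ∀ t, t ≤ t₁ → ∀ x, b x < 0 → 0 < y t x →
      deriv (fun s => y s x) t ≤ lap (y t) x + lam * y t x) :
    ∀ t, t₀ ≤ t → t ≤ t₁ → ∀ x, b x ≤ 0 → y t x ≤ m * Real.exp (lam * (t - t₀)) := by
  intro t ht0 ht1 x hx
  set Λ := max (C + lam + 1) 0 with hΛ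
  have hΛ0 : 0 ≤ Λ := le_max_right _ _
  have hΛ1 : C + lam + 1 ≤ Λ := le_max_left _ _
  have hΨ0 : ∀ z, 0 < Ψ z := fun z => by linarith [hΨ.growth z, sq_nonneg ‖z‖]
  have key : ∀ ε > 0, y t x < m * Real.exp (lam * (t - t₀)) +
      ε * Real.exp (Λ * (t - t₀)) * Ψ x := by
    intro ε hε
    set P : ℝ → Euc d → ℝ := fun s z =>
      m * Real.exp (lam * (s - t₀)) + ε * Real.exp (Λ * (s - t₀)) * Ψ z with hP
    have hPd : ∀ s z, HasDerivAt (fun s => P s z)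
        (m * (Real.exp (lam * (s - t₀)) * lam) + ε * (Real.exp (Λ * (s - t₀)) * Λ) * Ψ z) s := by
      intro s z
      have h1 : ∀ k : ℝ, HasDerivAt (fun s => Real.exp (k * (s - t₀)))
          (Real.exp (k * (s - t₀)) * k) s := fun k => by
        simpa using (((hasDerivAt_id s).sub_const t₀).const_mul k).exp
      exact ((h1 lam).const_mul m).add (((h1 Λ).const_mul ε).mul_const (Ψ z))
    have hPx : ∀ s, ContDiff ℝ 2 (P s) := fun s =>
      contDiff_const.add (contDiff_const.mul hΨ.contDiff)
    have hPc : Continuous fun p : ℝ × Euc d => P p.1 p.2 := by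
      have := hΨ.contDiff.continuous
      simp only [hP]
      fun_prop
    have hPlap : ∀ s z, lap (P s) z = ε * Real.exp (Λ * (s - t₀)) * lap Ψ z := fun s z => by
      simp only [hP]
      rw [lap_add contDiff_const.contDiffAt (contDiff_const.mul hΨ.contDiff).contDiffAt, lap_const,
        lap_const_mul _ hΨ.contDiff.contDiffAt, zero_add]
    set r := max ‖x‖ (1 / ε) with hr
    have hr1 : 1 / ε ≤ r := le_max_right _ _
    refine lt_of_parabolic_barrier hb hnd (x₀ := 0) (r := r) (P := P) rfl
      (fun s _ _ z hz => hyt s z hz.1) (fun s _ _ z _ hz => hyx s z hz)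
      (fun s _ _ z _ hz => hyn s z hz) (fun s _ _ z hz => (hyr s z hz.1).mono inter_subset_left)
      (fun s _ _ z _ => rightCont_of_continuous hPc s z)
      (fun s _ _ z _ => (hPd s z).differentiableAt) (fun s _ _ z _ => (hPx s).contDiffAt)
      (fun z hz => ?_) (fun s h1 h2 z hz hzr => ?_) (fun s h1 h2 z hz hz0 => ?_)
      (fun s h1 h2 z hz hz0 heq hle hlap => ?_) t ht0 ht1 x ⟨hx, ?_⟩
    · have := hy0 z hz.1
      simp only [hP, sub_self, mul_zero, Real.exp_zero, mul_one]
      linarith [mul_pos hε (hΨ0 z)]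
    · have h3 : 1 < ε * Ψ z := by
        rw [dist_zero_right] at hzr
        have h4 := hΨ.growth z
        rw [hzr] at h4
        have h5 : 1 / ε < Ψ z := by nlinarith [sq_nonneg (1 - r), one_div_pos.2 hε]
        calc 1 = ε * (1 / ε) := by field_simp
          _ < _ := by gcongr
      have h4 : 1 ≤ Real.exp (Λ * (s - t₀)) := Real.one_le_exp (by nlinarith)
      have h5 : 0 ≤ m * Real.exp (lam * (s - t₀)) := by positivity
      simp only [hP]
      nlinarith [hy1 s z hz.1]
    · simp only [hP]
      rw [fderiv_const_add, fderiv_const_mul (hΨ.contDiff.differentiable (by norm_num) z)]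
      exact mul_pos (by positivity) (hΨ.normal_pos z hz0)
    · have hPpos : 0 < P s z := by
        have := hΨ0 z
        simp only [hP]; positivity
      have h3 := hsub s h2 z hz0 (heq ▸ hPpos)
      rw [heq] at h3
      rw [(hPd s z).deriv] at hle
      rw [hPlap] at hlap
      have hE : 0 < ε * Real.exp (Λ * (s - t₀)) := by positivity
      have h4 := mul_le_mul_of_nonneg_left (hΨ.lap_le z hz0.le) hE.le
      have h5 := mul_pos hE (hΨ0 z)
      have h6 : P s z = m * Real.exp (lam * (s - t₀)) + ε * Real.exp (Λ * (s - t₀)) * Ψ z := rfl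
      rw [h6] at h3
      nlinarith [mul_le_mul_of_nonneg_left hΛ1 h5.le]
    · rw [Metric.mem_closedBall, dist_zero_right]
      exact le_max_left _ _
  refine le_of_forall_pos_le_add fun e he => ?_
  have hB : 0 < Real.exp (Λ * (t - t₀)) * Ψ x := mul_pos (Real.exp_pos _) (hΨ0 x)
  have := key (e / (Real.exp (Λ * (t - t₀)) * Ψ x)) (by positivity)
  rw [mul_assoc (e / _), div_mul_cancel₀ _ hB.ne'] at this
  exact this.le

section Monotonicity

variable {f φ h : ℝ → ℝ} {θ c R α L : ℝ} {d : ℕ} {u : ℝ → Euc d → ℝ}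

lemma Bistable.exists_lipschitz (hf : Bistable f θ) :
    ∃ K, 0 ≤ K ∧ (∀ a ∈ Icc (0 : ℝ) 1, |deriv f a| ≤ K) ∧
      ∀ a ∈ Icc (0 : ℝ) 1, ∀ b ∈ Icc (0 : ℝ) 1, |f a - f b| ≤ K * |a - b| := by
  obtain ⟨K, hK⟩ := (isCompact_Icc (a := (0 : ℝ)) (b := 1)).exists_bound_of_continuousOn
    (hf.smooth.continuous_deriv (by norm_num)).continuousOn
  refine ⟨K, (norm_nonneg _).trans (hK 0 (by simp)), hK, fun a ha b hb => ?_⟩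
  exact Convex.norm_image_sub_le_of_norm_deriv_le
    (fun x _ => hf.smooth.differentiable (by norm_num) x) hK (convex_Icc 0 1) hb ha

lemma exists_contraction_near {f : ℝ → ℝ} (hf : ContDiff ℝ 1 f) {p : ℝ} (hp : deriv f p < 0) :
    ∃ η > 0, ∃ κ > 0, ∀ a b, |a - p| ≤ η → |b - p| ≤ η → b ≤ a →
      f a - f b ≤ -κ * (a - b) := by
  have hc : ContinuousAt (deriv f) p := (hf.continuous_deriv (by norm_num)).continuousAt
  obtain ⟨η, hη, H⟩ := Metric.nhds_basis_closedBall.mem_iff.1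
    (hc.eventually_lt_const (show deriv f p < deriv f p / 2 by linarith))
  refine ⟨η, hη, -(deriv f p / 2), by linarith, fun a b ha hb hab => ?_⟩
  have := (convex_closedBall p η).image_sub_le_mul_sub_of_deriv_le (f := f) (C := deriv f p / 2)
    hf.continuous.continuousOn (hf.differentiable (by norm_num)).differentiableOn
    (fun x hx => le_of_lt (H (interior_subset hx))) b (by simpa [Real.dist_eq] using hb) a
    (by simpa [Real.dist_eq] using ha) hab
  linarith

lemma IsEntireSolution.range (hΩ : IsFunnel d R α L h) (hu : IsEntireSolution d h f c φ u)
    (t : ℝ) {x : Euc d} (hx : wall h x ≤ 0) : u t x ∈ Icc (0 : ℝ) 1 :=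
  hu.range01 t x (hΩ.closure_eq ▸ hx)

lemma IsEntireSolution.contDiffAt (hΩ : IsFunnel d R α L h) (hu : IsEntireSolution d h f c φ u)
    (t : ℝ) {x : Euc d} (hx : wall h x < 0) : ContDiffAt ℝ 2 (u t) x :=
  (hu.space_reg t).contDiffAt (mem_interior_iff_mem_nhds.1 (hΩ.mem_interior hx))

lemma IsEntireSolution.neumannAt (hΩ : IsFunnel d R α L h) (hu : IsEntireSolution d h f c φ u)
    (t : ℝ) {x : Euc d} (hx : wall h x = 0) : NeumannAt (wall h) (u t) x :=
  hΩ.neumannAt hx ((hu.space_reg t).differentiableOn (by norm_num) x (hΩ.closure_eq ▸ hx.le))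
    (hu.neumann t x (hΩ.frontier_eq ▸ hx))

lemma IsEntireSolution.deriv_eq (hΩ : IsFunnel d R α L h) (hu : IsEntireSolution d h f c φ u)
    (t : ℝ) {x : Euc d} (hx : wall h x < 0) :
    deriv (fun s => u s x) t = lap (u t) x + f (u t x) := by
  rw [hu.pde t x (hΩ.closure_eq ▸ hx.le), lapW_eq_lap (hΩ.mem_interior hx)]

lemma IsEntireSolution.rightCont (hf : Bistable f θ) (hΩ : IsFunnel d R α L h)
    (hu : IsEntireSolution d h f c φ u) (t : ℝ) {x : Euc d} (hx : wall h x ≤ 0) :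
    RightCont {x | wall h x ≤ 0} u t x := by
  obtain ⟨K, hK0, -, hK⟩ := hf.exists_lipschitz
  have hfb : ∀ t, ∀ x : Euc d, wall h x ≤ 0 → |f (u t x)| ≤ K := fun t x hx => by
    have h1 := hu.range hΩ t hx
    have h2 := hK _ h1 0 (by simp)
    rw [hf.f0, sub_zero, sub_zero, abs_of_nonneg h1.1] at h2
    nlinarith [h1.2]
  have htd : ∀ x : Euc d, wall h x ≤ 0 → Differentiable ℝ fun t => u t x :=
    fun x hx => hu.time_diff x (hΩ.closure_eq ▸ hx)
  have h1 : HeatSub (wall h) {x | wall h x ≤ 0} K u :=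
    { tdiff := htd
      xdiff := fun t x _ hx => hu.contDiffAt hΩ t hx
      neumann := fun t x _ hx => hu.neumannAt hΩ t hx
      mem01 := fun t x hx => hu.range hΩ t hx
      defect := fun t x hx hx' => by
        rw [hu.deriv_eq hΩ t hx']; linarith [(abs_le.1 (hfb t x hx)).2] }
  have h2 : HeatSub (wall h) {x | wall h x ≤ 0} K fun t x => 1 - u t x :=
    { tdiff := fun x hx => (htd x hx).const_sub 1
      xdiff := fun t x _ hx => contDiffAt_const.sub (hu.contDiffAt hΩ t hx)
      neumann := fun t x _ hx => (neumannAt_const _ 1 x).sub (hu.neumannAt hΩ t hx)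
      mem01 := fun t x hx => ⟨by linarith [(hu.range hΩ t hx).2], by linarith [(hu.range hΩ t hx).1]⟩
      defect := fun t x hx hx' => by
        rw [deriv_const_sub, hu.deriv_eq hΩ t hx',
          lap_sub contDiffAt_const (hu.contDiffAt hΩ t hx'), lap_const]
        linarith [(abs_le.1 (hfb t x hx)).1] }
  exact HeatSub.rightCont (contDiff_wall hΩ.smooth) hΩ.gradient_wall_ne hK0 h1 h2 t x hx

/-- Away from its limits, a front decreases by a definite amount under a fixed shift. -/
lemma PlanarFront.exists_gap (hφ : PlanarFront f θ c φ) {σ η : ℝ} (hσ : 0 < σ) (hη : 0 < η) :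
    ∃ δ > 0, ∀ z, η ≤ φ z → φ z ≤ 1 - η → δ ≤ φ (z - σ) - φ z := by
  have hc := hφ.smooth.continuous
  have hcl : IsClosed {z | η ≤ φ z ∧ φ z ≤ 1 - η} :=
    (isClosed_le continuous_const hc).inter (isClosed_le hc continuous_const)
  obtain ⟨a, ha⟩ := (hφ.lim_bot.eventually_const_lt (show 1 - η < 1 by linarith)).exists
  obtain ⟨b, hb⟩ := (hφ.lim_top.eventually_lt_const hη).exists
  have hcomp : IsCompact {z | η ≤ φ z ∧ φ z ≤ 1 - η} := by
    refine (isCompact_Icc (a := a) (b := b)).of_isClosed_subset hcl fun z hz => ⟨?_, ?_⟩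
    · by_contra! hlt
      linarith [hφ.anti hlt, hz.2]
    · by_contra! hlt
      linarith [hφ.anti hlt, hz.1]
  obtain ⟨δ, hδ, H⟩ := hcomp.exists_forall_le' (f := fun z => φ (z - σ) - φ z) (a := 0)
    (by fun_prop) fun z _ => sub_pos.2 (hφ.anti (by linarith))
  exact ⟨δ, hδ, fun z h1 h2 => H z ⟨h1, h2⟩⟩

/-- For very negative times, the difference of a solution and its time shift is, where positive,
a subsolution of a linear equation with damping. -/
lemma IsEntireSolution.exists_damping (hf : Bistable f θ) (hφ : PlanarFront f θ c φ)
    (hΩ : IsFunnel d R α L h) (hu : IsEntireSolution d h f c φ u) {s : ℝ} (hs : 0 < s) :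
    ∃ κ > 0, ∃ T, ∀ t ≤ T, ∀ x : Euc d, wall h x ≤ 0 → u (t + s) x < u t x →
      f (u t x) - f (u (t + s) x) ≤ -κ * (u t x - u (t + s) x) := by
  obtain ⟨η₀, hη₀, κ₀, hκ₀, H₀⟩ := exists_contraction_near hf.smooth hf.df0
  obtain ⟨η₁, hη₁, κ₁, hκ₁, H₁⟩ := exists_contraction_near hf.smooth hf.df1
  set η := min η₀ η₁ / 2 with hη
  have hηp : 0 < η := by positivity
  have hle0 : 2 * η ≤ η₀ := by rw [hη]; linarith [min_le_left η₀ η₁]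
  have hle1 : 2 * η ≤ η₁ := by rw [hη]; linarith [min_le_right η₀ η₁]
  obtain ⟨δ, hδ, Hδ⟩ := hφ.exists_gap (mul_pos hφ.cpos hs) hηp
  obtain ⟨T, hT⟩ := hu.past (min η (δ / 2)) (by positivity)
  refine ⟨min κ₀ κ₁, lt_min hκ₀ hκ₁, T - s, fun t ht x hx hlt => ?_⟩
  have hxD : x ∈ closure (funnel d h) := hΩ.closure_eq ▸ hx
  have h1 := abs_le.1 (hT t (by linarith) x hxD)
  have h2 := abs_le.1 (hT (t + s) (by linarith) x hxD)
  have hmη := min_le_left η (δ / 2)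
  have hmδ := min_le_right η (δ / 2)
  have hz : x 0 - c * (t + s) = x 0 - c * t - c * s := by ring
  rw [hz] at h2
  set z := x 0 - c * t
  have hmono : φ z < φ (z - c * s) := hφ.anti (by linarith [mul_pos hφ.cpos hs])
  have ha := hu.range hΩ t hx
  have hb := hu.range hΩ (t + s) hx
  have hκle : ∀ κ, min κ₀ κ₁ ≤ κ → f (u t x) - f (u (t + s) x) ≤ -κ * (u t x - u (t + s) x) →
      f (u t x) - f (u (t + s) x) ≤ -min κ₀ κ₁ * (u t x - u (t + s) x) := fun κ h3 h4 => by
    nlinarith [mul_le_mul_of_nonneg_right h3 (sub_nonneg.2 hlt.le)]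
  by_cases h3 : η ≤ φ z
  · by_cases h4 : φ z ≤ 1 - η
    · linarith [Hδ z h3 h4]
    · refine hκle κ₁ (min_le_right _ _) (H₁ _ _ (abs_le.2 ⟨?_, ?_⟩) (abs_le.2 ⟨?_, ?_⟩) hlt.le) <;>
        linarith [ha.2, hb.2]
  · refine hκle κ₀ (min_le_left _ _) (H₀ _ _ (abs_le.2 ⟨?_, ?_⟩) (abs_le.2 ⟨?_, ?_⟩) hlt.le) <;>
      linarith [ha.1, hb.1]

/-- Entire solutions emanating from the front are nondecreasing in time. -/
theorem IsEntireSolution.le_shift (hf : Bistable f θ) (hφ : PlanarFront f θ c φ)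
    (hΩ : IsFunnel d R α L h) (hu : IsEntireSolution d h f c φ u) {s : ℝ} (hs : 0 < s) (t : ℝ)
    {x : Euc d} (hx : wall h x ≤ 0) : u t x ≤ u (t + s) x := by
  obtain ⟨Ψ, C, hΨ⟩ := hΩ.exists_isGrowthFn
  obtain ⟨K, hK0, -, hK⟩ := hf.exists_lipschitz
  obtain ⟨κ, hκ, T, hT⟩ := hu.exists_damping hf hφ hΩ hs
  have htd : ∀ t, ∀ x : Euc d, wall h x ≤ 0 → DifferentiableAt ℝ (fun t => u t x) t :=
    fun t x hx => hu.time_diff x (hΩ.closure_eq ▸ hx) t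
  set y : ℝ → Euc d → ℝ := fun t x => u t x - u (t + s) x with hy
  have hyt : ∀ t, ∀ x : Euc d, wall h x ≤ 0 → HasDerivAt (fun r => y r x)
      (deriv (fun r => u r x) t - deriv (fun r => u r x) (t + s)) t := fun t x hx =>
    (htd t x hx).hasDerivAt.sub ((htd (t + s) x hx).hasDerivAt.comp_add_const t s)
  have hpde : ∀ t, ∀ x : Euc d, wall h x < 0 → deriv (fun r => y r x) t =
      lap (y t) x + (f (u t x) - f (u (t + s) x)) := fun t x hx => by
    rw [(hyt t x hx.le).deriv, hu.deriv_eq hΩ t hx, hu.deriv_eq hΩ (t + s) hx, hy,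
      lap_sub (hu.contDiffAt hΩ t hx) (hu.contDiffAt hΩ (t + s) hx)]
    ring
  have hcomp : ∀ t₀ t₁ lam m : ℝ, 0 ≤ m → (∀ x : Euc d, wall h x ≤ 0 → y t₀ x ≤ m) →
      (∀ t ≤ t₁, ∀ x : Euc d, wall h x < 0 → 0 < y t x →
        f (u t x) - f (u (t + s) x) ≤ lam * y t x) →
      ∀ t, t₀ ≤ t → t ≤ t₁ → ∀ x : Euc d, wall h x ≤ 0 → y t x ≤ m * Real.exp (lam * (t - t₀)) :=
    fun t₀ t₁ lam m hm h0 hsub => le_exp_of_subsolution (contDiff_wall hΩ.smooth)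
      hΩ.gradient_wall_ne hΨ hm (fun t x hx => (hyt t x hx).differentiableAt)
      (fun t x hx => (hu.contDiffAt hΩ t hx).sub (hu.contDiffAt hΩ (t + s) hx))
      (fun t x hx => (hu.neumannAt hΩ t hx).sub (hu.neumannAt hΩ (t + s) hx))
      (fun t x hx => (hu.rightCont hf hΩ t hx).sub
        ((hu.rightCont hf hΩ (t + s) hx).comp_add s))
      (fun t x hx => by
        linarith [(hu.range hΩ t hx).2, (hu.range hΩ (t + s) hx).1, hy]) h0
      (fun t ht x hx hpos => by
        rw [hpde t x hx]; linarith [hsub t ht x hx hpos])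
  have hpast : ∀ t ≤ T, ∀ x : Euc d, wall h x ≤ 0 → y t x ≤ 0 := by
    intro t ht x hx
    have h1 : ∀ t₀ ≤ t, y t x ≤ 1 * Real.exp (-κ * (t - t₀)) := fun t₀ ht₀ =>
      hcomp t₀ T (-κ) 1 zero_le_one
        (fun x hx => by
          have h1 := (hu.range hΩ t₀ hx).2
          have h2 := (hu.range hΩ (t₀ + s) hx).1
          simp only [hy]; linarith)
        (fun r hr x hx hpos => hT r hr x hx.le (sub_pos.1 hpos)) t ht₀ ht x hx
    have h2 : Tendsto (fun t₀ : ℝ => 1 * Real.exp (-κ * (t - t₀))) atBot (𝓝 0) := by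
      have h3 : Tendsto (fun t₀ : ℝ => -κ * (t - t₀)) atBot atBot := by
        have : Tendsto (fun t₀ : ℝ => κ * t₀ + -κ * t) atBot atBot :=
          tendsto_atBot_add_const_right _ _ (tendsto_id.const_mul_atBot hκ)
        exact this.congr fun t₀ => by ring
      simp only [one_mul]
      exact Real.tendsto_exp_atBot.comp h3
    exact ge_of_tendsto h2 ((eventually_le_atBot t).mono h1)
  have hfin : y t x ≤ 0 := by
    rcases le_total t T with ht | ht
    · exact hpast t ht x hx
    · have := hcomp T t K 0 le_rfl (hpast T le_rfl) (fun r _ x hx hpos => by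
        have h1 := hK _ (hu.range hΩ r hx.le) _ (hu.range hΩ (r + s) hx.le)
        rw [abs_of_pos (show 0 < u r x - u (r + s) x from hpos)] at h1
        exact (le_abs_self _).trans h1) t ht le_rfl x hx
      simpa using this
  exact sub_nonpos.1 hfin

lemma IsEntireSolution.monotone (hf : Bistable f θ) (hφ : PlanarFront f θ c φ)
    (hΩ : IsFunnel d R α L h) (hu : IsEntireSolution d h f c φ u) {x : Euc d}
    (hx : wall h x ≤ 0) : Monotone fun t => u t x := by
  intro a b hab
  rcases hab.eq_or_lt with rfl | hlt
  · rfl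
  · simpa using hu.le_shift hf hφ hΩ (sub_pos.2 hlt) a hx

end Monotonicity

/-- Propagation of strict negativity from an initial time, on a ball. -/
lemma neg_center_of_parabolic {d : ℕ} {v : ℝ → Euc d → ℝ} {x₀ : Euc d} {ρ m K t₀ t₁ : ℝ}
    (hρ : 0 < ρ) (hm : 0 < m) (hK : 0 ≤ K) (ht : t₀ ≤ t₁)
    (hvt : ∀ t, ∀ x ∈ Metric.closedBall x₀ ρ, DifferentiableAt ℝ (fun s => v s x) t)
    (hvx : ∀ t, ∀ x ∈ Metric.closedBall x₀ ρ, ContDiffAt ℝ 2 (v t) x)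
    (hvr : ∀ t, ∀ x ∈ Metric.closedBall x₀ ρ, RightCont (Metric.closedBall x₀ ρ) v t x)
    (hv0 : ∀ t, ∀ x ∈ Metric.closedBall x₀ ρ, v t x ≤ 0)
    (hvm : ∀ x ∈ Metric.closedBall x₀ ρ, v t₀ x ≤ -m)
    (hpde : ∀ t, ∀ x ∈ Metric.closedBall x₀ ρ,
      deriv (fun s => v s x) t ≤ lap (v t) x - K * v t x) :
    v t₁ x₀ < 0 := by
  set Λ := K + (4 * (d + 1) + 8) ^ 2 / ρ ^ 2 with hΛ
  set g : Euc d → ℝ := fun x => 1 - (1 / ρ ^ 2) * ‖x - x₀‖ ^ 2 with hg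
  have hns := contDiff_normSq_sub x₀
  have hgc : ContDiff ℝ 2 g := contDiff_const.sub (contDiff_const.mul hns)
  have hg2c : ContDiff ℝ 2 fun x => g x ^ 2 := hgc.pow 2
  have hgmem : ∀ x ∈ Metric.closedBall x₀ ρ, g x ∈ Icc (0 : ℝ) 1 := fun x hx => by
    rw [Metric.mem_closedBall, dist_eq_norm] at hx
    have h1 : ‖x - x₀‖ ^ 2 ≤ ρ ^ 2 := pow_le_pow_left₀ (norm_nonneg _) hx 2
    have h2 : 1 / ρ ^ 2 * ‖x - x₀‖ ^ 2 ≤ 1 := by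
      rw [one_div_mul_eq_div]; exact (div_le_one (by positivity)).2 h1
    have h3 : 0 ≤ 1 / ρ ^ 2 * ‖x - x₀‖ ^ 2 := by positivity
    exact ⟨by simp only [hg]; linarith, by simp only [hg]; linarith⟩
  have hglap : ∀ x, lap g x = -(2 * (d + 1) / ρ ^ 2) := fun x => by
    simp only [hg]
    rw [lap_sub contDiffAt_const (contDiff_const.mul hns).contDiffAt, lap_const,
      lap_const_mul _ hns.contDiffAt, lap_normSq_sub]
    ring
  have hggrad : ∀ x, ‖gradient g x‖ ^ 2 = 4 * (1 - g x) / ρ ^ 2 := fun x => by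
    have h1 : gradient g x = (-(2 / ρ ^ 2)) • (x - x₀) := by
      refine ext_inner_right ℝ fun w => ?_
      rw [gradient_apply_eq, real_inner_smul_left]
      simp only [hg]
      rw [fderiv_const_sub, fderiv_const_mul (hns.differentiable (by norm_num) x)]
      simp only [neg_apply, smul_apply, fderiv_normSq_sub, smul_eq_mul]
      ring
    rw [h1, norm_smul, mul_pow, Real.norm_eq_abs, sq_abs]
    simp only [hg]
    field_simp
    ring
  set κ := m * Real.exp (-Λ * (t₁ - t₀)) / 2 with hκ
  have hκ0 : 0 < κ := by positivity
  set P : ℝ → Euc d → ℝ := fun t x => κ - m * Real.exp (-Λ * (t - t₀)) * g x ^ 2 with hP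
  have hPd : ∀ t x, HasDerivAt (fun s => P s x)
      (-(m * (Real.exp (-Λ * (t - t₀)) * -Λ) * g x ^ 2)) t := fun t x => by
    have h1 : HasDerivAt (fun s => Real.exp (-Λ * (s - t₀))) (Real.exp (-Λ * (t - t₀)) * -Λ) t := by
      simpa using (((hasDerivAt_id t).sub_const t₀).const_mul (-Λ)).exp
    exact ((h1.const_mul m).mul_const (g x ^ 2)).const_sub κ
  have hPx : ∀ t, ContDiff ℝ 2 (P t) := fun t => contDiff_const.sub (contDiff_const.mul hg2c)
  have hPc : Continuous fun p : ℝ × Euc d => P p.1 p.2 := by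
    have := hgc.continuous
    simp only [hP]
    fun_prop
  have hPlap : ∀ t x, lap (P t) x = -(m * Real.exp (-Λ * (t - t₀)) *
      (8 * (1 - g x) / ρ ^ 2 - 4 * (d + 1) * g x / ρ ^ 2)) := fun t x => by
    simp only [hP]
    rw [lap_sub contDiffAt_const (contDiff_const.mul hg2c).contDiffAt, lap_const,
      lap_const_mul _ hg2c.contDiffAt, lap_sq hgc.contDiffAt, hggrad, hglap]
    ring
  have hKdef : Metric.closedBall x₀ ρ = {x | (fun _ : Euc d => (-1 : ℝ)) x ≤ 0} ∩
      Metric.closedBall x₀ ρ := by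
    ext x; simp
  have key := lt_of_parabolic_barrier (b := fun _ => -1) contDiff_const
    (fun x hx => absurd hx (by norm_num)) (x₀ := x₀) (r := ρ) (v := v) (P := P) (t₀ := t₀)
    (t₁ := t₁) hKdef (fun t _ _ x hx => hvt t x hx) (fun t _ _ x hx _ => hvx t x hx)
    (fun t _ _ x _ h0 => absurd h0 (by norm_num)) (fun t _ _ x hx => hvr t x hx)
    (fun t _ _ x _ => rightCont_of_continuous hPc t x)
    (fun t _ _ x _ => (hPd t x).differentiableAt) (fun t _ _ x _ => (hPx t).contDiffAt)
    (fun x hx => ?_) (fun t _ _ x hx hxr => ?_) (fun t _ _ x _ h0 => absurd h0 (by norm_num))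
    (fun t h1 h2 x hx _ heq hle hlap => ?_) t₁ ht le_rfl x₀ (Metric.mem_closedBall_self hρ.le)
  · have hgx : g x₀ = 1 := by simp [hg]
    have : P t₁ x₀ = -κ := by simp only [hP, hgx, hκ]; ring
    linarith
  · have h1 := hgmem x hx
    have h2 : g x ^ 2 ≤ 1 := by nlinarith [h1.1, h1.2]
    simp only [hP, sub_self, mul_zero, Real.exp_zero, mul_one]
    nlinarith [hvm x hx]
  · have hgx : g x = 0 := by
      simp only [hg]
      rw [← dist_eq_norm, hxr]; field_simp; ring
    have h1 := hv0 t x hx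
    simp only [hP, hgx]
    linarith
  · rw [(hPd t x).deriv] at hle
    rw [hPlap] at hlap
    have h3 := hpde t x hx
    have h4 := hgmem x hx
    have hE : 0 < m * Real.exp (-Λ * (t - t₀)) := by positivity
    have h5 : v t x = κ - m * Real.exp (-Λ * (t - t₀)) * g x ^ 2 := heq
    have h6 := hv0 t x hx
    set E := m * Real.exp (-Λ * (t - t₀))
    set N : ℝ := 4 * (d + 1) + 8 with hN
    have h7 : -(K * v t x) ≤ K * (E * g x ^ 2) := by
      rw [h5]; nlinarith [mul_nonneg hK hκ0.le]
    have h8 : m * (Real.exp (-Λ * (t - t₀)) * -Λ) * g x ^ 2 = -(E * (Λ * g x ^ 2)) := by ring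
    rw [h8] at hle
    have h9 : E * ((N ^ 2 * g x ^ 2 - N * g x + 8) / ρ ^ 2) ≤ 0 := by
      have : (N ^ 2 * g x ^ 2 - N * g x + 8) / ρ ^ 2 = Λ * g x ^ 2 - K * g x ^ 2 +
          (8 * (1 - g x) / ρ ^ 2 - 4 * (d + 1) * g x / ρ ^ 2) := by
        rw [hΛ, hN]; ring
      rw [this]
      nlinarith
    have h10 : 0 < (N ^ 2 * g x ^ 2 - N * g x + 8) / ρ ^ 2 :=
      div_pos (by nlinarith [sq_nonneg (N * g x - 1 / 2)]) (by positivity)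
    linarith [mul_pos hE h10]

section StrictPositivity

variable {f φ h : ℝ → ℝ} {θ c R α L : ℝ} {d : ℕ} {u : ℝ → Euc d → ℝ} {uinf : Euc d → ℝ}

/-- A stationary solution above an entire solution emanating from the front is strictly above it
in the interior. -/
theorem IsEntireSolution.lt_of_stationary (hf : Bistable f θ) (hφ : PlanarFront f θ c φ)
    (hΩ : IsFunnel d R α L h) (hu : IsEntireSolution d h f c φ u)
    (hreg : ContDiffOn ℝ 2 uinf (closure (funnel d h)))
    (hrange : ∀ x ∈ closure (funnel d h), uinf x ∈ Ioc (0 : ℝ) 1)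
    (hpde : ∀ x ∈ closure (funnel d h), lapW (closure (funnel d h)) uinf x + f (uinf x) = 0)
    (hle : ∀ t, ∀ x ∈ closure (funnel d h), u t x ≤ uinf x) (t : ℝ) {x₀ : Euc d}
    (hx₀ : wall h x₀ < 0) : u t x₀ < uinf x₀ := by
  obtain ⟨K, hK0, -, hK⟩ := hf.exists_lipschitz
  have hO : IsOpen {x : Euc d | wall h x < 0} :=
    isOpen_lt (contDiff_wall hΩ.smooth).continuous continuous_const
  obtain ⟨ρ, hρ, hball⟩ := Metric.nhds_basis_closedBall.mem_iff.1 (hO.mem_nhds hx₀)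
  have hin : ∀ x ∈ Metric.closedBall x₀ ρ, wall h x < 0 := fun x hx => hball hx
  have hcl : ∀ x ∈ Metric.closedBall x₀ ρ, x ∈ closure (funnel d h) := fun x hx =>
    hΩ.closure_eq ▸ (hin x hx).le
  have hsm : ∀ x ∈ Metric.closedBall x₀ ρ, ContDiffAt ℝ 2 uinf x := fun x hx =>
    hreg.contDiffAt (mem_interior_iff_mem_nhds.1 (hΩ.mem_interior (hin x hx)))
  obtain ⟨m, hm, hmu⟩ := (isCompact_closedBall x₀ ρ).exists_forall_le' (f := uinf) (a := 0)
    (fun x hx => (hsm x hx).continuousAt.continuousWithinAt) fun x hx => (hrange x (hcl x hx)).1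
  obtain ⟨T, hT⟩ := hu.past (m / 4) (by positivity)
  obtain ⟨B, hB⟩ := ((hφ.lim_top.eventually_lt_const (show 0 < m / 4 by positivity))).exists
  set t₀ := min (min T t) ((x₀ 0 - ρ - B) / c) with ht₀
  have htT : t₀ ≤ T := (min_le_left _ _).trans (min_le_left _ _)
  have htt : t₀ ≤ t := (min_le_left _ _).trans (min_le_right _ _)
  have htB : c * t₀ ≤ x₀ 0 - ρ - B := by
    rw [mul_comm]; exact (le_div_iff₀ hφ.cpos).1 (min_le_right _ _)
  have key := neg_center_of_parabolic (v := fun t x => u t x - uinf x) (x₀ := x₀) (ρ := ρ)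
    (m := m / 2) (K := K) (t₀ := t₀) (t₁ := t) hρ (by positivity) hK0 htt
    (fun s x hx => (hu.time_diff x (hcl x hx) s).sub_const _)
    (fun s x hx => (hu.contDiffAt hΩ s (hin x hx)).sub (hsm x hx))
    (fun s x hx => ?_) (fun s x hx => sub_nonpos.2 (hle s x (hcl x hx))) (fun x hx => ?_)
    (fun s x hx => ?_)
  · exact sub_neg.1 key
  · refine ((hu.rightCont hf hΩ s (hin x hx).le).mono fun z hz => (hin z hz).le).sub
      (w := fun _ => uinf) (rightCont_of_continuousAt ?_)
    exact ContinuousAt.comp (f := Prod.snd) (x := (s, x)) (hsm x hx).continuousAt continuousAt_snd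
  · have h1 := (abs_le.1 (hT t₀ htT x (hcl x hx))).2
    have h2 := hmu x hx
    have h3 : x₀ 0 - ρ ≤ x 0 := by
      have h4 : |(x - x₀) 0| ≤ ‖x - x₀‖ := by
        simpa using PiLp.norm_apply_le (x - x₀) 0
      rw [Metric.mem_closedBall, dist_eq_norm] at hx
      have h5 := (abs_le.1 (h4.trans hx)).1
      simp only [PiLp.sub_apply] at h5
      linarith
    have h4 : φ (x 0 - c * t₀) ≤ φ B := hφ.anti.antitone (by linarith)
    linarith
  · have h1 := hu.range01 s x (hcl x hx)
    have h2 := hrange x (hcl x hx)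
    have h3 := hpde x (hcl x hx)
    rw [lapW_eq_lap (hΩ.mem_interior (hin x hx))] at h3
    rw [deriv_sub_const, hu.deriv_eq hΩ s (hin x hx),
      lap_sub (hu.contDiffAt hΩ s (hin x hx)) (hsm x hx)]
    have h4 := hK _ h1 _ (Ioc_subset_Icc_self h2)
    rw [abs_of_nonpos (sub_nonpos.2 (hle s x (hcl x hx)))] at h4
    linarith [le_abs_self (f (u s x) - f (uinf x))]

end StrictPositivity

/-- Regular sublevel sets are sets of unique differentiability. -/
lemma uniqueDiffOn_sublevel {d : ℕ} {b : Euc d → ℝ} (hb : ContDiff ℝ 2 b)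
    (hnd : ∀ x, b x = 0 → gradient b x ≠ 0) : UniqueDiffOn ℝ {x | b x ≤ 0} := by
  intro x hx
  rcases (show b x ≤ 0 from hx).lt_or_eq with hlt | heq
  · refine uniqueDiffWithinAt_of_mem_nhds ?_
    filter_upwards [hb.continuous.continuousAt.eventually_lt_const hlt] with y hy using hy.le
  refine ⟨?_, subset_closure hx⟩
  have hcone : {v | fderiv ℝ b x v < 0} ⊆
      (Submodule.span ℝ (tangentConeAt ℝ {x | b x ≤ 0} x) : Set (Euc d)) := by
    intro v hv
    have hd : HasDerivAt (fun τ : ℝ => b (x + τ • v)) (fderiv ℝ b x v) 0 := by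
      have h1 : HasDerivAt (fun τ : ℝ => x + τ • v) v 0 := by
        simpa using ((hasDerivAt_id (0 : ℝ)).smul_const v).const_add x
      have h2 : HasFDerivAt b (fderiv ℝ b x) (x + (0 : ℝ) • v) := by
        simpa using (hb.differentiable (by norm_num) x).hasFDerivAt
      exact h2.comp_hasDerivAt (0 : ℝ) h1
    have hev : ∀ᶠ τ in 𝓝[>] (0 : ℝ), b (x + τ • v) ≤ 0 := by
      have h1 := (hasDerivAt_iff_tendsto_slope.1 hd).mono_left
        (nhdsWithin_mono (0 : ℝ) (fun τ (hτ : 0 < τ) => hτ.ne'))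
      filter_upwards [h1.eventually_lt_const hv, self_mem_nhdsWithin] with τ h2 h3
      simp only [slope_def_field, zero_smul, add_zero, heq, sub_zero] at h2
      have h4 : 0 < τ := h3
      by_contra! h5
      linarith [div_pos h5 h4]
    obtain ⟨δ, hδ, H⟩ := mem_nhdsGT_iff_exists_Ioc_subset.1 hev
    have hδ0 : 0 < δ := hδ
    have h1 : x + δ • v - x ∈ tangentConeAt ℝ {x | b x ≤ 0} x := by
      refine mem_tangentConeAt_of_segment_subset ?_
      rw [segment_eq_image']
      rintro _ ⟨s, hs, rfl⟩
      simp only [add_sub_cancel_left, smul_smul]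
      rcases hs.1.eq_or_lt with rfl | hs0
      · simpa using heq.le
      · exact H ⟨mul_pos hs0 hδ0, mul_le_of_le_one_left hδ0.le hs.2⟩
    rw [add_sub_cancel_left] at h1
    have h2 := Submodule.smul_mem (Submodule.span ℝ (tangentConeAt ℝ {x | b x ≤ 0} x)) δ⁻¹
      (Submodule.subset_span h1)
    rwa [smul_smul, inv_mul_cancel₀ hδ0.ne', one_smul] at h2
  have hopen : IsOpen {v | fderiv ℝ b x v < 0} :=
    isOpen_lt (fderiv ℝ b x).continuous continuous_const
  have hne : {v | fderiv ℝ b x v < 0}.Nonempty := by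
    refine ⟨-gradient b x, ?_⟩
    change fderiv ℝ b x (-gradient b x) < 0
    rw [map_neg, fderiv_gradient_self]
    have := norm_pos_iff.2 (hnd x heq)
    linarith [pow_pos this 2]
  rw [Submodule.eq_top_of_nonempty_interior' _
    (hne.mono (interior_maximal hcone hopen))]
  exact dense_univ

section NormalDerivative

variable {h : ℝ → ℝ} {R α L : ℝ} {d : ℕ}

/-- From a point of the funnel off its axis, the outward radial segment reaches the boundary. -/
lemma IsFunnel.exists_radial_segment (hΩ : IsFunnel d R α L h) {x : Euc d} (hx : wall h x ≤ 0)
    (hp : 0 < primeNorm x) :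
    ∃ z, wall h z = 0 ∧ (∀ y ∈ segment ℝ x z, wall h y ≤ 0 ∧ y 0 = x 0) ∧
      R * ‖z - x‖ ≤ |wall h x| := by
  have hpos := hΩ.pos (x 0)
  have hle : primeNorm x ≤ h (x 0) := by
    rw [wall_eq] at hx
    exact (sq_le_sq₀ hp.le hpos.le).1 (by linarith)
  set s := h (x 0) / primeNorm x with hs
  have hs1 : 1 ≤ s := (one_le_div hp).2 hle
  have hsp : s * primeNorm x = h (x 0) := div_mul_cancel₀ _ hp.ne'
  have hzx : dilate s x - x = (s - 1) • (x - x 0 • EuclideanSpace.single 0 1) := by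
    rw [dilate, add_sub_cancel_left]
  refine ⟨dilate s x, ?_, fun y hy => ?_, ?_⟩
  · rw [wall_dilate, ← mul_pow, hsp, sub_self]
  · rw [segment_eq_image'] at hy
    obtain ⟨τ, hτ, rfl⟩ := hy
    have h1 : x + τ • (dilate s x - x) = dilate (1 + τ * (s - 1)) x := by
      rw [hzx, smul_smul, dilate, add_sub_cancel_left]
    simp only [h1]
    refine ⟨?_, dilate_zero _ _⟩
    rw [wall_dilate, ← hsp, mul_pow, sub_nonpos]
    have h2 : 0 ≤ 1 + τ * (s - 1) := by nlinarith [hτ.1]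
    have h3 : 1 + τ * (s - 1) ≤ s := by nlinarith [hτ.2]
    gcongr
  · have h1 : ‖x - x 0 • EuclideanSpace.single 0 (1 : ℝ)‖ = primeNorm x := by
      rw [← sq_eq_sq₀ (norm_nonneg _) hp.le, norm_sq_eq_add_primeNorm_sq, primeNorm_sq, primeNorm_sq]
      simp
    rw [hzx, norm_smul, h1, Real.norm_of_nonneg (by linarith), wall_eq]
    have h2 : (s - 1) * primeNorm x = h (x 0) - primeNorm x := by rw [sub_mul, hsp, one_mul]
    rw [h2, abs_of_nonpos (by nlinarith)]
    nlinarith [hΩ.R_le (x 0)]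

lemma NeumannAt.fderivWithin_eq {b w : Euc d → ℝ} {x : Euc d} (hw : NeumannAt b w x)
    (hu : UniqueDiffWithinAt ℝ {y | b y ≤ 0} x) :
    fderivWithin ℝ w {y | b y ≤ 0} x (gradient b x) = 0 := by
  obtain ⟨L, hL, h0⟩ := hw
  rw [hL.fderivWithin hu, h0]

/-- Under the Neumann condition, `∇b·∇w` vanishes linearly at the boundary of the funnel. -/
lemma IsFunnel.exists_bound_normal_derivative (hΩ : IsFunnel d R α L h) {w : Euc d → ℝ}
    (hw : ContDiffOn ℝ 2 w {x | wall h x ≤ 0})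
    (hn : ∀ x, wall h x = 0 → NeumannAt (wall h) w x) (r : ℝ) :
    ∃ C, 0 ≤ C ∧ ∀ x, wall h x < 0 → ‖x‖ ≤ r →
      |fderiv ℝ w x (gradient (wall h) x)| ≤ C * |wall h x| := by
  set D : Set (Euc d) := {x | wall h x ≤ 0} with hD
  have hb : ContDiff ℝ 2 (wall h : Euc d → ℝ) := contDiff_wall hΩ.smooth
  have hDc : IsClosed D := isClosed_le hb.continuous continuous_const
  have hU : UniqueDiffOn ℝ D := uniqueDiffOn_sublevel hb hΩ.gradient_wall_ne
  set Q : Euc d → ℝ := fun x => fderivWithin ℝ w D x (gradient (wall h) x) with hQ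
  have hQ1 : ContDiffOn ℝ 1 Q D :=
    (hw.fderivWithin hU (m := 1) (by norm_num)).clm_apply (contDiff_gradient hb).contDiffOn
  have hQeq : ∀ x, wall h x < 0 → fderiv ℝ w x (gradient (wall h) x) = Q x := fun x hx => by
    have hmem : D ∈ 𝓝 x := by
      filter_upwards [hb.continuous.continuousAt.eventually_lt_const hx] with y hy using hy.le
    simp only [hQ, fderivWithin_of_mem_nhds hmem]
  set r' := |r| + (R + Real.tan α * |r|) with hr'
  have hcomp : IsCompact (D ∩ Metric.closedBall 0 r') :=
    (isCompact_closedBall 0 r').inter_left hDc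
  obtain ⟨M₀, hM₀⟩ := hcomp.exists_bound_of_continuousOn (hQ1.continuousOn.mono inter_subset_left)
  obtain ⟨M₁, hM₁⟩ := hcomp.exists_bound_of_continuousOn
    ((hQ1.continuousOn_fderivWithin hU (by norm_num)).mono inter_subset_left)
  have hR := hΩ.Rpos
  refine ⟨|M₁| / R + |M₀| / R ^ 2, by positivity, fun x hx hxr => ?_⟩
  rw [hQeq x hx, add_mul]
  have hball : ∀ y : Euc d, y ∈ D → y 0 = x 0 → y ∈ D ∩ Metric.closedBall 0 r' := by
    intro y hy hy0
    refine ⟨hy, ?_⟩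
    rw [Metric.mem_closedBall, dist_zero_right]
    have h1 : |x 0| ≤ |r| := by
      have : |x 0| ≤ ‖x‖ := by simpa using PiLp.norm_apply_le x 0
      exact (this.trans hxr).trans (le_abs_self r)
    have h2 : primeNorm y ^ 2 ≤ h (x 0) ^ 2 := by
      have : wall h y ≤ 0 := hy
      rw [wall_eq, hy0] at this; linarith
    have h3 : h (x 0) ≤ R + Real.tan α * |r| :=
      (hΩ.le_affine (x 0)).trans (by gcongr; exact hΩ.tan_nonneg)
    have h4 := hΩ.pos (x 0)
    refine (sq_le_sq₀ (norm_nonneg _) (by positivity [hΩ.tan_nonneg])).1 ?_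
    rw [norm_sq_eq_add_primeNorm_sq, hy0, hr', ← sq_abs (x 0)]
    nlinarith [abs_nonneg (x 0), abs_nonneg r, pow_le_pow_left₀ h4.le h3 2,
      pow_le_pow_left₀ (abs_nonneg (x 0)) h1 2, mul_nonneg (abs_nonneg r) (h4.le.trans h3)]
  rcases (primeNorm_nonneg x).eq_or_lt with hp | hp
  · have h1 := hM₀ x (hball x hx.le rfl)
    have h2 : R ^ 2 ≤ |wall h x| := by
      rw [wall_eq, ← hp, abs_of_nonpos (by nlinarith [sq_nonneg (h (x 0))])]
      nlinarith [hΩ.R_le (x 0)]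
    have h3 : |M₀| ≤ |M₀| / R ^ 2 * |wall h x| := by
      rw [div_mul_eq_mul_div, le_div_iff₀ (by positivity)]
      gcongr
    have h4 : 0 ≤ |M₁| / R * |wall h x| := by positivity
    rw [Real.norm_eq_abs] at h1
    linarith [le_abs_self M₀]
  · obtain ⟨z, hz0, hseg, hdist⟩ := hΩ.exists_radial_segment hx.le hp
    have hsegD : segment ℝ x z ⊆ D := fun y hy => (hseg y hy).1
    have h1 := (convex_segment x z).norm_image_sub_le_of_norm_hasFDerivWithin_le
      (f := Q) (f' := fderivWithin ℝ Q D) (C := |M₁|)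
      (fun y hy => ((hQ1.differentiableOn (by norm_num) y (hsegD hy)).hasFDerivWithinAt).mono hsegD)
      (fun y hy => (hM₁ y (hball y (hsegD hy) (hseg y hy).2)).trans (le_abs_self _))
      (left_mem_segment ℝ x z) (right_mem_segment ℝ x z)
    have h2 : Q z = 0 := (hn z hz0).fderivWithin_eq (hU z hz0.le)
    rw [h2, zero_sub, norm_neg, Real.norm_eq_abs] at h1
    have h3 : |M₁| * ‖z - x‖ ≤ |M₁| / R * |wall h x| := by
      rw [div_mul_eq_mul_div, le_div_iff₀ hR, mul_assoc, mul_comm ‖z - x‖]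
      gcongr
    have h4 : 0 ≤ |M₀| / R ^ 2 * |wall h x| := by positivity
    linarith

end NormalDerivative

section Stability

variable {d : ℕ}

lemma integral_fderiv_apply_eq_zero {F : Euc d → ℝ} (hF : ContDiff ℝ 1 F)
    (hc : HasCompactSupport F) (v : Euc d) : ∫ x, fderiv ℝ F x v = 0 := by
  have hi : Integrable fun x => fderiv ℝ F x v :=
    ((hF.continuous_fderiv (by norm_num)).clm_apply
      continuous_const).integrable_of_hasCompactSupport (hc.fderiv_apply (𝕜 := ℝ) v)
  have hF1 : Integrable F := hF.continuous.integrable_of_hasCompactSupport hc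
  have h1 := integral_mul_fderiv_eq_neg_fderiv_mul_of_integrable (μ := volume)
    (f := fun _ : Euc d => (1 : ℝ)) (g := F) (v := v) (by simp) (by simpa using hi)
    (by simpa using hF1) (fun x _ => differentiableAt_const _)
    (fun x _ => hF.differentiable (by norm_num) x)
  simpa using h1

lemma integrableOn_of_continuousOn {D : Set (Euc d)} (hD : IsClosed D) {A ψ : Euc d → ℝ}
    (hA : ContinuousOn A D) (hψ : HasCompactSupport ψ) (h0 : ∀ x ∉ tsupport ψ, A x = 0) :
    IntegrableOn A D := by
  have hK : IsCompact (D ∩ tsupport ψ) := IsCompact.inter_left hψ hD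
  refine ((hA.mono inter_subset_left).integrableOn_compact hK).of_forall_sdiff_eq_zero
    hD.measurableSet fun x hx => h0 x fun h => hx.2 ⟨hx.1, h⟩

lemma gradient_eq_zero_of_notMem_tsupport {ψ : Euc d → ℝ} {x : Euc d} (hx : x ∉ tsupport ψ) :
    gradient ψ x = 0 := by
  have h1 : fderiv ℝ ψ x = 0 := by
    by_contra h
    exact hx (support_fderiv_subset ℝ h)
  simp [gradient, h1]

lemma deriv_smoothTransition_of_one_lt {y : ℝ} (hy : 1 < y) :
    deriv Real.smoothTransition y = 0 := by
  have : Real.smoothTransition =ᶠ[𝓝 y] fun _ => 1 := by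
    filter_upwards [Ioi_mem_nhds hy] with z hz
    exact Real.smoothTransition.one_of_one_le (le_of_lt hz)
  rw [this.deriv_eq, deriv_const]

lemma exists_bound_mul_deriv_smoothTransition :
    ∃ M : ℝ, ∀ τ : ℝ, |τ * deriv Real.smoothTransition (τ - 1)| ≤ M := by
  have hc : Continuous (deriv Real.smoothTransition) :=
    (Real.smoothTransition.contDiff (n := 1)).continuous_deriv (by norm_num)
  obtain ⟨M, hM⟩ := (isCompact_Icc (a := (1 : ℝ)) (b := 2)).exists_bound_of_continuousOn
    (f := fun τ : ℝ => τ * deriv Real.smoothTransition (τ - 1)) (by fun_prop)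
  refine ⟨max M 0, fun τ => ?_⟩
  by_cases hτ : τ ∈ Icc (1 : ℝ) 2
  · exact (hM τ hτ).trans (le_max_left _ _)
  · have h0 : deriv Real.smoothTransition (τ - 1) = 0 := by
      rcases lt_or_ge τ 1 with h1 | h1
      · have : Real.smoothTransition =ᶠ[𝓝 (τ - 1)] fun _ => 0 := by
          filter_upwards [Iio_mem_nhds (show τ - 1 < 0 by linarith)] with y hy
          exact Real.smoothTransition.zero_of_nonpos (le_of_lt hy)
        rw [this.deriv_eq, deriv_const]
      · have h2 : 2 < τ := not_le.1 fun h2 => hτ ⟨h1, h2⟩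
        exact deriv_smoothTransition_of_one_lt (by linarith)
    simp [h0]

lemma sum_fderiv_mul_fderiv (a w : Euc d → ℝ) (x : Euc d) :
    ∑ i, fderiv ℝ a x (EuclideanSpace.single i 1) * fderiv ℝ w x (EuclideanSpace.single i 1) =
      fderiv ℝ a x (gradient w x) := by
  have hs : gradient w x = ∑ i, gradient w x i • EuclideanSpace.single i (1 : ℝ) := by
    ext j; simp [Finset.sum_apply, Pi.single_apply]
  conv_rhs => rw [hs, map_sum]
  refine Finset.sum_congr rfl fun i _ => ?_
  rw [map_smul, smul_eq_mul, gradient_apply_coord, mul_comm]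

/-- Pointwise divergence inequality for the field `ζ ψ² (w + ε)⁻¹ ∇w`. -/
lemma sum_fderiv_field_le {w ψ ζ : Euc d → ℝ} {x : Euc d} {ε q E : ℝ} (hε : 0 < ε)
    (hw : ContDiffAt ℝ 2 w x) (hψ : DifferentiableAt ℝ ψ x) (hζ : DifferentiableAt ℝ ζ x)
    (hw0 : 0 ≤ w x) (hζ0 : 0 ≤ ζ x) (hq : lap w x ≤ -q)
    (hE : |fderiv ℝ ζ x (gradient w x)| ≤ E) :
    ∑ i, fderiv ℝ (fun y => ζ y * (ψ y ^ 2 / (w y + ε)) *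
        fderiv ℝ w y (EuclideanSpace.single i 1)) x (EuclideanSpace.single i 1) ≤
      ζ x * (‖gradient ψ x‖ ^ 2 - q / (w x + ε) * ψ x ^ 2) + ψ x ^ 2 / ε * E := by
  have hwe : 0 < w x + ε := by linarith
  have hwd : DifferentiableAt ℝ w x := hw.differentiableAt (by norm_num)
  set p : Euc d → ℝ := fun y => ψ y ^ 2 / (w y + ε) with hp
  have hpd : HasFDerivAt p ((w x + ε)⁻¹ ^ 2 • ((w x + ε) • ((2 * ψ x) • fderiv ℝ ψ x) -
      (ψ x ^ 2) • fderiv ℝ w x)) x := by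
    have hinv : HasFDerivAt (fun y => (w y + ε)⁻¹) (-((w x + ε) ^ 2)⁻¹ • fderiv ℝ w x) x :=
      (hasDerivAt_inv hwe.ne').comp_hasFDerivAt x (hwd.hasFDerivAt.add_const ε)
    have h1 := (HasFDerivAt.pow hψ.hasFDerivAt 2).fun_mul hinv
    simp only [hp, div_eq_mul_inv]
    refine h1.congr_fderiv ?_
    ext v
    simp only [add_apply, smul_apply, sub_apply, smul_eq_mul, nsmul_eq_mul]
    push_cast
    field_simp
    ring
  set a : Euc d → ℝ := fun y => ζ y * p y with ha
  have had : HasFDerivAt a (ζ x • _ + p x • fderiv ℝ ζ x) x := hζ.hasFDerivAt.mul hpd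
  have hdiv : ∑ i, fderiv ℝ (fun y => a y * fderiv ℝ w y (EuclideanSpace.single i 1)) x
      (EuclideanSpace.single i 1) = fderiv ℝ a x (gradient w x) + a x * lap w x := by
    rw [← sum_fderiv_mul_fderiv, lap, Finset.mul_sum, ← Finset.sum_add_distrib]
    refine Finset.sum_congr rfl fun i _ => ?_
    rw [fderiv_fun_mul had.differentiableAt (hw.differentiableAt_fderiv_apply _)]
    simp only [add_apply, smul_apply, smul_eq_mul]
    ring
  rw [hdiv, had.fderiv]
  simp only [add_apply, smul_apply, sub_apply, smul_eq_mul, fderiv_gradient_self]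
  rw [← gradient_apply_eq ψ]
  have h1 : 0 ≤ ‖gradient ψ x - (ψ x / (w x + ε)) • gradient w x‖ ^ 2 := sq_nonneg _
  rw [norm_sub_sq_real, real_inner_smul_right, norm_smul, mul_pow, Real.norm_eq_abs, sq_abs] at h1
  set I := inner ℝ (gradient ψ x) (gradient w x)
  set N := ‖gradient w x‖ ^ 2
  have h2 : (w x + ε)⁻¹ ^ 2 * ((w x + ε) * (2 * ψ x * I) - ψ x ^ 2 * N) ≤
      ‖gradient ψ x‖ ^ 2 := by
    have : (w x + ε)⁻¹ ^ 2 * ((w x + ε) * (2 * ψ x * I) - ψ x ^ 2 * N) =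
        2 * (ψ x / (w x + ε) * I) - (ψ x / (w x + ε)) ^ 2 * N := by
      field_simp
    rw [this]; linarith
  have hp0 : 0 ≤ p x := div_nonneg (sq_nonneg _) hwe.le
  have h3 : a x * lap w x ≤ ζ x * (-(q / (w x + ε) * ψ x ^ 2)) := by
    have : ζ x * (-(q / (w x + ε) * ψ x ^ 2)) = a x * (-q) := by
      simp only [ha, hp]; ring
    rw [this]
    exact mul_le_mul_of_nonneg_left hq (mul_nonneg hζ0 hp0)
  have h4 : p x * fderiv ℝ ζ x (gradient w x) ≤ ψ x ^ 2 / ε * E := by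
    have h5 : p x ≤ ψ x ^ 2 / ε := by
      simp only [hp]; gcongr; linarith
    calc _ ≤ p x * |fderiv ℝ ζ x (gradient w x)| := by gcongr; exact le_abs_self _
      _ ≤ _ := mul_le_mul h5 hE (abs_nonneg _) (by positivity)
  have h6 := mul_le_mul_of_nonneg_left h2 hζ0
  linarith

end Stability

section StabilityInequality

variable {d : ℕ}

lemma contDiff_smoothTransition_mul {b g : Euc d → ℝ} (hb : ContDiff ℝ 1 b)
    (hg : ∀ x, b x < 0 → ContDiffAt ℝ 1 g x) (k : ℕ) :
    ContDiff ℝ 1 fun x => Real.smoothTransition (-(k : ℝ) * b x - 1) * g x := by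
  refine contDiff_iff_contDiffAt.2 fun x => ?_
  rcases lt_or_ge (b x) 0 with hx | hx
  · exact ((Real.smoothTransition.contDiff (n := 1)).comp
      ((contDiff_const.mul hb).sub contDiff_const)).contDiffAt.mul (hg x hx)
  · have hk : 0 ≤ (k : ℝ) * b x := by positivity
    have hc : Continuous fun y => -(k : ℝ) * b y - 1 := by
      have := hb.continuous
      fun_prop
    have h0 : (fun y => Real.smoothTransition (-(k : ℝ) * b y - 1) * g y) =ᶠ[𝓝 x]
        fun _ => 0 := by
      filter_upwards [hc.continuousAt.eventually_lt continuousAt_const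
        (show -(k : ℝ) * b x - 1 < 0 by linarith)] with y hy
      rw [Real.smoothTransition.zero_of_nonpos hy.le, zero_mul]
    exact contDiffAt_const.congr_of_eventuallyEq h0

lemma fderiv_smoothTransition_apply {b : Euc d → ℝ} (hb : Differentiable ℝ b) (k : ℝ)
    (x v : Euc d) :
    fderiv ℝ (fun y => Real.smoothTransition (-k * b y - 1)) x v =
      deriv Real.smoothTransition (-k * b x - 1) * (-k * fderiv ℝ b x v) := by
  have h1 : HasFDerivAt (fun y => -k * b y - 1) (-k • fderiv ℝ b x) x :=
    ((hb x).hasFDerivAt.const_mul (-k)).sub_const 1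
  have h2 : HasDerivAt Real.smoothTransition (deriv Real.smoothTransition (-k * b x - 1))
      (-k * b x - 1) :=
    ((Real.smoothTransition.contDiff (n := 1)).differentiable (by norm_num) _).hasDerivAt
  have h3 := HasDerivAt.comp_hasFDerivAt (f := fun y => -k * b y - 1) x h2 h1
  rw [show (fun y => Real.smoothTransition (-k * b y - 1)) =
    Real.smoothTransition ∘ fun y => -k * b y - 1 from rfl, h3.fderiv]
  simp

lemma tendsto_nat_neg_mul_sub {y : ℝ} (hy : y < 0) :
    Tendsto (fun k : ℕ => -(k : ℝ) * y - 1) atTop atTop := by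
  have h1 : Tendsto (fun k : ℕ => (k : ℝ) * (-y)) atTop atTop :=
    tendsto_natCast_atTop_atTop.atTop_mul_const (by linarith)
  simpa [sub_eq_add_neg] using tendsto_atTop_add_const_right atTop (-1 : ℝ) h1

/-- The divergence theorem for `ζ ψ² (w + ε)⁻¹ ∇w`, with the cutoff `ζ` supported in
`{b < 0}` at distance of order `1 / k` from the boundary. -/
lemma integral_cutoff_nonneg {b w q ψ : Euc d → ℝ} {ε C : ℝ} (hb : ContDiff ℝ 2 b) (hε : 0 < ε)
    (hw : ∀ x, b x < 0 → ContDiffAt ℝ 2 w x) (hwc : ContinuousOn w {x | b x ≤ 0})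
    (hw0 : ∀ x, b x ≤ 0 → 0 ≤ w x) (hqc : ContinuousOn q {x | b x ≤ 0})
    (hlap : ∀ x, b x < 0 → lap w x ≤ -q x)
    (hC : ∀ x ∈ tsupport ψ, b x < 0 → |fderiv ℝ w x (gradient b x)| ≤ C * |b x|)
    (hψ : ContDiff ℝ 1 ψ) (hψc : HasCompactSupport ψ) (k : ℕ) :
    0 ≤ ∫ x in {x | b x < 0}, (Real.smoothTransition (-(k : ℝ) * b x - 1) *
      (‖gradient ψ x‖ ^ 2 - q x / (w x + ε) * ψ x ^ 2) + ψ x ^ 2 / ε *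
      (C * |(-(k : ℝ) * b x) * deriv Real.smoothTransition (-(k : ℝ) * b x - 1)|)) := by
  have hD : IsClosed {x | b x ≤ 0} := isClosed_le hb.continuous continuous_const
  have hO : IsOpen {x | b x < 0} := isOpen_lt hb.continuous continuous_const
  have hOD : {x | b x < 0} ⊆ {x | b x ≤ 0} := fun x hx => le_of_lt (show b x < 0 from hx)
  have hbd : Differentiable ℝ b := hb.differentiable (by norm_num)
  set ζ : Euc d → ℝ := fun x => Real.smoothTransition (-(k : ℝ) * b x - 1) with hζ
  have hζ1 : ContDiff ℝ 1 ζ := (Real.smoothTransition.contDiff (n := 1)).comp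
    ((contDiff_const.mul (hb.of_le (by norm_num))).sub contDiff_const)
  set F : Fin (d + 1) → Euc d → ℝ := fun i y => ζ y * (ψ y ^ 2 / (w y + ε)) *
    fderiv ℝ w y (EuclideanSpace.single i 1) with hF
  have hFc : ∀ i, ContDiff ℝ 1 (F i) := by
    intro i
    have h1 := contDiff_smoothTransition_mul (b := b)
      (g := fun y => ψ y ^ 2 / (w y + ε) * fderiv ℝ w y (EuclideanSpace.single i 1))
      (hb.of_le (by norm_num)) (fun x hx => ?_) k
    · simpa only [hF, hζ, mul_assoc] using h1
    · have hwe : w x + ε ≠ 0 := by have := hw0 x hx.le; positivity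
      have h2 : ContDiffAt ℝ 1 (fun y => w y + ε) x :=
        ((hw x hx).of_le (by norm_num)).add contDiffAt_const
      exact ((hψ.contDiffAt.pow 2).div h2 hwe).mul
        (((hw x hx).fderiv_right (m := 1) (by norm_num)).clm_apply contDiffAt_const)
  have hFs : ∀ i, HasCompactSupport (F i) := fun i => hψc.mono fun x hx h0 => hx (by
    simp only [hF]; rw [h0]; simp)
  have hFi : ∀ i, Integrable fun x => fderiv ℝ (F i) x (EuclideanSpace.single i 1) := fun i =>
    (((hFc i).continuous_fderiv (by norm_num)).clm_apply
      continuous_const).integrable_of_hasCompactSupport ((hFs i).fderiv_apply (𝕜 := ℝ) _)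
  have hsum : ∫ x, ∑ i, fderiv ℝ (F i) x (EuclideanSpace.single i 1) = 0 := by
    rw [integral_finsetSum _ fun i _ => hFi i]
    exact Finset.sum_eq_zero fun i _ => integral_fderiv_apply_eq_zero (hFc i) (hFs i) _
  have hoff : ∀ x, x ∉ {x | b x < 0} →
      ∑ i, fderiv ℝ (F i) x (EuclideanSpace.single i 1) = 0 := by
    intro x hx
    have hx : 0 ≤ b x := not_lt.1 hx
    refine Finset.sum_eq_zero fun i _ => ?_
    have hk : 0 ≤ (k : ℝ) * b x := by positivity
    have hc : Continuous fun y => -(k : ℝ) * b y - 1 := by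
      have := hb.continuous
      fun_prop
    have h0 : F i =ᶠ[𝓝 x] fun _ => 0 := by
      filter_upwards [hc.continuousAt.eventually_lt continuousAt_const
        (show -(k : ℝ) * b x - 1 < 0 by linarith)] with y hy
      simp only [hF, hζ, Real.smoothTransition.zero_of_nonpos hy.le, zero_mul]
    rw [h0.fderiv_eq]
    simp
  rw [← setIntegral_eq_integral_of_forall_compl_eq_zero hoff] at hsum
  refine hsum.symm.le.trans ?_
  refine setIntegral_mono_on (integrable_finsetSum _ fun i _ => hFi i).integrableOn
    ?_ hO.measurableSet fun x hx => ?_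
  · refine (integrableOn_of_continuousOn hD ?_ hψc fun x hx => ?_).mono_set hOD
    · have hg : Continuous (gradient ψ) :=
        (InnerProductSpace.toDual ℝ (Euc d)).symm.continuous.comp
          (hψ.continuous_fderiv (by norm_num))
      have hs' : Continuous (deriv Real.smoothTransition) :=
        (Real.smoothTransition.contDiff (n := 1)).continuous_deriv (by norm_num)
      have hbc := hb.continuous
      have hψ0 := hψ.continuous
      have hζ0 := hζ1.continuous
      have hA : ContinuousOn (fun x => q x / (w x + ε)) {x | b x ≤ 0} :=
        hqc.div (hwc.add continuousOn_const) fun x hx => by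
          have := hw0 x hx
          positivity
      have h1 : Continuous fun x => ψ x ^ 2 / ε *
        (C * |(-(k : ℝ) * b x) * deriv Real.smoothTransition (-(k : ℝ) * b x - 1)|) := by
        fun_prop
      exact (hζ0.continuousOn.mul ((hg.norm.pow 2).continuousOn.sub
        (hA.mul (hψ0.pow 2).continuousOn))).add h1.continuousOn
    · simp [gradient_eq_zero_of_notMem_tsupport hx, image_eq_zero_of_notMem_tsupport hx]
  · have hx : b x < 0 := hx
    refine (sum_fderiv_field_le hε (hw x hx) (hψ.differentiable (by norm_num) x)
      (hζ1.differentiable (by norm_num) x) (hw0 x hx.le) (Real.smoothTransition.nonneg _)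
      (hlap x hx) le_rfl).trans ?_
    refine add_le_add le_rfl ?_
    by_cases hxs : x ∈ tsupport ψ
    · gcongr
      rw [fderiv_smoothTransition_apply hbd, ← gradient_apply_eq b, real_inner_comm,
        gradient_apply_eq w, abs_mul, abs_mul, abs_mul, abs_mul]
      have := mul_le_mul_of_nonneg_left (hC x hxs hx)
        (mul_nonneg (abs_nonneg (deriv Real.smoothTransition (-(k : ℝ) * b x - 1)))
          (abs_nonneg (-(k : ℝ))))
      linarith
    · simp [image_eq_zero_of_notMem_tsupport hxs]

/-- A positive supersolution of the linearized equation yields the stability inequality. -/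
lemma integral_gradient_sq_sub_nonneg {b w q ψ : Euc d → ℝ} {ε C : ℝ} (hb : ContDiff ℝ 2 b)
    (hε : 0 < ε)
    (hw : ∀ x, b x < 0 → ContDiffAt ℝ 2 w x) (hwc : ContinuousOn w {x | b x ≤ 0})
    (hw0 : ∀ x, b x ≤ 0 → 0 ≤ w x) (hqc : ContinuousOn q {x | b x ≤ 0})
    (hlap : ∀ x, b x < 0 → lap w x ≤ -q x)
    (hC0 : 0 ≤ C)
    (hC : ∀ x ∈ tsupport ψ, b x < 0 → |fderiv ℝ w x (gradient b x)| ≤ C * |b x|)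
    (hψ : ContDiff ℝ 1 ψ) (hψc : HasCompactSupport ψ) :
    0 ≤ ∫ x in {x | b x < 0}, (‖gradient ψ x‖ ^ 2 - q x / (w x + ε) * ψ x ^ 2) := by
  have hD : IsClosed {x | b x ≤ 0} := isClosed_le hb.continuous continuous_const
  have hO : IsOpen {x | b x < 0} := isOpen_lt hb.continuous continuous_const
  have hOD : {x | b x < 0} ⊆ {x | b x ≤ 0} := fun x hx => le_of_lt (show b x < 0 from hx)
  obtain ⟨M, hM⟩ := exists_bound_mul_deriv_smoothTransition
  have hg : Continuous (gradient ψ) :=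
    (InnerProductSpace.toDual ℝ (Euc d)).symm.continuous.comp
      (hψ.continuous_fderiv (by norm_num))
  have hs' : Continuous (deriv Real.smoothTransition) :=
    (Real.smoothTransition.contDiff (n := 1)).continuous_deriv (by norm_num)
  have hs : Continuous Real.smoothTransition := Real.smoothTransition.continuous
  have hbc := hb.continuous
  have hψ0 := hψ.continuous
  have hA : ContinuousOn (fun x => ‖gradient ψ x‖ ^ 2 - q x / (w x + ε) * ψ x ^ 2)
      {x | b x ≤ 0} := by
    refine (hg.norm.pow 2).continuousOn.sub ((hqc.div (hwc.add continuousOn_const)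
      fun x hx => ?_).mul (hψ0.pow 2).continuousOn)
    have := hw0 x hx
    exact (show 0 < w x + ε by linarith).ne'
  have hAi : IntegrableOn (fun x => ‖gradient ψ x‖ ^ 2 - q x / (w x + ε) * ψ x ^ 2)
      {x | b x < 0} := by
    refine (integrableOn_of_continuousOn hD hA hψc fun x hx => ?_).mono_set hOD
    simp [gradient_eq_zero_of_notMem_tsupport hx, image_eq_zero_of_notMem_tsupport hx]
  have hψi : IntegrableOn (fun x => ψ x ^ 2 / ε * (C * M)) {x | b x < 0} := by
    refine (integrableOn_of_continuousOn hD (by fun_prop) hψc fun x hx => ?_).mono_set hOD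
    simp [image_eq_zero_of_notMem_tsupport hx]
  refine ge_of_tendsto' (tendsto_integral_of_dominated_convergence
    (fun x => |‖gradient ψ x‖ ^ 2 - q x / (w x + ε) * ψ x ^ 2| + ψ x ^ 2 / ε * (C * M))
    (fun k => ?_) (hAi.abs.add hψi) (fun k => ?_) ?_)
    (integral_cutoff_nonneg hb hε hw hwc hw0 hqc hlap hC hψ hψc)
  · have h1 : Continuous fun x => ψ x ^ 2 / ε *
      (C * |(-(k : ℝ) * b x) * deriv Real.smoothTransition (-(k : ℝ) * b x - 1)|) := by
      fun_prop
    have h2 : Continuous fun x => Real.smoothTransition (-(k : ℝ) * b x - 1) := by fun_prop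
    exact (((h2.continuousOn.mul hA).add h1.continuousOn).mono
      hOD).aestronglyMeasurable hO.measurableSet
  · refine Eventually.of_forall fun x => ?_
    refine (norm_add_le _ _).trans ?_
    rw [norm_mul, Real.norm_eq_abs, Real.norm_eq_abs, abs_of_nonneg
      (Real.smoothTransition.nonneg _), Real.norm_eq_abs,
      abs_of_nonneg (a := ψ x ^ 2 / ε * _) (by positivity)]
    gcongr
    · exact mul_le_of_le_one_left (abs_nonneg _) (Real.smoothTransition.le_one _)
    · exact hM _
  · refine (ae_restrict_mem hO.measurableSet).mono fun x hx => ?_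
    refine tendsto_const_nhds.congr' ?_
    filter_upwards [(tendsto_nat_neg_mul_sub hx).eventually_gt_atTop 1] with k hk
    rw [Real.smoothTransition.one_of_one_le hk.le, deriv_smoothTransition_of_one_lt hk]
    simp

end StabilityInequality

section Limits

variable {f φ h : ℝ → ℝ} {θ c R α L : ℝ} {d : ℕ} {u : ℝ → Euc d → ℝ} {uinf : Euc d → ℝ}

lemma dilate_dilate (s r : ℝ) (x : Euc d) : dilate s (dilate r x) = dilate (s * r) x := by
  ext i
  induction i using Fin.cases with
  | zero => simp only [dilate_zero]
  | succ i => simp only [dilate_succ, mul_assoc]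

lemma IsFunnel.volume_frontier (hΩ : IsFunnel d R α L h) :
    volume (frontier (funnel d h)) = 0 := by
  set g : Euc d → ℝ := fun x => (wall h x + h (x 0) ^ 2) / h (x 0) ^ 2 with hg
  have hgm : Measurable g := by
    have h1 := (contDiff_wall (d := d) hΩ.smooth).continuous
    have h2 := hΩ.smooth.continuous
    exact (h1.measurable.add (by fun_prop)).div (by fun_prop)
  have hcount := Measure.countable_meas_level_set_pos (μ := volume) hgm
  obtain ⟨t, ht0, ht⟩ : ∃ t, 0 < t ∧ volume {x | g x = t} = 0 := by
    by_contra! H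
    have hI : (Ioi (0 : ℝ)).Countable := hcount.mono fun t ht => pos_iff_ne_zero.2 (H t ht)
    rw [← Cardinal.le_aleph0_iff_set_countable, Cardinal.mk_Ioi_real] at hI
    exact hI.not_gt Cardinal.aleph0_lt_continuum
  have hd : Differentiable ℝ (dilate (√t)⁻¹ : Euc d → Euc d) := by
    unfold dilate; fun_prop
  refine measure_mono_null (fun x hx => ?_)
    (addHaar_image_eq_zero_of_differentiableOn_of_addHaar_eq_zero volume
      hd.differentiableOn ht)
  have hs := Real.sqrt_pos.2 ht0
  have hp := hΩ.pos (x 0)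
  rw [hΩ.frontier_eq] at hx
  have hx0 : primeNorm x ^ 2 = h (x 0) ^ 2 := by
    have : wall h x = 0 := hx
    rw [wall_eq] at this
    linarith
  refine ⟨dilate (√t) x, ?_, ?_⟩
  · simp only [mem_ofPred_eq, hg, wall_dilate, dilate_zero, hx0, Real.sq_sqrt ht0.le]
    field_simp
    ring
  · rw [dilate_dilate, inv_mul_cancel₀ hs.ne', dilate_one]

lemma integral_nonneg_of_tendsto {O : Set (Euc d)} (hO : MeasurableSet O) {ψ a : Euc d → ℝ}
    {A : ℕ → Euc d → ℝ} {K : ℝ} (hψ : ContDiff ℝ 1 ψ) (hψc : HasCompactSupport ψ)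
    (hA : ∀ n, ContinuousOn (A n) O) (hK : ∀ n, ∀ x ∈ O, |A n x| ≤ K)
    (hlim : ∀ x ∈ O, Tendsto (fun n => A n x) atTop (𝓝 (a x)))
    (h0 : ∀ n, 0 ≤ ∫ x in O, (‖gradient ψ x‖ ^ 2 - A n x * ψ x ^ 2)) :
    0 ≤ ∫ x in O, (‖gradient ψ x‖ ^ 2 - a x * ψ x ^ 2) := by
  have hg : Continuous (gradient ψ) :=
    (InnerProductSpace.toDual ℝ (Euc d)).symm.continuous.comp
      (hψ.continuous_fderiv (by norm_num))
  have hψ0 := hψ.continuous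
  have hbi : IntegrableOn (fun x => ‖gradient ψ x‖ ^ 2 + K * ψ x ^ 2) O := by
    refine (integrableOn_of_continuousOn isClosed_univ (by fun_prop) hψc
      fun x hx => ?_).mono_set (subset_univ O)
    simp [gradient_eq_zero_of_notMem_tsupport hx, image_eq_zero_of_notMem_tsupport hx]
  refine ge_of_tendsto' (tendsto_integral_of_dominated_convergence
    (fun x => ‖gradient ψ x‖ ^ 2 + K * ψ x ^ 2) (fun n => ?_) hbi (fun n => ?_) ?_) h0
  · exact ((hg.norm.pow 2).continuousOn.sub
      ((hA n).mul (hψ0.pow 2).continuousOn)).aestronglyMeasurable hO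
  · refine (ae_restrict_mem hO).mono fun x hx => (norm_sub_le _ _).trans ?_
    rw [norm_mul, Real.norm_eq_abs, Real.norm_eq_abs, Real.norm_eq_abs,
      abs_of_nonneg (sq_nonneg _), abs_of_nonneg (sq_nonneg (ψ x))]
    gcongr
    exact hK n x hx
  · exact (ae_restrict_mem hO).mono fun x hx => tendsto_const_nhds.sub ((hlim x hx).mul_const _)

/-- The stability inequality with `f'(u_∞)` replaced by a regularized difference quotient. -/
lemma IsEntireSolution.integral_quotient_nonneg (hf : Bistable f θ) (hφ : PlanarFront f θ c φ)
    (hΩ : IsFunnel d R α L h) (hu : IsEntireSolution d h f c φ u)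
    (hreg : ContDiffOn ℝ 2 uinf (closure (funnel d h)))
    (hpde : ∀ x ∈ closure (funnel d h), lapW (closure (funnel d h)) uinf x + f (uinf x) = 0)
    (hneu : ∀ x ∈ frontier (funnel d h), neumannLHS h uinf x = 0)
    (hle : ∀ t, ∀ x ∈ closure (funnel d h), u t x ≤ uinf x) (t : ℝ) {ε : ℝ} (hε : 0 < ε)
    {ψ : Euc d → ℝ} (hψ : ContDiff ℝ 1 ψ) (hψc : HasCompactSupport ψ) :
    0 ≤ ∫ x in {x | wall h x < 0}, (‖gradient ψ x‖ ^ 2 -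
      (f (uinf x) - f (u t x)) / (uinf x - u t x + ε) * ψ x ^ 2) := by
  have hD := hΩ.closure_eq
  have hreg' : ContDiffOn ℝ 2 uinf {x | wall h x ≤ 0} := hD ▸ hreg
  have hut : ContDiffOn ℝ 2 (u t) {x | wall h x ≤ 0} := hD ▸ hu.space_reg t
  have hw : ContDiffOn ℝ 2 (fun x => uinf x - u t x) {x | wall h x ≤ 0} := hreg'.sub hut
  have hsm : ∀ x, wall h x < 0 → ContDiffAt ℝ 2 uinf x := fun x hx =>
    hreg.contDiffAt (mem_interior_iff_mem_nhds.1 (hΩ.mem_interior hx))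
  have hn : ∀ x, wall h x = 0 → NeumannAt (wall h) (fun y => uinf y - u t y) x := fun x hx =>
    (hΩ.neumannAt hx ((hreg.differentiableOn (by norm_num)) x (hD ▸ hx.le))
      (hneu x (hΩ.frontier_eq ▸ hx))).sub (hu.neumannAt hΩ t hx)
  obtain ⟨r, hr⟩ := hψc.isBounded.exists_norm_le
  obtain ⟨C, hC0, hC⟩ := hΩ.exists_bound_normal_derivative hw hn r
  refine integral_gradient_sq_sub_nonneg (w := fun x => uinf x - u t x)
    (q := fun x => f (uinf x) - f (u t x)) (contDiff_wall hΩ.smooth) hε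
    (fun x hx => (hsm x hx).sub (hu.contDiffAt hΩ t hx)) hw.continuousOn
    (fun x hx => sub_nonneg.2 (hle t x (hD ▸ hx)))
    ((hf.smooth.continuous.comp_continuousOn hreg'.continuousOn).sub
      (hf.smooth.continuous.comp_continuousOn hut.continuousOn))
    (fun x hx => ?_) hC0 (fun x hxs hx => hC x hx (hr x hxs)) hψ hψc
  have hxD : x ∈ closure (funnel d h) := hD ▸ hx.le
  have h1 := hpde x hxD
  rw [lapW_eq_lap (hΩ.mem_interior hx)] at h1
  have h2 := hu.deriv_eq hΩ t hx
  have h3 : 0 ≤ deriv (fun s => u s x) t := (hu.monotone hf hφ hΩ hx.le).deriv_nonneg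
  rw [lap_sub (hsm x hx) (hu.contDiffAt hΩ t hx)]
  linarith

lemma abs_div_add_le {a b K ε : ℝ} (hK : 0 ≤ K) (hb : 0 ≤ b) (hε : 0 ≤ ε) (hab : |a| ≤ K * |b|) :
    |a / (b + ε)| ≤ K := by
  rw [abs_div, abs_of_nonneg (add_nonneg hb hε)]
  refine div_le_of_le_mul₀ (add_nonneg hb hε) hK (hab.trans ?_)
  rw [abs_of_nonneg hb]
  gcongr
  linarith

end Limits

/-- Lemma 3.6: the large-time limit `u_∞` of the entire solution emanating
from the planar front is a stable solution of `Δu_∞ + f(u_∞) = 0` in `Ω̄`. -/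
theorem statement14 (d : ℕ) (f φ h : ℝ → ℝ) (θ c R α L : ℝ)
    (hf : Bistable f θ) (hφ : PlanarFront f θ c φ) (hΩ : IsFunnel d R α L h)
    (u : ℝ → Euc d → ℝ) (hu : IsEntireSolution d h f c φ u)
    (uinf : Euc d → ℝ)
    (hlim : TendstoLocallyUniformlyOn u uinf atTop (closure (funnel d h)))
    (hreg : ContDiffOn ℝ 2 uinf (closure (funnel d h)))
    (hrange : ∀ x ∈ closure (funnel d h), uinf x ∈ Ioc (0 : ℝ) 1)
    (hpde : ∀ x ∈ closure (funnel d h), lapW (closure (funnel d h)) uinf x + f (uinf x) = 0)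
    (hneu : ∀ x ∈ frontier (funnel d h), neumannLHS h uinf x = 0) :
    StableOn (closure (funnel d h)) f uinf := by
  intro ψ hψ hψc
  obtain ⟨K, hK0, -, hK⟩ := hf.exists_lipschitz
  have hD := hΩ.closure_eq
  have hOD : ∀ x, wall h x < 0 → x ∈ closure (funnel d h) := fun x hx => hD ▸ hx.le
  have hO : MeasurableSet {x : Euc d | wall h x < 0} :=
    (isOpen_lt (contDiff_wall hΩ.smooth).continuous continuous_const).measurableSet
  have htend : ∀ x ∈ closure (funnel d h), Tendsto (fun t => u t x) atTop (𝓝 (uinf x)) :=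
    fun x hx => hlim.tendsto_at hx
  have hle : ∀ t, ∀ x ∈ closure (funnel d h), u t x ≤ uinf x := fun t x hx =>
    (hu.monotone hf hφ hΩ (show x ∈ {x | wall h x ≤ 0} from hD ▸ hx)).ge_of_tendsto (htend x hx) t
  have hlt : ∀ t x, wall h x < 0 → u t x < uinf x := fun t x hx =>
    hu.lt_of_stationary hf hφ hΩ hreg hrange hpde hle t hx
  have hKq : ∀ t x, wall h x < 0 → |f (uinf x) - f (u t x)| ≤ K * |uinf x - u t x| :=
    fun t x hx => hK _ (Ioc_subset_Icc_self (hrange x (hOD x hx))) _ (hu.range hΩ t hx.le)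
  have hfu : ContinuousOn (fun x => f (uinf x)) {x | wall h x < 0} :=
    hf.smooth.continuous.comp_continuousOn (hreg.continuousOn.mono hOD)
  have huc : ∀ t, ContinuousOn (u t) {x | wall h x < 0} := fun t =>
    (hu.space_reg t).continuousOn.mono hOD
  have hqc : ∀ t, ContinuousOn (fun x => f (uinf x) - f (u t x)) {x | wall h x < 0} := fun t =>
    hfu.sub (hf.smooth.continuous.comp_continuousOn (huc t))
  have hwc : ∀ t, ContinuousOn (fun x => uinf x - u t x) {x | wall h x < 0} := fun t =>
    (hreg.continuousOn.mono hOD).sub (huc t)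
  have hquot : ∀ t, 0 ≤ ∫ x in {x | wall h x < 0}, (‖gradient ψ x‖ ^ 2 -
      (f (uinf x) - f (u t x)) / (uinf x - u t x) * ψ x ^ 2) := by
    intro t
    refine integral_nonneg_of_tendsto hO hψ hψc (A := fun (n : ℕ) x =>
      (f (uinf x) - f (u t x)) / (uinf x - u t x + 1 / ((n : ℝ) + 1))) (K := K)
      (fun n => (hqc t).div ((hwc t).add continuousOn_const) fun x hx => ?_)
      (fun n x hx => abs_div_add_le hK0 (sub_pos.2 (hlt t x hx)).le (by positivity) (hKq t x hx))
      (fun x hx => ?_)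
      fun n => hu.integral_quotient_nonneg hf hφ hΩ hreg hpde hneu hle t (by positivity) hψ hψc
    · exact (add_pos (sub_pos.2 (hlt t x hx)) (by positivity)).ne'
    · have h1 : Tendsto (fun n : ℕ => uinf x - u t x + 1 / ((n : ℝ) + 1)) atTop
          (𝓝 (uinf x - u t x)) := by
        simpa using tendsto_one_div_add_atTop_nhds_zero_nat.const_add (uinf x - u t x)
      exact tendsto_const_nhds.div h1 (sub_pos.2 (hlt t x hx)).ne'
  have hfun : funnel d h =ᵐ[volume] closure (funnel d h) := by
    rw [ae_eq_set]
    refine ⟨by simp [sdiff_eq_empty.2 (subset_closure (s := funnel d h))], ?_⟩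
    rw [← hΩ.isOpen.frontier_eq]
    exact hΩ.volume_frontier
  rw [← setIntegral_congr_set hfun, hΩ.funnel_eq]
  refine integral_nonneg_of_tendsto hO hψ hψc (A := fun (n : ℕ) x =>
    (f (uinf x) - f (u n x)) / (uinf x - u n x)) (K := K)
    (fun n => (hqc n).div (hwc n) fun x hx => (sub_pos.2 (hlt n x hx)).ne')
    (fun n x hx => by
      simpa using abs_div_add_le hK0 (sub_pos.2 (hlt n x hx)).le le_rfl (hKq n x hx))
    (fun x hx => ?_) fun n => hquot n
  have h1 : Tendsto (fun n : ℕ => u n x) atTop (𝓝[≠] uinf x) :=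
    tendsto_nhdsWithin_iff.2 ⟨(htend x (hOD x hx)).comp tendsto_natCast_atTop_atTop,
      Eventually.of_forall fun n => (hlt n x hx).ne⟩
  have h2 := (hasDerivAt_iff_tendsto_slope.1
    (hf.smooth.differentiable (by norm_num) (uinf x)).hasDerivAt).comp h1
  refine h2.congr fun n => ?_
  rw [Function.comp_apply, slope_comm, slope_def_field]
end
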